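/- There exist absolute constants C, c > 0 such that the following holds. Let q ≤ N be positive integers, δ > 0, and let f : ℤ → ℂ be a 1-bounded function supported in [N]. Suppose that ‖f‖_{q,N} ≥ δ. Then either N ≤ C (q/δ)^C, or there exist 1-bounded local functions φ₁ and φ₂, of resolution at least c (δ/q)^C N^{1/2} and moduli qq₁ and qq₂ respectively, for some positive integers q₁, q₂ ≤ C δ^{-C}, such that |∑_{x∈[N]} f(x) φ₁(x) φ₂(x)| ≥ c δ^C N. -/

import Mathlib

/-- The counting operator `Λ_{q,N}(f₀,f₁,f₂) = 𝔼_{x∈[N]} 𝔼_{y∈[M]} f₀(x) f₁(x+y) f₂(x+qy²)`,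
where `M = ⌊√(N/q)⌋`. -/
noncomputable def cntOp (q N : ℕ) (f₀ f₁ f₂ : ℤ → ℂ) : ℂ :=
  (∑ x ∈ Finset.Icc (1 : ℤ) (N : ℤ), ∑ y ∈ Finset.Icc (1 : ℤ) ((Nat.sqrt (N / q) : ℕ) : ℤ),
      f₀ x * f₁ (x + y) * f₂ (x + (q : ℤ) * y ^ 2)) /
    ((N : ℂ) * ((Nat.sqrt (N / q) : ℕ) : ℂ))

/-- The cut norm `‖f‖_{q,N}`: the supremum of `|Λ_{q,N}(f,g₁,g₂)|`, `|Λ_{q,N}(g₁,f,g₂)|`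
and `|Λ_{q,N}(g₁,g₂,f)|` over 1-bounded `g₁, g₂` supported in `[N]`. -/
noncomputable def cutNorm (q N : ℕ) (f : ℤ → ℂ) : ℝ :=
  sSup {r : ℝ | ∃ g₁ g₂ : ℤ → ℂ,
    (∀ x, ‖g₁ x‖ ≤ 1) ∧ (∀ x, ‖g₂ x‖ ≤ 1) ∧
    (∀ x, g₁ x ≠ 0 → x ∈ Finset.Icc (1 : ℤ) (N : ℤ)) ∧
    (∀ x, g₂ x ≠ 0 → x ∈ Finset.Icc (1 : ℤ) (N : ℤ)) ∧
    (r = ‖cntOp q N f g₁ g₂‖ ∨ r = ‖cntOp q N g₁ f g₂‖ ∨ r = ‖cntOp q N g₁ g₂ f‖)}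

/-- `φ : ℤ → ℂ` is a *local function of resolution `M` and modulus `q`*. -/
def IsLocalFunction (φ : ℤ → ℂ) (M : ℝ) (q : ℕ) : Prop :=
  ∃ r : ℝ, ∀ x y : ℤ,
    ⌊((x : ℝ) - r) / M⌋ = ⌊((y : ℝ) - r) / M⌋ → x % (q : ℤ) = y % (q : ℤ) → φ x = φ y

namespace CutNorm
open Finset BigOperators ComplexConjugate
set_option linter.all false
section basic
variable {ι κ : Type} [Fintype ι] [Fintype κ]
theorem re_expect (f : ι → ℂ) : (𝔼 i, f i).re = 𝔼 i, (f i).re :=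
  map_expect (Complex.reLm.restrictScalars ℚ≥0) f univ
theorem conj_expect (f : ι → ℂ) : conj (𝔼 i, f i) = 𝔼 i, conj (f i) :=
  map_expect (starRingEnd ℂ) f univ
theorem eprod {E : Type} [AddCommMonoid E] [Module ℚ≥0 E] (f : ι × κ → E) :
    𝔼 p, f p = 𝔼 i, 𝔼 j, f (i, j) := by
  rw [← univ_product_univ, expect_product]
theorem emono {f g : ι → ℝ} (h : ∀ i, f i ≤ g i) : 𝔼 i, f i ≤ 𝔼 i, g i :=
  expect_le_expect fun i _ => h i
theorem ele [Nonempty ι] {f : ι → ℝ} {c : ℝ} (h : ∀ i, f i ≤ c) : 𝔼 i, f i ≤ c :=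
  expect_le univ_nonempty fun i _ => h i
theorem expect_nn {f : ι → ℝ} (h : ∀ i, 0 ≤ f i) : 0 ≤ 𝔼 i, f i :=
  expect_nonneg fun i _ => h i
theorem nee (f : ι → ℂ) : ‖𝔼 i, f i‖ ≤ 𝔼 i, ‖f i‖ := RCLike.norm_expect_le (K := ℂ)
theorem nel [Nonempty ι] {f : ι → ℂ} {c : ℝ} (h : ∀ i, ‖f i‖ ≤ c) : ‖𝔼 i, f i‖ ≤ c :=
  (nee f).trans (ele h)
theorem neo {f : ι → ℂ} (h : ∀ i, ‖f i‖ ≤ 1) : ‖𝔼 i, f i‖ ≤ 1 := by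
  rcases isEmpty_or_nonempty ι with ja | ja
  · simp
  · exact nel h
theorem sq_expect_le (f : ι → ℝ) : (𝔼 i, f i) ^ 2 ≤ 𝔼 i, f i ^ 2 := by
  rcases isEmpty_or_nonempty ι with ja | ja
  · simp
  · have := expect_mul_sq_le_sq_mul_sq univ f (fun _ => 1)
    simpa using this
theorem pow_expect_le (k : ℕ) (f : ι → ℝ) (hf : ∀ i, 0 ≤ f i) :
    (𝔼 i, f i) ^ (2 ^ k) ≤ 𝔼 i, f i ^ (2 ^ k) := by
  induction k with
  | zero => simp
  | succ k ih =>
    rw [pow_succ, pow_mul]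
    calc _ ≤ (𝔼 i, f i ^ 2 ^ k) ^ 2 := by
            apply pow_le_pow_left₀ _ ih
            exact pow_nonneg (expect_nn hf) _
      _ ≤ _ := by
            refine (sq_expect_le _).trans (le_of_eq ?_)
            simp [pow_mul]
theorem norm_sq_expect_le (f : ι → ℂ) : ‖𝔼 i, f i‖ ^ 2 ≤ 𝔼 i, ‖f i‖ ^ 2 :=
  (pow_le_pow_left₀ (norm_nonneg _) (nee f) 2).trans (sq_expect_le _)
theorem npe (k : ℕ) (f : ι → ℂ) : ‖𝔼 i, f i‖ ^ (2 ^ k) ≤ 𝔼 i, ‖f i‖ ^ (2 ^ k) :=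
  (pow_le_pow_left₀ (norm_nonneg _) (nee f) _).trans
    (pow_expect_le _ _ fun _ => norm_nonneg _)
theorem cs_kill (a b : ι → ℂ) (ha : ∀ i, ‖a i‖ ≤ 1) :
    ‖𝔼 i, a i * b i‖ ^ 2 ≤ 𝔼 i, ‖b i‖ ^ 2 := by
  refine (norm_sq_expect_le _).trans (emono fun i => ?_)
  rw [norm_mul]
  apply pow_le_pow_left₀ (by positivity)
  exact mul_le_of_le_one_left (norm_nonneg _) (ha i)
theorem norm_sq_re (z : ℂ) : ‖z‖ ^ 2 = (z * conj z).re := by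
  rw [Complex.mul_conj, Complex.ofReal_re, Complex.normSq_eq_norm_sq]
theorem nse (f : ι → ℂ) :
    ‖𝔼 i, f i‖ ^ 2 = (𝔼 i, 𝔼 j, f i * conj (f j)).re := by
  rw [norm_sq_re, conj_expect, expect_mul]
  simp_rw [mul_expect]
theorem eshift {G : Type} [AddCommGroup G] [Fintype G] {E : Type} [AddCommMonoid E]
    [Module ℚ≥0 E] (c : G) (f : G → E) : 𝔼 x, f (x + c) = 𝔼 x, f x :=
  Fintype.expect_equiv (Equiv.addRight c) _ _ fun _ => rfl
theorem popular [Nonempty ι] {E F : ι → ℝ} {ε η : ℝ} (hε : 0 ≤ ε) (hη : 0 ≤ η) (hE : ∀ i, E i ≤ 1)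
    (hF : ∀ i, 0 ≤ F i) (h : ∀ i, ε / 2 ≤ E i → η ≤ F i) (hh : ε ≤ 𝔼 i, E i) :
    ε / 2 * η ≤ 𝔼 i, F i := by
  have ho : 𝔼 i, (η * (E i - ε / 2)) ≤ 𝔼 i, F i := by
    refine emono fun i => ?_
    by_cases hi : ε / 2 ≤ E i
    · nlinarith [h i hi, hE i]
    · nlinarith [hF i]
  rw [← mul_expect, expect_sub_distrib, expect_const univ_nonempty] at ho
  nlinarith
theorem ege [Nonempty ι] {f : ι → ℝ} {c : ℝ} (h : c ≤ 𝔼 i, f i) : ∃ i, c ≤ f i := by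
  obtain ⟨i, _, hi⟩ := exists_le_of_le_expect univ_nonempty h
  exact ⟨i, hi⟩
theorem egn [Nonempty ι] {f : ι → ℂ} {c : ℝ} (h : c ≤ ‖𝔼 i, f i‖) :
    ∃ i, c ≤ ‖f i‖ := ege (h.trans (nee f))
theorem nml {a b : ℂ} (ha : ‖a‖ ≤ 1) (hb : ‖b‖ ≤ 1) : ‖a * b‖ ≤ 1 := by
  rw [norm_mul]; exact mul_le_one₀ ha (norm_nonneg _) hb
theorem ncl {a : ℂ} (ha : ‖a‖ ≤ 1) : ‖conj a‖ ≤ 1 := by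
  rwa [Complex.norm_conj]
theorem re_le_one {a : ℂ} (ha : ‖a‖ ≤ 1) : a.re ≤ 1 := (Complex.re_le_norm a).trans ha
end basic
section cube
variable {H : Type} [Fintype H]
theorem expect_cons {E : Type} [AddCommMonoid E] [Module ℚ≥0 E] (s : ℕ) (f : (Fin (s+1) → H) → E) :
    𝔼 h, f h = 𝔼 a, 𝔼 pm, f (Fin.cons a pm) := by
  rw [← eprod (fun p : H × (Fin s → H) => f (Fin.cons p.1 p.2))]
  exact (Fintype.expect_equiv (Fin.consEquiv fun _ => H) _ _ fun _ => rfl).symm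
def cube : (s : ℕ) → ((Fin s → H) → ℂ) → (Fin s → H) → (Fin s → H) → ℂ
  | 0, G, u, _ => G u
  | s+1, G, u, v => cube s (fun h => G (Fin.cons (u 0) h) * conj (G (Fin.cons (v 0) h)))
      (Fin.tail u) (Fin.tail v)
theorem cube_mul (s : ℕ) (F G : (Fin s → H) → ℂ) (u v) :
    cube s (fun h => F h * G h) u v = cube s F u v * cube s G u v := by
  induction s with
  | zero => rfl
  | succ s ih =>
    simp only [cube, ← ih]
    congr 1; ext h; simp only [map_mul]; ring
theorem cube_bdd (s : ℕ) (F : (Fin s → H) → ℂ) (hF : ∀ h, ‖F h‖ ≤ 1) (u v) : ‖cube s F u v‖ ≤ 1 := by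
  induction s with
  | zero => exact hF _
  | succ s ih =>
    exact ih _ (fun h => nml (hF _) (ncl (hF _))) _ _
theorem boxCS_step {X : Type} [Fintype X] (s : ℕ) (B : Fin (s+1) → X → (Fin (s+1) → H) → ℂ)
    (hB : ∀ i x h, ‖B i x h‖ ≤ 1)
    (hind : ∀ i x h pm, (∀ j, j ≠ i → h j = pm j) → B i x h = B i x pm)
    (G : X → (Fin (s+1) → H) → ℂ) :
    ‖𝔼 x, 𝔼 h, (∏ i, B i x h) * G x h‖ ^ 2 ≤
      (𝔼 p : X × H × H, 𝔼 h, (∏ i : Fin s, B i.succ p.1 (Fin.cons p.2.1 h) *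
        conj (B i.succ p.1 (Fin.cons p.2.2 h))) *
        (G p.1 (Fin.cons p.2.1 h) * conj (G p.1 (Fin.cons p.2.2 h)))).re := by
  rcases isEmpty_or_nonempty H with ja | ja
  · have : IsEmpty (Fin (s+1) → H) := ⟨fun h => ja.elim (h 0)⟩
    have jb : IsEmpty (X × H × H) := ⟨fun h => ja.elim h.2.1⟩
    simp
  obtain ⟨a0⟩ := ja
  have ea : 𝔼 x, 𝔼 h, (∏ i, B i x h) * G x h =
      𝔼 p : X × (Fin s → H), B 0 p.1 (Fin.cons a0 p.2) * 𝔼 a, (∏ i : Fin s, B i.succ p.1 (Fin.cons a p.2)) *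
        G p.1 (Fin.cons a p.2) := by
    rw [eprod]
    refine expect_congr rfl fun x _ => ?_
    rw [expect_cons, expect_comm]
    refine expect_congr rfl fun h _ => ?_
    rw [mul_expect]
    refine expect_congr rfl fun a _ => ?_
    rw [Fin.prod_univ_succ, hind 0 x (Fin.cons a0 h) (Fin.cons a h), mul_assoc]
    intro j hj
    obtain ⟨k, rfl⟩ := Fin.exists_succ_eq.mpr hj
    simp
  rw [ea]
  refine (cs_kill _ _ fun p => hB _ _ _).trans (le_of_eq ?_)
  simp_rw [nse]
  rw [← re_expect]
  congr 1
  rw [eprod, eprod]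
  refine expect_congr rfl fun x _ => ?_
  rw [eprod, expect_comm]
  refine expect_congr rfl fun a _ => ?_
  rw [expect_comm]
  refine expect_congr rfl fun b _ => ?_
  refine expect_congr rfl fun h _ => ?_
  rw [map_mul, map_prod, prod_mul_distrib]; ring
theorem boxCS (s : ℕ) : ∀ {X : Type} [Fintype X] (B : Fin (s+1) → X → (Fin (s+1) → H) → ℂ)
    (_ : ∀ i x h, ‖B i x h‖ ≤ 1)
    (_ : ∀ i x h pm, (∀ j, j ≠ i → h j = pm j) → B i x h = B i x pm)
    (G : X → (Fin (s+1) → H) → ℂ),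
    ‖𝔼 x, 𝔼 h, (∏ i, B i x h) * G x h‖ ^ (2 ^ (s+1)) ≤
      (𝔼 x, 𝔼 u, 𝔼 v, cube (s+1) (G x) u v).re := by
  have key : ∀ (s : ℕ) {X : Type} [Fintype X] (G : X → (Fin (s+1) → H) → ℂ),
     𝔼 x, 𝔼 u, 𝔼 v, cube (s+1) (G x) u v =
      𝔼 p : X × H × H, 𝔼 u, 𝔼 v, cube s (fun h => (G p.1 (Fin.cons p.2.1 h) * conj (G p.1 (Fin.cons p.2.2 h)))) u v := by
    intro s X _ G
    rw [eprod]
    refine expect_congr rfl fun x _ => ?_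
    rw [eprod, expect_cons]
    refine expect_congr rfl fun a _ => ?_
    simp_rw [expect_cons s, expect_comm (s := (univ : Finset (Fin s → H))) (t := (univ : Finset H))]
    rfl
  induction s with
  | zero =>
    intro X _ B hB hind G
    refine (boxCS_step 0 B hB hind G).trans (le_of_eq ?_)
    rw [key]
    simp [cube]
  | succ s ih =>
    intro X _ B hB hind G
    rw [key, pow_succ' 2 (s+1), pow_mul]
    refine le_trans ?_ (ih (X := X × H × H) (fun i p h => B i.succ p.1 (Fin.cons p.2.1 h) *
        conj (B i.succ p.1 (Fin.cons p.2.2 h))) ?_ ?_ _)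
    · refine pow_le_pow_left₀ (by positivity) ?_ _
      exact (boxCS_step (s+1) B hB hind G).trans (Complex.re_le_norm _)
    · intro i p h
      exact nml (hB _ _ _) (ncl (hB _ _ _))
    · intro i p h pm hh
      have : ∀ a : H, B i.succ p.1 (Fin.cons a h) = B i.succ p.1 (Fin.cons a pm) := by
        intro a
        apply hind
        intro j hj
        induction j using Fin.cases with
        | zero => rfl
        | succ j => simpa using hh j (fun h => hj (by rw [h]))
      simp only [this]
end cube
section box
variable {A G : Type} [AddCommGroup A] [Fintype A] [DecidableEq A] [AddCommGroup G] [Fintype G]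
  (γ : A →+ G)
noncomputable def dd (t : A) (f : G → ℂ) (x : G) : ℂ := f (x + γ t) * conj (f x)
theorem dd_comm (s t : A) (f : G → ℂ) : dd γ s (dd γ t f) = dd γ t (dd γ s f) := by
  ext x
  simp only [dd, map_mul, Complex.conj_conj]
  rw [add_right_comm]; ring
theorem dd_bdd {f : G → ℂ} (hf : ∀ x, ‖f x‖ ≤ 1) (t : A) (x : G) : ‖dd γ t f x‖ ≤ 1 :=
  nml (hf _) (ncl (hf _))
noncomputable def Box : List (A → ℝ) → (G → ℂ) → ℝ
  | [], f => (𝔼 x, f x).re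
  | ν :: l, f => ∑ t, ν t * Box l (dd γ t f)
noncomputable def nu {Y : Type} [Fintype Y] (p : Y → A) (t : A) : ℝ :=
  𝔼 a, 𝔼 b, if p a - p b = t then 1 else 0
noncomputable def full : A → ℝ := fun _ => 1 / (Fintype.card A : ℝ)
theorem nu_sum {Y : Type} [Fintype Y] (p : Y → A) (φ : A → ℝ) :
    ∑ t, nu p t * φ t = 𝔼 a, 𝔼 b, φ (p a - p b) := by
  simp only [nu, expect_mul]
  rw [← expect_sum_comm]
  refine expect_congr rfl fun a _ => ?_
  rw [← expect_sum_comm]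
  refine expect_congr rfl fun b _ => ?_
  simp
theorem Box_nu {Y : Type} [Fintype Y] (p : Y → A) (l) (f : G → ℂ) :
    Box γ (nu p :: l) f = 𝔼 a, 𝔼 b, Box γ l (dd γ (p a - p b) f) := by
  simp only [Box]; rw [nu_sum]
theorem full_eq : (full : A → ℝ) = nu (fun a : A => a) := by
  ext t
  have h : ∀ a : A, (𝔼 b, if a - b = t then (1:ℝ) else 0) = 1 / (Fintype.card A : ℝ) := by
    intro a
    have : ∀ b, (a - b = t) ↔ b = a - t := fun b => by
      constructor
      · rintro rfl; abel
      · rintro rfl; abel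
    simp_rw [this]
    rw [expect_ite_eq']
    simp [← NNRat.cast_smul_eq_nnqsmul ℝ]
  simp only [nu, h, full]
  rw [expect_const univ_nonempty]
theorem Box_full (l) (f : G → ℂ) : Box γ (full :: l) f = 𝔼 t, Box γ l (dd γ t f) := by
  simp only [Box, full, ← mul_sum]
  rw [Fintype.expect_eq_sum_div_card]; ring
theorem Box_perm {l l' : List (A → ℝ)} (h : l.Perm l') (f : G → ℂ) : Box γ l f = Box γ l' f := by
  induction h generalizing f with
  | nil => rfl
  | cons x _ ih => simp only [Box, ih]
  | swap x y l =>
    simp only [Box, mul_sum]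
    rw [sum_comm]
    refine sum_congr rfl fun a _ => sum_congr rfl fun b _ => ?_
    rw [dd_comm]; ring
  | trans _ _ ho jb => exact (ho f).trans (jb f)
def IsNu (ν : A → ℝ) : Prop := ∃ (n : ℕ) (_ : NeZero n) (p : Fin n → A), ν = nu p
theorem isNu_nu {Y : Type} [Fintype Y] [Nonempty Y] (p : Y → A) : IsNu (nu p) := by
  refine ⟨Fintype.card Y, ⟨Fintype.card_ne_zero⟩, fun i => p ((Fintype.equivFin Y).symm i), ?_⟩
  ext t
  simp only [nu]
  refine Fintype.expect_equiv (Fintype.equivFin Y) _ _ fun a => ?_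
  refine Fintype.expect_equiv (Fintype.equivFin Y) _ _ fun b => ?_
  simp
theorem isNu_full : IsNu (full : A → ℝ) := by
  rw [full_eq]; exact isNu_nu _
theorem IsNu.nonneg {ν : A → ℝ} (h : IsNu ν) (t) : 0 ≤ ν t := by
  obtain ⟨n, _, p, rfl⟩ := h
  exact expect_nn fun a => expect_nn fun b => by split_ifs <;> norm_num
theorem IsNu.sum {ν : A → ℝ} (h : IsNu ν) : ∑ t, ν t = 1 := by
  obtain ⟨n, hn, p, rfl⟩ := h
  have := nu_sum p (fun _ => 1)
  simp only [mul_one] at this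
  rw [this]
  have : NeZero n := hn
  simp
theorem Box_one {Y : Type} [Fintype Y] (p : Y → A) (f : G → ℂ) :
    Box γ [nu p] f = 𝔼 x, ‖𝔼 a, f (x + γ (p a))‖ ^ 2 := by
  rw [Box_nu]
  simp only [Box, dd, nse, ← re_expect]
  congr 1
  rw [expect_comm (s := (univ : Finset G))]
  refine expect_congr rfl fun a _ => ?_
  rw [expect_comm (s := (univ : Finset G))]
  refine expect_congr rfl fun b _ => ?_
  rw [← eshift (γ (p b))]
  refine expect_congr rfl fun x _ => ?_
  congr 2
  rw [map_sub]; abel_nf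
theorem Boxn (l : List (A → ℝ)) (hl : ∀ ν ∈ l, IsNu ν) (ja : l ≠ []) (f : G → ℂ) :
    0 ≤ Box γ l f := by
  induction l generalizing f with
  | nil => exact absurd rfl ja
  | cons ν l ih =>
    by_cases ki : l = []
    · subst ki
      obtain ⟨n, _, p, rfl⟩ := hl ν (by simp)
      rw [Box_one]
      exact expect_nn fun x => by positivity
    · simp only [Box]
      exact sum_nonneg fun t _ => mul_nonneg ((hl ν (by simp)).nonneg t)
        (ih (fun μ hμ => hl μ (by simp [hμ])) ki _)
theorem Boxo (l : List (A → ℝ)) (hl : ∀ ν ∈ l, IsNu ν) (f : G → ℂ) (hf : ∀ x, ‖f x‖ ≤ 1) :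
    Box γ l f ≤ 1 := by
  induction l generalizing f with
  | nil => exact re_le_one (neo hf)
  | cons ν l ih =>
    simp only [Box]
    have hν := hl ν (by simp)
    calc _ ≤ ∑ t, ν t * 1 := sum_le_sum fun t _ => mul_le_mul_of_nonneg_left
            (ih (fun μ hμ => hl μ (by simp [hμ])) _ (dd_bdd γ hf t)) (hν.nonneg t)
      _ = 1 := by simp [hν.sum]
theorem Box_dom {ν : A → ℝ} {κ : ℝ} (hν : ∀ t, ν t ≤ κ / (Fintype.card A : ℝ)) (l : List (A → ℝ))
    (hl : ∀ ν ∈ l, IsNu ν) (ja : l ≠ []) (f : G → ℂ) :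
    Box γ (ν :: l) f ≤ κ * Box γ (full :: l) f := by
  simp only [Box, mul_sum]
  refine sum_le_sum fun t _ => ?_
  have := mul_le_mul_of_nonneg_right (hν t) (Boxn γ l hl ja (dd γ t f))
  refine this.trans (le_of_eq ?_)
  simp only [full]; ring
theorem cube_Box {H : Type} [Fintype H] (s : ℕ) (p : Fin s → H → A) (f : G → ℂ) :
    (𝔼 x, 𝔼 u, 𝔼 v, cube s (fun h => f (x + γ (∑ i, p i (h i)))) u v).re =
      Box γ (List.ofFn fun i => nu (p i)) f := by
  induction s generalizing f with
  | zero => simp [cube, Box]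
  | succ s ih =>
    rw [List.ofFn_succ, Box_nu]
    simp_rw [← ih, ← re_expect]
    congr 1
    simp_rw [expect_cons s]
    rw [expect_comm (s := (univ : Finset G))]
    refine expect_congr rfl fun a _ => ?_
    simp_rw [expect_comm (s := (univ : Finset (Fin s → H))) (t := (univ : Finset H))]
    rw [expect_comm (s := (univ : Finset G))]
    refine expect_congr rfl fun b _ => ?_
    refine Eq.trans ?_ (eshift (γ (p 0 b)) _)
    refine expect_congr rfl fun x _ => expect_congr rfl fun u _ => expect_congr rfl fun v _ => ?_
    simp only [cube, Fin.sum_univ_succ, Fin.cons_zero, Fin.cons_succ, Fin.tail_cons, dd]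
    congr 1; ext h
    congr 2
    · simp only [map_add, map_sub]; abel_nf
    · simp only [map_add]; abel_nf
theorem boxCS_G {H : Type} [Fintype H] (s : ℕ) (B : Fin (s+1) → G → (Fin (s+1) → H) → ℂ)
    (hB : ∀ i x h, ‖B i x h‖ ≤ 1)
    (hind : ∀ i x h pm, (∀ j, j ≠ i → h j = pm j) → B i x h = B i x pm)
    (p : Fin (s+1) → H → A) (f : G → ℂ) :
    ‖𝔼 x, 𝔼 h, (∏ i, B i x h) * f (x + γ (∑ i, p i (h i)))‖ ^ (2 ^ (s+1)) ≤
      Box γ (List.ofFn fun i => nu (p i)) f := by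
  rw [← cube_Box]
  exact boxCS s B hB hind _
theorem Box_prefix (la : List (A → ℝ)) (hl : ∀ ν ∈ la, IsNu ν) (f : G → ℂ) (hf : ∀ x, ‖f x‖ ≤ 1) :
    ∃ (I : Type) (_ : Fintype I) (w : I → ℝ) (F : I → G → ℂ), (∀ i, 0 ≤ w i) ∧ ∑ i, w i = 1 ∧
      (∀ i x, ‖F i x‖ ≤ 1) ∧ ∀ l, Box γ (la ++ l) f = ∑ i, w i * Box γ l (F i) := by
  induction la generalizing f with
  | nil => exact ⟨Unit, inferInstance, fun _ => 1, fun _ => f, by simp, by simp, fun _ => hf, by simp⟩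
  | cons ν la ih =>
    have hν := hl ν (by simp)
    choose I hI w F ho jb jd je using fun t => ih (fun μ hμ => hl μ (by simp [hμ])) (dd γ t f) (dd_bdd γ hf t)
    refine ⟨(t : A) × I t, inferInstance, fun p => ν p.1 * w p.1 p.2, fun p => F p.1 p.2, ?_, ?_, ?_, ?_⟩
    · intro p; exact mul_nonneg (hν.nonneg _) (ho _ _)
    · rw [Fintype.sum_sigma]; simp [← mul_sum, jb, hν.sum]
    · intro p; exact jd _ _
    · intro l
      rw [Fintype.sum_sigma]
      simp only [List.cons_append, Box, je, mul_sum]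
      simp only [mul_assoc]
theorem popular_w {ι : Type} [Fintype ι] {w E F : ι → ℝ} {ε η : ℝ} (hw : ∀ i, 0 ≤ w i) (hw1 : ∑ i, w i = 1)
    (hε : 0 ≤ ε) (hη : 0 ≤ η) (hE : ∀ i, E i ≤ 1)
    (hF : ∀ i, 0 ≤ F i) (h : ∀ i, ε / 2 ≤ E i → η ≤ F i) (hh : ε ≤ ∑ i, w i * E i) :
    ε / 2 * η ≤ ∑ i, w i * F i := by
  have ho : ∑ i, w i * (η * (E i - ε / 2)) ≤ ∑ i, w i * F i := by
    refine sum_le_sum fun i _ => mul_le_mul_of_nonneg_left ?_ (hw i)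
    by_cases hi : ε / 2 ≤ E i
    · nlinarith [h i hi, hE i]
    · nlinarith [hF i]
  have jb : ∑ i, w i * (η * (E i - ε / 2)) = η * (∑ i, w i * E i - ε / 2 * ∑ i, w i) := by
    rw [mul_sum, ← sum_sub_distrib, mul_sum]
    exact sum_congr rfl fun i _ => by ring
  rw [jb, hw1] at ho
  nlinarith
end box
section shift
theorem expect_fin (M : ℕ) (z : ℕ → ℂ) : 𝔼 y : Fin M, z y = (∑ y ∈ range M, z y) / M := by
  rw [Fintype.expect_eq_sum_div_card, Fin.sum_univ_eq_sum_range (fun i => z i), Fintype.card_fin]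
theorem shift_one (M a : ℕ) (z : ℕ → ℂ) (hz : ∀ y, ‖z y‖ ≤ 1) :
    ‖𝔼 y : Fin M, z y - 𝔼 y : Fin M, z (y + a)‖ ≤ 2 * a / M := by
  rw [expect_fin, expect_fin M (fun y => z (y + a)), ← sub_div, norm_div, Complex.norm_natCast]
  apply div_le_div_of_nonneg_right _ (Nat.cast_nonneg M)
  have ho := sum_range_add z a M
  have jb := sum_range_add z M a
  rw [add_comm a M] at ho
  have : ∑ y ∈ range M, z y - ∑ y ∈ range M, z (y + a) =
     ∑ y ∈ range a, z y - ∑ y ∈ range a, z (M + y) := by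
    have : ∑ y ∈ range M, z (y + a) = ∑ y ∈ range M, z (a + y) := sum_congr rfl fun y _ => by rw [add_comm]
    rw [this]
    linear_combination ho - jb
  rw [this]
  refine (norm_sub_le _ _).trans ?_
  have jd : ∀ w : ℕ → ℂ, (∀ y, ‖w y‖ ≤ 1) → ‖∑ y ∈ range a, w y‖ ≤ a := fun w hw => by
    refine (norm_sum_le _ _).trans ?_
    calc _ ≤ ∑ y ∈ range a, (1:ℝ) := sum_le_sum fun y _ => hw y
      _ = a := by simp
  linarith [jd z hz, jd (fun y => z (M + y)) fun y => hz _]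
theorem shift_avg {I : Type} [Fintype I] [Nonempty I] (M m : ℕ) (s : I → ℕ) (hs : ∀ i, s i ≤ m) (z : ℕ → ℂ)
    (hz : ∀ y, ‖z y‖ ≤ 1) :
    ‖𝔼 y : Fin M, z y - 𝔼 i, 𝔼 y : Fin M, z (y + s i)‖ ≤ 2 * m / M := by
  have : 𝔼 y : Fin M, z y - 𝔼 i, 𝔼 y : Fin M, z (y + s i) =
      𝔼 i, (𝔼 y : Fin M, z y - 𝔼 y : Fin M, z (y + s i)) := by
    rw [expect_sub_distrib, expect_const univ_nonempty]
  rw [this]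
  refine nel fun i => (shift_one M (s i) z hz).trans ?_
  have : (s i : ℝ) ≤ m := by exact_mod_cast hs i
  gcongr
theorem shift_avg2 {I : Type} [Fintype I] [Nonempty I] (M m : ℕ) (s sd : I → ℕ) (hs : ∀ i, s i ≤ m)
    (hs' : ∀ i, sd i ≤ m) (z : ℕ → ℕ → ℂ)
    (hz : ∀ y ya, ‖z y ya‖ ≤ 1) :
    ‖𝔼 y : Fin M, 𝔼 ya : Fin M, z y ya - 𝔼 i, 𝔼 y : Fin M, 𝔼 ya : Fin M, z (y + s i) (ya + sd i)‖
      ≤ 4 * m / M := by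
  have : 𝔼 y : Fin M, 𝔼 ya : Fin M, z y ya - 𝔼 i, 𝔼 y : Fin M, 𝔼 ya : Fin M, z (y + s i) (ya + sd i) =
      𝔼 i, (𝔼 y : Fin M, 𝔼 ya : Fin M, z y ya - 𝔼 y : Fin M, 𝔼 ya : Fin M, z (y + s i) (ya + sd i)) := by
    rw [expect_sub_distrib, expect_const univ_nonempty]
  rw [this]
  refine nel fun i => ?_
  have ho := shift_one M (s i) (fun y => 𝔼 ya : Fin M, z y ya) fun y => neo fun ya => hz _ _
  have jb := shift_one M (sd i) (fun ya => 𝔼 y : Fin M, z (y + s i) ya)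
    fun y => neo fun ya => hz _ _
  rw [expect_comm, expect_comm (f := fun (ya : Fin M) (y : Fin M) => z (y + s i) (ya + sd i))] at jb
  have ea : (s i : ℝ) ≤ m := by exact_mod_cast hs i
  have eb : (sd i : ℝ) ≤ m := by exact_mod_cast hs' i
  have jd : 2 * (s i : ℝ) / M + 2 * (sd i : ℝ) / M ≤ 4 * m / M := by
    rw [← add_div]; gcongr; linarith
  exact (norm_sub_le_norm_sub_add_norm_sub _ _ _).trans ((add_le_add ho jb).trans jd)
end shift
section eps
theorem epl {ε : ℝ} (ja : 0 < ε) (ho : ε ≤ 1/2) {a b : ℕ} (h : a ≤ b) : ε ^ b ≤ ε ^ a :=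
  pow_le_pow_of_le_one ja.le (by linarith) h
theorem epm {ε : ℝ} (ja : 0 < ε) (ho : ε ≤ 1/2) (a j : ℕ) {c : ℝ} (hc : c ≤ 2 ^ j) :
    c * ε ^ (a + j) ≤ ε ^ a := by
  rw [pow_add]
  have jb : (2:ℝ) ^ j * ε ^ j ≤ 1 := by
    rw [← mul_pow]; exact pow_le_one₀ (by positivity) (by linarith)
  have jd : c * ε ^ j ≤ 1 := (mul_le_mul_of_nonneg_right hc (by positivity)).trans jb
  have := pow_pos ja a
  nlinarith
theorem xlen {ε : ℝ} (ja : 0 < ε) (ho : ε ≤ 1/2) (a : ℕ) {M : ℝ} (h : 1 ≤ ε ^ a * M) :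
    ∃ m : ℕ, 0 < m ∧ (m : ℝ) ≤ ε ^ a * M ∧ ε ^ (a+1) * M ≤ m := by
  refine ⟨⌊ε ^ a * M⌋₊, ?_, Nat.floor_le (by linarith), ?_⟩
  · exact Nat.floor_pos.mpr h
  · have jb := Nat.lt_floor_add_one (ε ^ a * M)
    have jd : (1:ℝ) ≤ ⌊ε ^ a * M⌋₊ := by exact_mod_cast Nat.floor_pos.mpr h
    rw [pow_succ]
    nlinarith
theorem szm {ε : ℝ} (ja : 0 < ε) (ho : ε ≤ 1/2) {a b : ℕ} (h : a ≤ b) {M : ℝ} (hM : 0 ≤ M)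
    (hb : 1 ≤ ε ^ b * M) : 1 ≤ ε ^ a * M :=
  hb.trans (mul_le_mul_of_nonneg_right (epl ja ho h) hM)
end eps
section pet
variable {A G : Type} [CommRing A] [Fintype A] [DecidableEq A] [AddCommGroup G] [Fintype G]
  (γ : A →+ G) (e : G)
noncomputable def TT (M : ℕ) (fb fa fc : G → ℂ) : ℂ :=
  𝔼 x, 𝔼 y : Fin M, fb x * fa (x + (y:ℕ) • e) * fc (x + γ (((y:ℕ):A) ^ 2))
noncomputable def ap (m : ℕ) (α : A) : A → ℝ := nu fun u : Fin m => α * ((u:ℕ) : A)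
theorem isNu_ap (m : ℕ) [NeZero m] (α : A) : IsNu (ap m α) := isNu_nu _
theorem ap_neg (m : ℕ) (α : A) : ap m (-α) = ap m α := by
  ext t
  simp only [ap, nu]
  rw [expect_comm]
  refine expect_congr rfl fun a _ => expect_congr rfl fun b _ => ?_
  congr 1
  ring_nf
noncomputable def WW (f : G → ℂ) (x : G) (a ac y : ℕ) : ℂ :=
  f (x - y • e + γ (((y + a : ℕ) : A) ^ 2)) * conj (f (x - y • e + γ (((y + ac : ℕ) : A) ^ 2)))
theorem WW_bdd (f : G → ℂ) (hf : ∀ x, ‖f x‖ ≤ 1) (x : G) (a ac y : ℕ) : ‖WW γ e f x a ac y‖ ≤ 1 :=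
  nml (hf _) (ncl (hf _))
theorem pet1 (M m : ℕ) [NeZero m] [NeZero M] (fb fa fc : G → ℂ) (ja : ∀ x, ‖fb x‖ ≤ 1) (ho : ∀ x, ‖fa x‖ ≤ 1)
    (jb : ∀ x, ‖fc x‖ ≤ 1) (η : ℝ) (hη : 0 ≤ η) (h : η + 2 * m / M ≤ ‖TT γ e M fb fa fc‖) :
    η ^ 4 ≤ 𝔼 a : Fin m, 𝔼 ac : Fin m, 𝔼 x, ‖𝔼 y : Fin M, WW γ e fc x a ac y‖ ^ 2 := by
  set z : G → ℕ → ℂ := fun x y => fa (x + y • e) * fc (x + γ ((y:A) ^ 2)) with hz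
  have hzb : ∀ x y, ‖z x y‖ ≤ 1 := fun x y => nml (ho _) (jb _)
  have ea : TT γ e M fb fa fc = 𝔼 x, fb x * 𝔼 y : Fin M, z x y := by
    simp only [TT, mul_expect, hz, mul_assoc]
  have eb : ‖TT γ e M fb fa fc - 𝔼 x, 𝔼 y : Fin M, fb x * 𝔼 a : Fin m, z x (y + a)‖ ≤ 2 * m / M := by
    have : TT γ e M fb fa fc - 𝔼 x, 𝔼 y : Fin M, fb x * 𝔼 a : Fin m, z x (y + a) =
       𝔼 x, fb x * (𝔼 y : Fin M, z x y - 𝔼 a : Fin m, 𝔼 y : Fin M, z x (y + a)) := by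
      rw [ea, ← expect_sub_distrib]
      refine expect_congr rfl fun x _ => ?_
      rw [mul_sub, ← mul_expect, expect_comm]
    rw [this]
    refine nel fun x => ?_
    rw [norm_mul]
    have := shift_avg M m (fun a : Fin m => (a:ℕ)) (fun a => a.2.le) (z x) (hzb x)
    calc _ ≤ 1 * (2 * m / M : ℝ) := mul_le_mul (ja x) this (norm_nonneg _) zero_le_one
      _ = _ := one_mul _
  have ec : η ≤ ‖𝔼 p : G × Fin M, fb p.1 * 𝔼 a : Fin m, z p.1 (p.2 + a)‖ := by
    rw [eprod]
    have := norm_sub_norm_le (TT γ e M fb fa fc) (𝔼 x, 𝔼 y : Fin M, fb x * 𝔼 a : Fin m, z x (y + a))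
    linarith
  have ed : η ^ 2 ≤ 𝔼 p : G × Fin M, ‖𝔼 a : Fin m, z p.1 (p.2 + a)‖ ^ 2 :=
    (pow_le_pow_left₀ hη ec 2).trans (cs_kill _ _ fun p => ja _)
  have ef : 𝔼 p : G × Fin M, ‖𝔼 a : Fin m, z p.1 (p.2 + a)‖ ^ 2 =
      (𝔼 p : Fin m × Fin m × G, (fa (p.2.2 + (p.1:ℕ) • e) * conj (fa (p.2.2 + (p.2.1:ℕ) • e))) *
        𝔼 y : Fin M, WW γ e fc p.2.2 p.1 p.2.1 y).re := by
    simp_rw [nse]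
    rw [← re_expect]
    congr 1
    simp_rw [mul_expect]
    rw [eprod, eprod]
    simp_rw [eprod]
    simp_rw [expect_comm (s := (univ : Finset (Fin M))) (t := (univ : Finset (Fin m)))]
    rw [expect_comm (s := (univ : Finset G))]
    refine expect_congr rfl fun a _ => ?_
    rw [expect_comm (s := (univ : Finset G))]
    refine expect_congr rfl fun ac _ => ?_
    rw [expect_comm (s := (univ : Finset G)), expect_comm (s := (univ : Finset G))]
    refine expect_congr rfl fun y _ => ?_
    rw [← eshift (-((y:ℕ) • e))]
    refine expect_congr rfl fun x _ => ?_
    simp only [hz, WW, map_mul]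
    have : ∀ b : ℕ, x + -((y:ℕ) • e) + ((y + b : ℕ)) • e = x + b • e := fun b => by
      rw [add_smul]; abel
    rw [this, this, ← sub_eq_add_neg]
    ring
  have eg : η ^ 2 ≤ ‖𝔼 p : Fin m × Fin m × G, (fa (p.2.2 + (p.1:ℕ) • e) * conj (fa (p.2.2 + (p.2.1:ℕ) • e))) *
        𝔼 y : Fin M, WW γ e fc p.2.2 p.1 p.2.1 y‖ := by
    rw [ef] at ed
    exact ed.trans (Complex.re_le_norm _)
  have ee := (pow_le_pow_left₀ (by positivity) eg 2).trans
    (cs_kill _ _ fun p => nml (ho _) (ncl (ho _)))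
  rw [← pow_mul] at ee
  refine ee.trans (le_of_eq ?_)
  rw [eprod]
  simp_rw [eprod]
theorem pet2 (m : ℕ) [NeZero m] (f : G → ℂ) (hf : ∀ x, ‖f x‖ ≤ 1) (a ac y z : ℕ) :
    ‖𝔼 b : Fin 3 → Fin m, 𝔼 x, WW γ e f x a ac (y + (∑ i, (b i : ℕ))) *
      conj (WW γ e f x a ac (z + (∑ i, (b i : ℕ))))‖ ^ 8 ≤
    Box γ [ap m (2 * ((ac:A) - a)), ap m (2 * ((z:A) - y)), ap m (2 * ((ac:A) - a) + 2 * ((z:A) - y))] f := by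
  set p : Fin 3 → A := ![2 * ((ac:A) - a), 2 * ((z:A) - y), 2 * ((ac:A) - a) + 2 * ((z:A) - y)] with hp
  have key := boxCS_G γ 2 (H := Fin m)
    (fun i (x : G) (b : Fin 3 → Fin m) => ![
      conj (f (x + γ (((y:A) + ac) ^ 2 - (y + a) ^ 2 + p 0 * (∑ i, ((b i : ℕ) : A)) - ∑ i, p i * ((b i : ℕ) : A)))),
      conj (f (x + (y:ℕ) • e - (z:ℕ) • e + γ (((z:A) + a) ^ 2 - (y + a) ^ 2 + p 1 * (∑ i, ((b i : ℕ) : A)) - ∑ i, p i * ((b i : ℕ) : A)))),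
      f (x + (y:ℕ) • e - (z:ℕ) • e + γ (((z:A) + ac) ^ 2 - (y + a) ^ 2 + p 2 * (∑ i, ((b i : ℕ) : A)) - ∑ i, p i * ((b i : ℕ) : A)))] i)
    (by
      intro i x b
      fin_cases i
      · exact ncl (hf _)
      · exact ncl (hf _)
      · exact hf _)
    (by
      intro i x b bf hb
      have jd : ∀ i : Fin 3, (∀ j, j ≠ i → b j = bf j) → p i * (∑ i, ((b i : ℕ) : A)) - ∑ i, p i * ((b i : ℕ) : A) =
         p i * (∑ i, ((bf i : ℕ) : A)) - ∑ i, p i * ((bf i : ℕ) : A) := by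
        intro i hb
        rw [mul_sum, mul_sum, ← sum_sub_distrib, ← sum_sub_distrib]
        refine sum_congr rfl fun j _ => ?_
        by_cases hj : j = i
        · subst hj; ring
        · rw [hb j hj]
      fin_cases i
      · have := jd 0 hb
        simp only [add_sub_assoc, this]; rfl
      · have := jd 1 hb
        simp only [add_sub_assoc, this]; rfl
      · have := jd 2 hb
        simp only [add_sub_assoc, this]; rfl)
    (fun i b => -(p i * ((b:ℕ):A))) f
  have hl : (List.ofFn fun i : Fin 3 => nu fun b : Fin m => -(p i * ((b:ℕ):A))) =
      [ap m (2 * ((ac:A) - a)), ap m (2 * ((z:A) - y)), ap m (2 * ((ac:A) - a) + 2 * ((z:A) - y))] := by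
    have : ∀ i, (nu fun b : Fin m => -(p i * ((b:ℕ):A))) = ap m (p i) := fun i => by
      rw [← ap_neg]; simp only [ap, neg_mul]
    simp only [this, List.ofFn_succ, List.ofFn_zero]
    simp [hp]
  rw [hl] at key
  refine le_trans (le_of_eq ?_) key
  congr 2
  rw [expect_comm (s := (univ : Finset G))]
  refine expect_congr rfl fun b _ => ?_
  set B : ℕ := ∑ i, (b i : ℕ) with hB
  have jz : ∑ i, ((b i : ℕ) : A) = (B : A) := by rw [hB]; push_cast; rfl
  rw [jz]
  rw [← eshift ((B + y) • e - γ (((y:A) + a) ^ 2 + 2 * (y + a) * B + (B:A)^2) - γ (∑ i, p i * ((b i : ℕ) : A)))]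
  refine expect_congr rfl fun x _ => ?_
  have hp3 : ∀ F : Fin (2+1) → ℂ, ∏ i, F i = F 0 * F 1 * F 2 := fun F => Fin.prod_univ_three F
  rw [hp3]
  simp only [WW, map_mul, Complex.conj_conj]
  have q0 : p 0 = 2 * ((ac:A) - a) := rfl
  have q1 : p 1 = 2 * ((z:A) - y) := rfl
  have q2 : p 2 = 2 * ((ac:A) - a) + 2 * ((z:A) - y) := rfl
  set S : A := ∑ i, p i * ((b i : ℕ) : A) with hS
  have kr : ∑ i, -(p i * ((b i : ℕ) : A)) = - S := by rw [hS, sum_neg_distrib]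
  rw [kr]
  have r : ∀ (w c : ℕ), x + ((B + y) • e - γ (((y:A) + a) ^ 2 + 2 * (y + a) * B + (B:A)^2) - γ S)
      - (w + B) • e + γ (((w + B + c : ℕ) : A) ^ 2) =
      x + y • e - w • e + γ (((w:A) + c) ^ 2 - (y + a) ^ 2 + (2 * (w + c) - 2 * (y + a)) * B - S) := by
    intro w c
    have : γ (((w + B + c : ℕ) : A) ^ 2) = γ (((w:A) + c) ^ 2 - (y + a) ^ 2 + (2 * (w + c) - 2 * (y + a)) * B - S)
       + γ (((y:A) + a) ^ 2 + 2 * (y + a) * B + (B:A)^2) + γ S := by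
      rw [← map_add, ← map_add]; congr 1; push_cast; ring
    rw [this]
    simp only [add_smul]
    abel
  rw [r, r, r, r]
  simp only [add_sub_cancel_right, sub_self, zero_mul, zero_sub, zero_add]
  simp only [Matrix.cons_val_zero, Matrix.cons_val_one, Matrix.cons_val_two, Matrix.vecHead, Matrix.vecTail, Function.comp, Fin.succ_zero_eq_one]
  have z0 : (2 * ((y:A) + ac) - 2 * (y + a)) = p 0 := by rw [q0]; ring
  have z1 : (2 * ((z:A) + a) - 2 * (y + a)) = p 1 := by rw [q1]; ring
  have z2 : (2 * ((z:A) + ac) - 2 * (y + a)) = p 2 := by rw [q2]; ring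
  rw [z0, z1, z2]
  ring
theorem pet_aux (M m : ℕ) [NeZero m] [NeZero M] (fb fa fc : G → ℂ) (ja : ∀ x, ‖fb x‖ ≤ 1) (ho : ∀ x, ‖fa x‖ ≤ 1)
    (jb : ∀ x, ‖fc x‖ ≤ 1) (η : ℝ) (hη : 0 ≤ η) (h : η + 2 * m / M ≤ ‖TT γ e M fb fa fc‖)
    (hη2 : 24 * (m:ℝ) / M ≤ η ^ 4) :
    (η ^ 4 / 2) ^ 8 ≤ 𝔼 a : Fin m, 𝔼 ac : Fin m, 𝔼 y : Fin M, 𝔼 z : Fin M,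
      Box γ [ap m (2 * (((ac:ℕ):A) - ((a:ℕ):A))), ap m (2 * (((z:ℕ):A) - ((y:ℕ):A))),
        ap m (2 * (((ac:ℕ):A) - ((a:ℕ):A)) + 2 * (((z:ℕ):A) - ((y:ℕ):A)))] fc := by
  have ea := pet1 γ e M m fb fa fc ja ho jb η hη h
  set V : ℕ → ℕ → ℕ → ℕ → ℂ := fun a ac y z => 𝔼 x, WW γ e fc x a ac y * conj (WW γ e fc x a ac z) with hV
  have hVb : ∀ a ac y z, ‖V a ac y z‖ ≤ 1 := fun a ac y z => neo fun x =>
    nml (WW_bdd _ _ _ jb _ _ _ _) (ncl (WW_bdd _ _ _ jb _ _ _ _))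
  have eb : η ^ 4 ≤ ‖𝔼 a : Fin m, 𝔼 ac : Fin m, 𝔼 y : Fin M, 𝔼 z : Fin M, V a ac y z‖ := by
    refine ea.trans ((le_of_eq ?_).trans (Complex.re_le_norm _))
    simp_rw [nse, re_expect]
    refine expect_congr rfl fun a _ => expect_congr rfl fun ac _ => ?_
    rw [expect_comm]
    refine expect_congr rfl fun y _ => ?_
    rw [expect_comm]
    refine expect_congr rfl fun z _ => ?_
    simp_rw [hV, re_expect]
  have ec : ‖𝔼 a : Fin m, 𝔼 ac : Fin m, 𝔼 y : Fin M, 𝔼 z : Fin M, V a ac y z -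
      𝔼 a : Fin m, 𝔼 ac : Fin m, 𝔼 b : Fin 3 → Fin m, 𝔼 y : Fin M, 𝔼 z : Fin M,
        V a ac (y + ∑ i, (b i : ℕ)) (z + ∑ i, (b i : ℕ))‖ ≤ 4 * (3 * m : ℕ) / M := by
    rw [← expect_sub_distrib]
    refine nel fun a => ?_
    rw [← expect_sub_distrib]
    refine nel fun ac => ?_
    have hb : ∀ b : Fin 3 → Fin m, ∑ i, (b i : ℕ) ≤ 3 * m := fun b => by
      calc _ ≤ ∑ i : Fin 3, m := sum_le_sum fun i _ => (b i).2.le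
        _ = 3 * m := by simp
    exact shift_avg2 M (3 * m) (fun b : Fin 3 → Fin m => ∑ i, (b i : ℕ)) (fun b : Fin 3 → Fin m => ∑ i, (b i : ℕ))
      hb hb (V a ac) (hVb a ac)
  have ed : η ^ 4 / 2 ≤ ‖𝔼 a : Fin m, 𝔼 ac : Fin m, 𝔼 y : Fin M, 𝔼 z : Fin M, 𝔼 b : Fin 3 → Fin m,
        V a ac (y + ∑ i, (b i : ℕ)) (z + ∑ i, (b i : ℕ))‖ := by
    have jg : ∀ (a ac : Fin m), 𝔼 b : Fin 3 → Fin m, 𝔼 y : Fin M, 𝔼 z : Fin M,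
        V a ac (y + ∑ i, (b i : ℕ)) (z + ∑ i, (b i : ℕ)) = 𝔼 y : Fin M, 𝔼 z : Fin M, 𝔼 b : Fin 3 → Fin m,
        V a ac (y + ∑ i, (b i : ℕ)) (z + ∑ i, (b i : ℕ)) := by
      intro a ac
      rw [expect_comm]
      refine expect_congr rfl fun y _ => ?_
      rw [expect_comm]
    simp_rw [jg] at ec
    have jl : 4 * ((3 * m : ℕ) : ℝ) / M ≤ η ^ 4 / 2 := by
      push_cast
      have : 4 * (3 * (m:ℝ)) / M = 24 * (m:ℝ) / M / 2 := by ring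
      rw [this]; linarith
    have jp := norm_sub_norm_le (𝔼 a : Fin m, 𝔼 ac : Fin m, 𝔼 y : Fin M, 𝔼 z : Fin M, V a ac y z)
      (𝔼 a : Fin m, 𝔼 ac : Fin m, 𝔼 y : Fin M, 𝔼 z : Fin M, 𝔼 b : Fin 3 → Fin m,
        V a ac (y + ∑ i, (b i : ℕ)) (z + ∑ i, (b i : ℕ)))
    linarith
  refine (pow_le_pow_left₀ (by positivity) ed 8).trans ?_
  refine (npe 3 _).trans (emono fun a => ?_)
  refine (npe 3 _).trans (emono fun ac => ?_)
  refine (npe 3 _).trans (emono fun y => ?_)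
  refine (npe 3 _).trans (emono fun z => ?_)
  exact pet2 γ e m fc jb a ac y z
theorem pet {ε : ℝ} (hε : 0 < ε) (hε2 : ε ≤ 1/2) (M : ℕ) (hM : 1 ≤ ε ^ 14 * M) (fb fa fc : G → ℂ)
    (ja : ∀ x, ‖fb x‖ ≤ 1) (ho : ∀ x, ‖fa x‖ ≤ 1)
    (jb : ∀ x, ‖fc x‖ ≤ 1) (h : ε ≤ ‖TT γ e M fb fa fc‖) :
    ∃ m : ℕ, 0 < m ∧ (m : ℝ) ≤ ε ^ 14 * M ∧ ε ^ 15 * M ≤ m ∧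
    ε ^ 72 ≤ 𝔼 a : Fin m, 𝔼 ac : Fin m, 𝔼 y : Fin M, 𝔼 z : Fin M,
      Box γ [ap m (2 * (((ac:ℕ):A) - ((a:ℕ):A))), ap m (2 * (((z:ℕ):A) - ((y:ℕ):A))),
        ap m (2 * (((ac:ℕ):A) - ((a:ℕ):A)) + 2 * (((z:ℕ):A) - ((y:ℕ):A)))] fc := by
  obtain ⟨m, jf, jo, jw⟩ := xlen hε hε2 14 hM
  have hMpos : 0 < (M:ℝ) := by
    by_contra h; nlinarith [pow_pos hε 14]
  have : NeZero m := ⟨jf.ne'⟩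
  have : NeZero M := ⟨by rintro rfl; simp at hMpos⟩
  refine ⟨m, jf, jo, jw, ?_⟩
  have hmM : (m:ℝ) / M ≤ ε ^ 14 := by rwa [div_le_iff₀ hMpos]
  have key := pet_aux γ e M m fb fa fc ja ho jb (ε ^ 2) (by positivity) ?_ ?_
  · refine le_trans ?_ key
    have : ε ^ 9 ≤ (ε ^ 2) ^ 4 / 2 := by
      have := epm hε hε2 8 1 (c := 2) (by norm_num)
      rw [← pow_mul]; norm_num at this ⊢; linarith
    calc ε ^ 72 = (ε ^ 9) ^ 8 := by rw [← pow_mul]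
      _ ≤ _ := pow_le_pow_left₀ (by positivity) this 8
  · refine le_trans ?_ h
    rw [mul_div_assoc]
    have := epm hε hε2 2 12 (c := 2) (by norm_num)
    have := epm hε hε2 1 1 (c := 2) (by norm_num)
    norm_num at *
    linarith
  · rw [mul_div_assoc, ← pow_mul]
    have := epm hε hε2 8 6 (c := 24) (by norm_num)
    norm_num at *
    linarith
end pet
theorem shift4 (M m : ℕ) [NeZero M] (s : Fin 4 → ℕ) (hs : ∀ i, s i ≤ m) (z : ℕ → ℕ → ℕ → ℕ → ℂ)
    (hz : ∀ a b c d, ‖z a b c d‖ ≤ 1) :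
    ‖𝔼 a : Fin M, 𝔼 b : Fin M, 𝔼 c : Fin M, 𝔼 d : Fin M, z a b c d -
      𝔼 a : Fin M, 𝔼 b : Fin M, 𝔼 c : Fin M, 𝔼 d : Fin M, z (a + s 0) (b + s 1) (c + s 2) (d + s 3)‖
      ≤ 8 * m / M := by
  have ho := shift_avg2 (I := Unit) M m (fun _ => s 0) (fun _ => s 1) (fun _ => hs _) (fun _ => hs _)
    (fun a b => 𝔼 c : Fin M, 𝔼 d : Fin M, z a b c d) (fun a b => neo fun c => neo fun d => hz _ _ _ _)
  have jb : ‖𝔼 a : Fin M, 𝔼 b : Fin M, 𝔼 c : Fin M, 𝔼 d : Fin M, z (a + s 0) (b + s 1) c d -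
      𝔼 a : Fin M, 𝔼 b : Fin M, 𝔼 c : Fin M, 𝔼 d : Fin M, z (a + s 0) (b + s 1) (c + s 2) (d + s 3)‖ ≤ 4 * m / M := by
    rw [← expect_sub_distrib]
    refine nel fun a => ?_
    rw [← expect_sub_distrib]
    refine nel fun b => ?_
    have := shift_avg2 (I := Unit) M m (fun _ => s 2) (fun _ => s 3) (fun _ => hs _) (fun _ => hs _)
      (fun c d => z (a + s 0) (b + s 1) c d) (fun a b => hz _ _ _ _)
    simpa using this
  rw [Fintype.expect_const] at ho
  calc _ ≤ _ := norm_sub_le_norm_sub_add_norm_sub _ _ _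
    _ ≤ 4 * m / M + 4 * m / M := add_le_add ho jb
    _ = _ := by ring
section concat
variable {A G : Type} [CommRing A] [Fintype A] [DecidableEq A] [AddCommGroup G] [Fintype G]
  (γ : A →+ G)
noncomputable def sp (m : ℕ) (α β : A) : A → ℝ :=
  nu fun h : Fin m × Fin m => β * ((h.2:ℕ) : A) - α * ((h.1:ℕ) : A)
theorem isNu_sp (m : ℕ) [NeZero m] (α β : A) : IsNu (sp m α β) := isNu_nu _
theorem nu_fst {Y Z : Type} [Fintype Y] [Fintype Z] [Nonempty Z] (p : Y → A) :
    nu (fun h : Y × Z => p h.1) = nu p := by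
  ext t
  have key : ∀ F : Y → Y → ℝ, 𝔼 h : Y × Z, 𝔼 pm : Y × Z, F h.1 pm.1 = 𝔼 a, 𝔼 b, F a b := fun F => by
    simp only [eprod, Fintype.expect_const]
  exact key fun a b => if p a - p b = t then 1 else 0
theorem boxCS1 {H : Type} [Fintype H] (B : G → ℂ) (hB : ∀ x, ‖B x‖ ≤ 1) (p : H → A) (f : G → ℂ) :
    ‖𝔼 h, 𝔼 x, B x * f (x + γ (p h))‖ ^ 2 ≤ Box γ [nu p] f := by
  rw [Box_one, expect_comm]
  simp_rw [← mul_expect]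
  exact cs_kill _ _ hB
variable {Ω : Type} [Fintype Ω] [Nonempty Ω]
theorem concat1_aux (m mb : ℕ) [NeZero m] [NeZero mb] (α : Ω → A) (g : G → ℂ) (hg : ∀ x, ‖g x‖ ≤ 1) (ε : ℝ)
    (hε : 0 ≤ ε) (hm : 8 * (mb:ℝ) / m ≤ ε ^ 2) (h : ε ≤ 𝔼 ω, Box γ [ap m (α ω)] g) :
    (ε ^ 2 / 2) ^ 2 ≤ 𝔼 ω, 𝔼 pg, Box γ [sp mb (α ω) (α pg)] g := by
  set V : Ω × Fin m → Ω × Fin m → ℕ → ℕ → ℂ := fun q qc u ub => 𝔼 z,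
    g (z + γ (α q.1 * u - α q.1 * ((q.2:ℕ):A))) * conj (g (z + γ (α qc.1 * ub - α qc.1 * ((qc.2:ℕ):A)))) with hV
  have hVb : ∀ q qc u ub, ‖V q qc u ub‖ ≤ 1 := fun q qc u ub => neo fun x =>
    nml (hg _) (ncl (hg _))
  have ea : 𝔼 ω, Box γ [ap m (α ω)] g = (𝔼 z, conj (g z) * 𝔼 q : Ω × Fin m, 𝔼 u : Fin m,
      g (z + γ (α q.1 * ((u:ℕ):A) - α q.1 * ((q.2:ℕ):A)))).re := by
    simp only [ap, Box_nu]
    simp only [Box, ← re_expect]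
    congr 1
    simp_rw [mul_expect]
    rw [expect_comm (s := (univ : Finset G)), eprod]
    refine expect_congr rfl fun ω _ => ?_
    rw [expect_comm]
    refine expect_congr rfl fun b _ => ?_
    rw [expect_comm (s := (univ : Finset G))]
    refine expect_congr rfl fun a _ => expect_congr rfl fun z _ => ?_
    simp only [dd]; ring
  rw [ea] at h
  have eb := (pow_le_pow_left₀ hε (h.trans (Complex.re_le_norm _)) 2).trans
    (cs_kill _ _ fun z => ncl (hg z))
  have ec : ε ^ 2 ≤ ‖𝔼 q, 𝔼 qc, 𝔼 u : Fin m, 𝔼 ub : Fin m, V q qc u ub‖ := by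
    refine eb.trans ((le_of_eq ?_).trans (Complex.re_le_norm _))
    simp_rw [nse, ← re_expect]
    congr 1
    rw [expect_comm (s := (univ : Finset G))]
    refine expect_congr rfl fun q _ => ?_
    rw [expect_comm (s := (univ : Finset G))]
    refine expect_congr rfl fun qc _ => ?_
    simp_rw [conj_expect, mul_expect, expect_mul]
    rw [expect_comm (s := (univ : Finset G))]
    simp_rw [expect_comm (s := (univ : Finset G)), hV]
    rw [expect_comm]
  have ed : ‖𝔼 q, 𝔼 qc, 𝔼 u : Fin m, 𝔼 ub : Fin m, V q qc u ub -
      𝔼 q, 𝔼 qc, 𝔼 i : Fin mb × Fin mb, 𝔼 u : Fin m, 𝔼 ub : Fin m, V q qc (u + i.1) (ub + i.2)‖ ≤ 4 * mb / m := by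
    rw [← expect_sub_distrib]
    refine nel fun a => ?_
    rw [← expect_sub_distrib]
    refine nel fun ac => ?_
    exact shift_avg2 m mb (fun i : Fin mb × Fin mb => (i.1:ℕ)) (fun i => i.2) (fun i => i.1.2.le)
      (fun i => i.2.2.le) _ (hVb _ _)
  have ef : ε ^ 2 / 2 ≤ ‖𝔼 q, 𝔼 qc, 𝔼 u : Fin m, 𝔼 ub : Fin m, 𝔼 i : Fin mb × Fin mb, V q qc (u + i.1) (ub + i.2)‖ := by
    have jg : ∀ q qc, 𝔼 i : Fin mb × Fin mb, 𝔼 u : Fin m, 𝔼 ub : Fin m, V q qc (u + i.1) (ub + i.2) =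
        𝔼 u : Fin m, 𝔼 ub : Fin m, 𝔼 i : Fin mb × Fin mb, V q qc (u + i.1) (ub + i.2) := by
      intro q qc
      rw [expect_comm]
      refine expect_congr rfl fun y _ => ?_
      rw [expect_comm]
    simp_rw [jg] at ed
    have jl : 4 * (mb:ℝ) / m = 8 * (mb:ℝ) / m / 2 := by ring
    have := norm_sub_norm_le (𝔼 q, 𝔼 qc, 𝔼 u : Fin m, 𝔼 ub : Fin m, V q qc u ub) (𝔼 q, 𝔼 qc, 𝔼 u : Fin m, 𝔼 ub : Fin m, 𝔼 i : Fin mb × Fin mb, V q qc (u + i.1) (ub + i.2))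
    linarith
  have eg := pow_le_pow_left₀ (by positivity) ef 2
  refine eg.trans ?_
  have ee : 𝔼 ω, 𝔼 pg, Box γ [sp mb (α ω) (α pg)] g = 𝔼 q : Ω × Fin m, 𝔼 qc : Ω × Fin m, Box γ [sp mb (α q.1) (α qc.1)] g := by
    simp only [eprod, Fintype.expect_const]
  rw [ee]
  refine (npe 1 _).trans (emono fun q => ?_)
  refine (npe 1 _).trans (emono fun qc => ?_)
  refine (npe 1 _).trans (ele fun u => ?_)
  refine (npe 1 _).trans (ele fun ub => ?_)
  have key := boxCS1 γ (fun z => conj (g (z + γ (α q.1 * ((u:ℕ):A) - α q.1 * ((q.2:ℕ):A) - (α qc.1 * ((ub:ℕ):A) - α qc.1 * ((qc.2:ℕ):A))))))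
    (fun x => ncl (hg _)) (fun h : Fin mb × Fin mb => α qc.1 * ((h.2:ℕ) : A) - α q.1 * ((h.1:ℕ) : A)) g
  refine le_trans (le_of_eq ?_) key
  rw [pow_one, ← Complex.norm_conj]
  congr 2
  rw [conj_expect]
  refine expect_congr rfl fun i _ => ?_
  simp only [hV]
  rw [conj_expect, ← eshift (γ (-(α q.1 * ((i.1:ℕ):A)) - (α qc.1 * ((ub:ℕ):A) - α qc.1 * ((qc.2:ℕ):A))))]
  refine expect_congr rfl fun z _ => ?_
  simp only [map_mul, Complex.conj_conj]
  have r : ∀ a b c : A, a + b = c → z + γ a + γ b = z + γ c := fun a b c h => by rw [add_assoc, ← map_add, h]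
  rw [r _ _ _ rfl, r _ _ _ rfl]
  congr 4
  · push_cast; ring_nf
  · push_cast; ring_nf
theorem concat2_core (mb : ℕ) [NeZero mb] (g : G → ℂ) (hg : ∀ x, ‖g x‖ ≤ 1) (α β pk ph u v ub vc : A) :
    ‖𝔼 h : Fin 4 → Fin mb × Fin mb, 𝔼 z, (
      g (z + γ (v + β * (((h 1).1:ℕ):A)) + γ (u + α * (((h 0).1:ℕ):A))) *
      conj (g (z + γ (v + β * (((h 1).1:ℕ):A)))) * conj (g (z + γ (u + α * (((h 0).1:ℕ):A))))) *
      conj (g (z + γ (vc + ph * ((((h 2).1:ℕ):A) + (((h 3).1:ℕ):A))) + γ (ub + pk * ((((h 0).2:ℕ):A) + (((h 1).2:ℕ):A) + (((h 2).2:ℕ):A)))) *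
        conj (g (z + γ (vc + ph * ((((h 2).1:ℕ):A) + (((h 3).1:ℕ):A))))) *
        conj (g (z + γ (ub + pk * ((((h 0).2:ℕ):A) + (((h 1).2:ℕ):A) + (((h 2).2:ℕ):A))))))‖ ^ 16 ≤
    Box γ [sp mb α pk, sp mb β pk, sp mb ph pk, ap mb ph] g := by
  have key := boxCS_G γ 3 (H := Fin mb × Fin mb)
    (fun i (z : G) (h : Fin 4 → Fin mb × Fin mb) => ![
      g (z + γ (v + u - ub - ph * ((((h 2).1:ℕ):A) + (((h 3).1:ℕ):A)))) *
      conj (g (z + γ (u - ub - β * (((h 1).1:ℕ):A) - ph * ((((h 2).1:ℕ):A) + (((h 3).1:ℕ):A))))),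
      conj (g (z + γ (v - ub - α * (((h 0).1:ℕ):A) - ph * ((((h 2).1:ℕ):A) + (((h 3).1:ℕ):A))))),
      g (z + γ (vc - ub - α * (((h 0).1:ℕ):A) - β * (((h 1).1:ℕ):A))),
      conj (g (z + γ (vc - α * (((h 0).1:ℕ):A) - β * (((h 1).1:ℕ):A) + pk * ((((h 0).2:ℕ):A) + (((h 1).2:ℕ):A) + (((h 2).2:ℕ):A)))))
      ] i)
    (by
      intro i x b
      fin_cases i
      · exact nml (hg _) (ncl (hg _))
      · exact ncl (hg _)
      · exact hg _
      · exact ncl (hg _))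
    (by
      intro i z h pm hh
      fin_cases i
      · have ho := hh 1 (by decide)
        have jb := hh 2 (by decide)
        have jd := hh 3 (by decide)
        simp only [ho, jb, jd]; rfl
      · have ho := hh 0 (by decide)
        have jb := hh 2 (by decide)
        have jd := hh 3 (by decide)
        simp only [ho, jb, jd]; rfl
      · have ho := hh 0 (by decide)
        have jb := hh 1 (by decide)
        have jd := hh 3 (by decide)
        simp only [ho, jb, jd]; rfl
      · have ho := hh 0 (by decide)
        have jb := hh 1 (by decide)
        have jd := hh 2 (by decide)
        simp only [ho, jb, jd]; rfl)
    ![fun h => pk * ((h.2:ℕ) : A) - α * ((h.1:ℕ) : A), fun h => pk * ((h.2:ℕ) : A) - β * ((h.1:ℕ) : A),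
      fun h => pk * ((h.2:ℕ) : A) - ph * ((h.1:ℕ) : A), fun h => (-ph) * ((h.1:ℕ) : A)] g
  have hl : (List.ofFn fun i : Fin 4 => nu ((![fun h => pk * ((h.2:ℕ) : A) - α * ((h.1:ℕ) : A), fun h => pk * ((h.2:ℕ) : A) - β * ((h.1:ℕ) : A),
      fun h => pk * ((h.2:ℕ) : A) - ph * ((h.1:ℕ) : A), fun h => (-ph) * ((h.1:ℕ) : A)] : Fin 4 → Fin mb × Fin mb → A) i)) =
      [sp mb α pk, sp mb β pk, sp mb ph pk, ap mb ph] := by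
    have ho : nu (fun h : Fin mb × Fin mb => (-ph) * ((h.1:ℕ) : A)) = ap mb ph := by
      rw [nu_fst (Y := Fin mb) (Z := Fin mb) (fun u => (-ph) * ((u:ℕ) : A)), ← ap_neg]; rfl
    simp only [List.ofFn_succ, List.ofFn_zero]
    rw [← ho]
    rfl
  rw [hl] at key
  refine le_trans (le_of_eq ?_) key
  congr 2
  rw [expect_comm (s := (univ : Finset G))]
  refine expect_congr rfl fun h _ => ?_
  have hp4 : ∀ F : Fin (3+1) → ℂ, ∏ i, F i = F 0 * F 1 * F 2 * F 3 := fun F => Fin.prod_univ_four F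
  have hs4 : ∀ F : Fin (3+1) → A, ∑ i, F i = F 0 + F 1 + F 2 + F 3 := fun F => Fin.sum_univ_four F
  have hsum : ∑ i, (![fun h => pk * ((h.2:ℕ) : A) - α * ((h.1:ℕ) : A), fun h => pk * ((h.2:ℕ) : A) - β * ((h.1:ℕ) : A),
      fun h => pk * ((h.2:ℕ) : A) - ph * ((h.1:ℕ) : A), fun h => (-ph) * ((h.1:ℕ) : A)] : Fin 4 → Fin mb × Fin mb → A) i (h i) =
      pk * (((h 0).2:ℕ):A) - α * (((h 0).1:ℕ):A) + (pk * (((h 1).2:ℕ):A) - β * (((h 1).1:ℕ):A)) +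
      (pk * (((h 2).2:ℕ):A) - ph * (((h 2).1:ℕ):A)) + (-ph) * (((h 3).1:ℕ):A) := by
    rw [hs4]; rfl
  simp_rw [hp4]
  rw [hsum]
  generalize (((h 0).1:ℕ):A) = bc
  generalize (((h 1).1:ℕ):A) = ba
  generalize (((h 2).1:ℕ):A) = bb
  generalize (((h 3).1:ℕ):A) = bd
  generalize (((h 0).2:ℕ):A) = wa
  generalize (((h 1).2:ℕ):A) = wb
  generalize (((h 2).2:ℕ):A) = wc
  rw [← eshift (γ (-ub - α * bc - β * ba - ph * bb - ph * bd))]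
  refine expect_congr rfl fun z _ => ?_
  simp only [add_assoc z, ← map_add γ]
  simp only [map_mul, Complex.conj_conj]
  change _ = (g (z + γ (v + u - ub - ph * (bb + bd))) * conj (g (z + γ (u - ub - β * ba - ph * (bb + bd)))) *
    conj (g (z + γ (v - ub - α * bc - ph * (bb + bd)))) * g (z + γ (vc - ub - α * bc - β * ba)) *
    conj (g (z + γ (vc - α * bc - β * ba + pk * (wa + wb + wc))))) *
    g (z + γ (pk * wa - α * bc + (pk * wb - β * ba) + (pk * wc - ph * bb) + (-ph) * bd))
  have rd : -ub - α * bc - β * ba - ph * bb - ph * bd + (v + β * ba) + (u + α * bc) = v + u - ub - ph * (bb + bd) := by ring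
  have rc : -ub - α * bc - β * ba - ph * bb - ph * bd + (v + β * ba) = v - ub - α * bc - ph * (bb + bd) := by ring
  have rb : -ub - α * bc - β * ba - ph * bb - ph * bd + (u + α * bc) = u - ub - β * ba - ph * (bb + bd) := by ring
  have r4 : -ub - α * bc - β * ba - ph * bb - ph * bd + (vc + ph * (bb + bd)) + (ub + pk * (wa + wb + wc))
    = vc - α * bc - β * ba + pk * (wa + wb + wc) := by ring
  have r5 : -ub - α * bc - β * ba - ph * bb - ph * bd + (vc + ph * (bb + bd)) = vc - ub - α * bc - β * ba := by ring
  have r6 : -ub - α * bc - β * ba - ph * bb - ph * bd + (ub + pk * (wa + wb + wc)) =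
    pk * wa - α * bc + (pk * wb - β * ba) + (pk * wc - ph * bb) + (-ph) * bd := by ring
  rw [rd, rc, rb, r4, r5, r6]
  ring
theorem concat2_aux (m mb : ℕ) [NeZero m] [NeZero mb] (α β : Ω → A) (g : G → ℂ) (hg : ∀ x, ‖g x‖ ≤ 1) (ε : ℝ)
    (hε : 0 ≤ ε) (hm : 48 * (mb:ℝ) / m ≤ ε ^ 2) (h : ε ≤ 𝔼 ω, Box γ [ap m (α ω), ap m (β ω)] g) :
    (ε ^ 2 / 2) ^ 16 ≤ 𝔼 ω, 𝔼 pg, Box γ [sp mb (α ω) (α pg), sp mb (β ω) (α pg), sp mb (β pg) (α pg), ap mb (β pg)] g := by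
  set k : Ω × Fin m × Fin m → G → ℕ → ℕ → ℂ := fun q z u v =>
    g (z + γ (β q.1 * v - β q.1 * ((q.2.2:ℕ):A)) + γ (α q.1 * u - α q.1 * ((q.2.1:ℕ):A))) *
      conj (g (z + γ (β q.1 * v - β q.1 * ((q.2.2:ℕ):A)))) * conj (g (z + γ (α q.1 * u - α q.1 * ((q.2.1:ℕ):A)))) with hk
  have hkb : ∀ q z u v, ‖k q z u v‖ ≤ 1 := fun q z u v =>
    nml (nml (hg _) (ncl (hg _))) (ncl (hg _))
  set V : Ω × Fin m × Fin m → Ω × Fin m × Fin m → ℕ → ℕ → ℕ → ℕ → ℂ := fun q qc u v ub vc => 𝔼 z,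
    k q z u v * conj (k qc z ub vc) with hV
  have hVb : ∀ q qc u v ub vc, ‖V q qc u v ub vc‖ ≤ 1 := fun q qc u v ub vc => neo fun x =>
    nml (hkb _ _ _ _) (ncl (hkb _ _ _ _))
  have ea : 𝔼 ω, Box γ [ap m (α ω), ap m (β ω)] g = (𝔼 z, g z * 𝔼 q : Ω × Fin m × Fin m, 𝔼 u : Fin m, 𝔼 v : Fin m,
      k q z u v).re := by
    simp only [ap, Box_nu]
    simp only [Box, ← re_expect]
    congr 1
    simp_rw [mul_expect]
    rw [expect_comm (s := (univ : Finset G)), eprod]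
    refine expect_congr rfl fun ω _ => ?_
    rw [eprod, expect_comm]
    refine expect_congr rfl fun u2 _ => ?_
    simp_rw [expect_comm (s := (univ : Finset G))]
    rw [expect_comm]
    have : ∀ F : Fin m → Fin m → Fin m → ℂ, 𝔼 va, 𝔼 ua, 𝔼 vb, F ua va vb = 𝔼 vb, 𝔼 ua, 𝔼 va, F ua va vb := by
      intro F
      rw [expect_comm]
      refine Eq.trans (expect_congr rfl fun ua _ => (?_ : _ = 𝔼 vb, 𝔼 va, F ua va vb)) ?_
      · rw [expect_comm]
      · rw [expect_comm]
    rw [this (fun ua va vb => 𝔼 i, dd γ (β ω * ((va:ℕ):A) - β ω * ((vb:ℕ):A)) (dd γ (α ω * ((ua:ℕ):A) - α ω * ((u2:ℕ):A)) g) i)]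
    refine expect_congr rfl fun vb _ => expect_congr rfl fun ua _ => expect_congr rfl fun va _ => expect_congr rfl fun z _ => ?_
    simp only [dd, hk, map_mul, Complex.conj_conj]; ring
  rw [ea] at h
  have eb := (pow_le_pow_left₀ hε (h.trans (Complex.re_le_norm _)) 2).trans
    (cs_kill _ _ fun z => hg z)
  have ec : ε ^ 2 ≤ ‖𝔼 q, 𝔼 qc, 𝔼 u : Fin m, 𝔼 v : Fin m, 𝔼 ub : Fin m, 𝔼 vc : Fin m, V q qc u v ub vc‖ := by
    refine eb.trans ((le_of_eq ?_).trans (Complex.re_le_norm _))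
    simp_rw [nse, ← re_expect]
    congr 1
    rw [expect_comm (s := (univ : Finset G))]
    refine expect_congr rfl fun q _ => ?_
    rw [expect_comm (s := (univ : Finset G))]
    refine expect_congr rfl fun qc _ => ?_
    simp_rw [conj_expect, expect_mul, mul_expect]
    simp_rw [expect_comm (s := (univ : Finset G)), hV]
  set sh : (Fin 4 → Fin mb × Fin mb) → Fin 4 → ℕ := fun h => ![(h 0).1, (h 1).1, (h 0).2 + (h 1).2 + (h 2).2, (h 2).1 + (h 3).1] with hsh
  have hshb : ∀ h i, sh h i ≤ 3 * mb := by
    intro h i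
    have bc := (h 0).1.2
    have ba := (h 1).1.2
    have bb := (h 2).1.2
    have bd := (h 3).1.2
    have c0 := (h 0).2.2
    have c1 := (h 1).2.2
    have ca := (h 2).2.2
    fin_cases i <;> simp [hsh] <;> omega
  have ed : ‖𝔼 q, 𝔼 qc, 𝔼 u : Fin m, 𝔼 v : Fin m, 𝔼 ub : Fin m, 𝔼 vc : Fin m, V q qc u v ub vc -
      𝔼 q, 𝔼 qc, 𝔼 h : Fin 4 → Fin mb × Fin mb, 𝔼 u : Fin m, 𝔼 v : Fin m, 𝔼 ub : Fin m, 𝔼 vc : Fin m,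
        V q qc (u + sh h 0) (v + sh h 1) (ub + sh h 2) (vc + sh h 3)‖ ≤ 8 * (3 * mb : ℕ) / m := by
    rw [← expect_sub_distrib]
    refine nel fun a => ?_
    rw [← expect_sub_distrib]
    refine nel fun ac => ?_
    rw [← Fintype.expect_const (ι := Fin 4 → Fin mb × Fin mb) (𝔼 u : Fin m, 𝔼 v : Fin m, 𝔼 ub : Fin m, 𝔼 vc : Fin m, V a ac u v ub vc),
      ← expect_sub_distrib]
    refine nel fun h => ?_
    exact shift4 m (3 * mb) (sh h) (hshb h) (V a ac) (hVb a ac)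
  have ef : ε ^ 2 / 2 ≤ ‖𝔼 q, 𝔼 qc, 𝔼 u : Fin m, 𝔼 v : Fin m, 𝔼 ub : Fin m, 𝔼 vc : Fin m, 𝔼 h : Fin 4 → Fin mb × Fin mb,
        V q qc (u + sh h 0) (v + sh h 1) (ub + sh h 2) (vc + sh h 3)‖ := by
    simp_rw [expect_comm (s := (univ : Finset (Fin 4 → Fin mb × Fin mb)))] at ed
    have jl : 8 * ((3 * mb : ℕ):ℝ) / m = 48 * (mb:ℝ) / m / 2 := by push_cast; ring
    have := norm_sub_norm_le (𝔼 q, 𝔼 qc, 𝔼 u : Fin m, 𝔼 v : Fin m, 𝔼 ub : Fin m, 𝔼 vc : Fin m, V q qc u v ub vc)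
      (𝔼 q, 𝔼 qc, 𝔼 u : Fin m, 𝔼 v : Fin m, 𝔼 ub : Fin m, 𝔼 vc : Fin m, 𝔼 h : Fin 4 → Fin mb × Fin mb,
        V q qc (u + sh h 0) (v + sh h 1) (ub + sh h 2) (vc + sh h 3))
    linarith
  have eg := pow_le_pow_left₀ (by positivity) ef 16
  refine eg.trans ?_
  have ee : 𝔼 ω, 𝔼 pg, Box γ [sp mb (α ω) (α pg), sp mb (β ω) (α pg), sp mb (β pg) (α pg), ap mb (β pg)] g =
      𝔼 q : Ω × Fin m × Fin m, 𝔼 qc : Ω × Fin m × Fin m,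
        Box γ [sp mb (α q.1) (α qc.1), sp mb (β q.1) (α qc.1), sp mb (β qc.1) (α qc.1), ap mb (β qc.1)] g := by
    simp only [eprod, Fintype.expect_const]
  rw [ee]
  refine (npe 4 _).trans (emono fun q => ?_)
  refine (npe 4 _).trans (emono fun qc => ?_)
  refine (npe 4 _).trans (ele fun u => ?_)
  refine (npe 4 _).trans (ele fun v => ?_)
  refine (npe 4 _).trans (ele fun ub => ?_)
  refine (npe 4 _).trans (ele fun vc => ?_)
  have key := concat2_core γ mb g hg (α q.1) (β q.1) (α qc.1) (β qc.1)
    (α q.1 * ((u:ℕ):A) - α q.1 * ((q.2.1:ℕ):A)) (β q.1 * ((v:ℕ):A) - β q.1 * ((q.2.2:ℕ):A))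
    (α qc.1 * ((ub:ℕ):A) - α qc.1 * ((qc.2.1:ℕ):A)) (β qc.1 * ((vc:ℕ):A) - β qc.1 * ((qc.2.2:ℕ):A))
  refine le_trans (le_of_eq ?_) key
  congr 2
  refine expect_congr rfl fun h _ => ?_
  simp only [hV]
  refine expect_congr rfl fun z _ => ?_
  have s0 : sh h 0 = (h 0).1 := rfl
  have sa : sh h 1 = (h 1).1 := rfl
  have sb : sh h 2 = (h 0).2 + (h 1).2 + (h 2).2 := rfl
  have sc : sh h 3 = (h 2).1 + (h 3).1 := rfl
  have r : ∀ a b c w : A, a * (b + c) - a * w = a * b - a * w + a * c := fun a b c w => by ring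
  simp only [hk, s0, sa, sb, sc, Nat.cast_add, r, map_mul]
theorem concat1 {ε : ℝ} (hε : 0 < ε) (hε2 : ε ≤ 1/2) (m mb : ℕ) (hm : 0 < m) (jf : 0 < mb) (hm' : (mb:ℝ) ≤ ε ^ 7 * m)
    (α : Ω → A) (la : List (A → ℝ)) (hl : ∀ ν ∈ la, IsNu ν) (f : G → ℂ) (hf : ∀ x, ‖f x‖ ≤ 1)
    (h : ε ≤ 𝔼 ω, Box γ (la ++ [ap m (α ω)]) f) :
    ε ^ 12 ≤ 𝔼 ω, 𝔼 pg, Box γ (la ++ [sp mb (α ω) (α pg)]) f := by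
  have : NeZero m := ⟨hm.ne'⟩
  have : NeZero mb := ⟨jf.ne'⟩
  obtain ⟨I, _, w, F, wa, wb, hF, hB⟩ := Box_prefix γ la hl f hf
  simp only [hB] at h ⊢
  simp_rw [expect_sum_comm, ← mul_expect] at h ⊢
  have key := popular_w wa wb hε.le (η := (((ε/2) ^ 2 / 2) ^ 2)) (by positivity)
    (E := fun i => 𝔼 ω, Box γ [ap m (α ω)] (F i))
    (F := fun i => 𝔼 ω, 𝔼 pg, Box γ [sp mb (α ω) (α pg)] (F i)) ?_ ?_ ?_ h
  · refine le_trans ?_ key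
    have := epm hε hε2 5 7 (c := 128) (by norm_num)
    norm_num at this
    have e : ε / 2 * ((ε / 2) ^ 2 / 2) ^ 2 = ε ^ 5 / 128 := by ring
    rw [e]; linarith
  · intro i
    exact ele fun ω => Boxo γ _ (by simp [isNu_ap]) _ (hF i)
  · intro i
    exact expect_nn fun ω => expect_nn fun pg => Boxn γ _ (by simp [isNu_sp]) (by simp) _
  · intro i hi
    refine concat1_aux γ m mb α (F i) (hF i) (ε/2) (by positivity) ?_ hi
    have hmp : 0 < (m:ℝ) := by exact_mod_cast hm
    rw [div_le_iff₀ hmp]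
    have := epm hε hε2 2 5 (c := 32) (by norm_num)
    norm_num at this
    have : 32 * ε ^ 7 * m ≤ ε ^ 2 * m := mul_le_mul_of_nonneg_right this hmp.le
    nlinarith
theorem concat2 {ε : ℝ} (hε : 0 < ε) (hε2 : ε ≤ 1/2) (m mb : ℕ) (hm : 0 < m) (jf : 0 < mb) (hm' : (mb:ℝ) ≤ ε ^ 10 * m)
    (α β : Ω → A) (la : List (A → ℝ)) (hl : ∀ ν ∈ la, IsNu ν) (f : G → ℂ) (hf : ∀ x, ‖f x‖ ≤ 1)
    (h : ε ≤ 𝔼 ω, Box γ (la ++ [ap m (α ω), ap m (β ω)]) f) :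
    ε ^ 82 ≤ 𝔼 ω, 𝔼 pg, Box γ (la ++ [sp mb (α ω) (α pg), sp mb (β ω) (α pg), sp mb (β pg) (α pg), ap mb (β pg)]) f := by
  have : NeZero m := ⟨hm.ne'⟩
  have : NeZero mb := ⟨jf.ne'⟩
  obtain ⟨I, _, w, F, wa, wb, hF, hB⟩ := Box_prefix γ la hl f hf
  simp only [hB] at h ⊢
  simp_rw [expect_sum_comm, ← mul_expect] at h ⊢
  have key := popular_w wa wb hε.le (η := (((ε/2) ^ 2 / 2) ^ 16)) (by positivity)
    (E := fun i => 𝔼 ω, Box γ [ap m (α ω), ap m (β ω)] (F i))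
    (F := fun i => 𝔼 ω, 𝔼 pg, Box γ [sp mb (α ω) (α pg), sp mb (β ω) (α pg), sp mb (β pg) (α pg), ap mb (β pg)] (F i)) ?_ ?_ ?_ h
  · refine le_trans ?_ key
    have := epm hε hε2 33 49 (c := 2 ^ 49) (by norm_num)
    norm_num at this
    have e : ε / 2 * ((ε / 2) ^ 2 / 2) ^ 16 = ε ^ 33 / 2 ^ 49 := by ring
    rw [e]; norm_num; linarith
  · intro i
    exact ele fun ω => Boxo γ _ (by simp [isNu_ap]) _ (hF i)
  · intro i
    exact expect_nn fun ω => expect_nn fun pg => Boxn γ _ (by simp [isNu_sp, isNu_ap]) (by simp) _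
  · intro i hi
    refine concat2_aux γ m mb α β (F i) (hF i) (ε/2) (by positivity) ?_ hi
    have hmp : 0 < (m:ℝ) := by exact_mod_cast hm
    rw [div_le_iff₀ hmp]
    have := epm hε hε2 2 8 (c := 192) (by norm_num)
    norm_num at this
    have : 192 * ε ^ 10 * m ≤ ε ^ 2 * m := mul_le_mul_of_nonneg_right this hmp.le
    nlinarith
end concat
open Classical in
noncomputable def ind (p : Prop) : ℝ := if p then 1 else 0
theorem indn (p : Prop) : 0 ≤ ind p := by unfold ind; split_ifs <;> norm_num
theorem ind_le_one (p : Prop) : ind p ≤ 1 := by unfold ind; split_ifs <;> norm_num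
theorem indt {p : Prop} (h : p) : ind p = 1 := by simp [ind, h]
theorem indf {p : Prop} (h : ¬ p) : ind p = 0 := by simp [ind, h]
theorem ind_mono {p q : Prop} (h : p → q) : ind p ≤ ind q := by
  by_cases hp : p
  · rw [indt hp, indt (h hp)]
  · rw [indf hp]; exact indn q
theorem card_class (m k : ℕ) (hk : 0 < k) (S : Finset ℕ) (hS : ∀ x ∈ S, x < m)
    (hc : ∀ x ∈ S, ∀ y ∈ S, x % k = y % k) : S.card ≤ m / k + 1 := by
  rw [← card_range (m / k + 1)]
  refine card_le_card_of_injOn (fun x => x / k) ?_ ?_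
  · intro x hx
    simp only [coe_range, Set.mem_Iio]
    exact Nat.lt_succ_of_le (Nat.div_le_div_right (hS x hx).le)
  · intro x hx y hy h
    have ho := hc x hx y hy
    have jb : x / k = y / k := h
    rw [← Nat.div_add_mod x k, ← Nat.div_add_mod y k, ho, jb]
theorem expect_ind_fin (m : ℕ) (p : ℕ → Prop) [DecidablePred p] :
    𝔼 x : Fin m, ind (p x) = (((range m).filter p).card : ℝ) / m := by
  rw [Fintype.expect_eq_sum_div_card, Fintype.card_fin, Fin.sum_univ_eq_sum_range (fun i => ind (p i))]
  congr 1
  rw [card_filter]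
  push_cast
  refine sum_congr rfl fun x _ => ?_
  unfold ind; split_ifs <;> rfl
theorem card_class_fin (m k : ℕ) (hk : 0 < k) (p : ℕ → Prop) (hc : ∀ x y, p x → p y → x % k = y % k) (hm : 0 < m) :
    𝔼 x : Fin m, ind (p x) ≤ ((m:ℝ) / k + 1) / m := by
  classical
  rw [expect_ind_fin]
  gcongr
  have := card_class m k hk ((range m).filter p) (by simp; tauto) (by
    intro x hx y hy
    exact hc x y (mem_filter.mp hx).2 (mem_filter.mp hy).2)
  calc ((#{x ∈ range m | p x} : ℕ) : ℝ) ≤ ((m / k + 1 : ℕ) : ℝ) := by exact_mod_cast this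
    _ ≤ _ := by push_cast; gcongr; exact Nat.cast_div_le
theorem dv (L : ℕ) (hL : 0 < L) (s : ℤ) (d : ℕ) (hd : 0 < d) (ks : d ≤ 2 * L) :
    𝔼 y : Fin L, 𝔼 z : Fin L, ind ((d:ℤ) ∣ ((z:ℕ):ℤ) - ((y:ℕ):ℤ) + s) ≤ 3 / d := by
  have : Nonempty (Fin L) := ⟨⟨0, hL⟩⟩
  refine ele fun y => ?_
  refine (card_class_fin L d hd (fun z => (d:ℤ) ∣ (z:ℤ) - ((y:ℕ):ℤ) + s) ?_ hL).trans ?_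
  · intro x z hx hz
    have : (d:ℤ) ∣ (z:ℤ) - x := by
      have := dvd_sub hz hx
      ring_nf at this ⊢; exact this
    exact (Nat.modEq_iff_dvd.mpr this)
  · have ho : (0:ℝ) < L := by exact_mod_cast hL
    have jb : (0:ℝ) < d := by exact_mod_cast hd
    have jd : (d:ℝ) ≤ 2 * L := by exact_mod_cast ks
    rw [div_add_one jb.ne', div_div, div_le_div_iff₀ (by positivity) jb]
    nlinarith [mul_pos ho jb]
theorem small (L : ℕ) (hL : 0 < L) (s : ℤ) (θ : ℝ) (hθ : 0 ≤ θ) :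
    𝔼 y : Fin L, 𝔼 z : Fin L, ind ((|((z:ℕ):ℤ) - ((y:ℕ):ℤ) + s| : ℝ) < θ) ≤ (2 * θ + 1) / L := by
  classical
  have : Nonempty (Fin L) := ⟨⟨0, hL⟩⟩
  refine ele fun y => ?_
  rw [expect_ind_fin L (fun z => (|((z:ℕ):ℤ) - ((y:ℕ):ℤ) + s| : ℝ) < θ)]
  gcongr
  have ho : #{x ∈ range L | (|((x:ℕ):ℤ) - ((y:ℕ):ℤ) + s| : ℝ) < θ} ≤ (2 * ⌈θ⌉₊ - 1) := by
    have hc : (Finset.Ioo (((y:ℕ):ℤ) - s - ⌈θ⌉₊) (((y:ℕ):ℤ) - s + ⌈θ⌉₊)).card = 2 * ⌈θ⌉₊ - 1 := by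
      rw [Int.card_Ioo]; omega
    rw [← hc]
    refine card_le_card_of_injOn (fun x => (x:ℤ)) ?_ (fun x _ y _ h => by simpa using h)
    intro x hx
    have hx := (mem_filter.mp (mem_coe.mp hx)).2
    have je : (|((x:ℕ):ℤ) - ((y:ℕ):ℤ) + s| : ℝ) < (⌈θ⌉₊ : ℝ) := lt_of_lt_of_le hx (Nat.le_ceil θ)
    rw [abs_lt] at je
    have jg : -((⌈θ⌉₊:ℕ):ℤ) < ((x:ℕ):ℤ) - ((y:ℕ):ℤ) + s := by exact_mod_cast je.1
    have jl : ((x:ℕ):ℤ) - ((y:ℕ):ℤ) + s < ((⌈θ⌉₊:ℕ):ℤ) := by exact_mod_cast je.2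
    simp only [coe_Ioo, Set.mem_Ioo]
    omega
  have jb := Nat.ceil_lt_add_one hθ
  calc ((#{x ∈ range L | (|((x:ℕ):ℤ) - ((y:ℕ):ℤ) + s| : ℝ) < θ} : ℕ) : ℝ) ≤ ((2 * ⌈θ⌉₊ - 1 : ℕ) : ℝ) := by exact_mod_cast ho
    _ ≤ 2 * θ + 1 := by
      rcases Nat.eq_zero_or_pos ⌈θ⌉₊ with h | h
      · rw [h]; simp; linarith
      · rw [Nat.cast_sub (by omega)]; push_cast; linarith
theorem gcdbad {Ω Ω' : Type} [Fintype Ω] [Fintype Ω'] (X : Ω → ℤ) (Y : Ω' → ℤ) (L : ℕ)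
    (hX : ∀ d : ℕ, 0 < d → d ≤ L → 𝔼 ω, ind ((d:ℤ) ∣ X ω) ≤ 3 / d)
    (hY : ∀ d : ℕ, 0 < d → d ≤ L → 𝔼 ω, ind ((d:ℤ) ∣ Y ω) ≤ 3 / d)
    (hYL : ∀ ω, |Y ω| ≤ L) (D : ℕ) (hD : 0 < D) :
    𝔼 ω, 𝔼 pg, ind (D < Int.gcd (X ω) (Y pg) ∧ Y pg ≠ 0) ≤ 9 / D := by
  have ho : ∀ ω pg, ind (D < Int.gcd (X ω) (Y pg) ∧ Y pg ≠ 0) ≤ ∑ d ∈ Ioc D L, ind ((d:ℤ) ∣ X ω) * ind ((d:ℤ) ∣ Y pg) := by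
    intro ω pg
    by_cases h : D < Int.gcd (X ω) (Y pg) ∧ Y pg ≠ 0
    · rw [indt h]
      have hg : Int.gcd (X ω) (Y pg) ∈ Ioc D L := by
        rw [mem_Ioc]
        refine ⟨h.1, ?_⟩
        have := Nat.le_of_dvd (Int.natAbs_pos.mpr h.2) (Int.gcd_dvd_natAbs_right (X ω) (Y pg))
        have := hYL pg
        rw [Int.abs_eq_natAbs] at this
        omega
      refine le_trans (le_of_eq ?_) (single_le_sum (f := fun d : ℕ => ind ((d:ℤ) ∣ X ω) * ind ((d:ℤ) ∣ Y pg)) (fun d _ => mul_nonneg (indn _) (indn _)) hg)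
      rw [indt (Int.gcd_dvd_left ..), indt (Int.gcd_dvd_right ..), one_mul]
    · rw [indf h]
      exact sum_nonneg fun d _ => mul_nonneg (indn _) (indn _)
  calc _ ≤ 𝔼 ω, 𝔼 pg, ∑ d ∈ Ioc D L, ind ((d:ℤ) ∣ X ω) * ind ((d:ℤ) ∣ Y pg) :=
        emono fun ω => emono fun pg => ho ω pg
    _ = ∑ d ∈ Ioc D L, (𝔼 ω, ind ((d:ℤ) ∣ X ω)) * 𝔼 pg, ind ((d:ℤ) ∣ Y pg) := by
        simp_rw [expect_sum_comm, expect_mul, mul_expect]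
    _ ≤ ∑ d ∈ Ioc D L, 9 * ((d:ℝ) ^ 2)⁻¹ := by
        refine sum_le_sum fun d hd => ?_
        rw [mem_Ioc] at hd
        have := mul_le_mul (hX d (by omega) hd.2) (hY d (by omega) hd.2) (expect_nn fun _ => indn _) (by positivity)
        refine this.trans (le_of_eq ?_)
        have : (d:ℝ) ≠ 0 := by exact_mod_cast (by omega : d ≠ 0)
        field_simp; norm_num
    _ ≤ 9 * (D:ℝ)⁻¹ := by
        rw [← mul_sum]
        gcongr
        rcases le_or_gt D L with h | h
        · refine (sum_Ioc_inv_sq_le_sub hD.ne' h).trans ?_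
          simp
        · rw [Ioc_eq_empty (by omega)]; simp
    _ = _ := by ring
def Good (η : ℝ) (M : ℕ) (X Y : ℤ) : Prop := η * M ≤ |(Y:ℝ)| ∧ (Int.gcd X Y : ℝ) * (2 * η) ≤ 1
theorem bad_prob {Ω Ω' : Type} [Fintype Ω] [Fintype Ω'] [Nonempty Ω] [Nonempty Ω'] (X : Ω → ℤ) (Y : Ω' → ℤ) (L M : ℕ)
    (hX : ∀ d : ℕ, 0 < d → d ≤ L → 𝔼 ω, ind ((d:ℤ) ∣ X ω) ≤ 3 / d)
    (hY : ∀ d : ℕ, 0 < d → d ≤ L → 𝔼 ω, ind ((d:ℤ) ∣ Y ω) ≤ 3 / d)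
    (hYL : ∀ ω, |Y ω| ≤ L) (η : ℝ) (hη : 0 < η) (hη2 : η ≤ 1/2) (hM : 0 < M) :
    𝔼 ω, 𝔼 pg, ind (¬ Good η M (X ω) (Y pg)) ≤ 36 * η + 𝔼 pg, ind (|(Y pg:ℝ)| < η * M) := by
  obtain ⟨D, hD, hD1, hD2⟩ : ∃ D : ℕ, 0 < D ∧ (D:ℝ) * (2 * η) ≤ 1 ∧ 1 ≤ D * (4 * η) := by
    have ho : 1 ≤ 1 / (2 * η) := by rw [le_div_iff₀ (by positivity)]; linarith
    refine ⟨⌊1 / (2 * η)⌋₊, Nat.floor_pos.mpr ho, ?_, ?_⟩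
    · have := Nat.floor_le (by positivity : 0 ≤ 1 / (2 * η))
      rwa [le_div_iff₀ (by positivity)] at this
    · have jb := Nat.lt_floor_add_one (1 / (2 * η))
      have jd : (1:ℝ) ≤ ⌊1 / (2 * η)⌋₊ := by exact_mod_cast Nat.floor_pos.mpr ho
      have je : 1 / (2 * η) ≤ 2 * ⌊1 / (2 * η)⌋₊ := by linarith
      rw [div_le_iff₀ (by positivity)] at je
      linarith
  have ho : ∀ ω pg, ind (¬ Good η M (X ω) (Y pg)) ≤ ind (D < Int.gcd (X ω) (Y pg) ∧ Y pg ≠ 0) + ind (|(Y pg:ℝ)| < η * M) := by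
    intro ω pg
    by_cases jb : |(Y pg:ℝ)| < η * M
    · rw [indt jb]; linarith [ind_le_one (¬ Good η M (X ω) (Y pg)), indn (D < Int.gcd (X ω) (Y pg) ∧ Y pg ≠ 0)]
    · rw [indf jb, add_zero]
      apply ind_mono
      intro hg
      push Not at jb
      constructor
      · by_contra hc
        push Not at hc
        refine hg ⟨jb, le_trans ?_ hD1⟩
        gcongr
      · intro ja
        rw [ja] at jb
        simp at jb
        have : (0:ℝ) < M := by exact_mod_cast hM
        nlinarith [mul_pos hη this]
  calc _ ≤ 𝔼 ω, 𝔼 pg, (ind (D < Int.gcd (X ω) (Y pg) ∧ Y pg ≠ 0) + ind (|(Y pg:ℝ)| < η * M)) :=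
        emono fun ω => emono fun pg => ho ω pg
    _ = 𝔼 ω, 𝔼 pg, ind (D < Int.gcd (X ω) (Y pg) ∧ Y pg ≠ 0) + 𝔼 pg, ind (|(Y pg:ℝ)| < η * M) := by
        simp_rw [expect_add_distrib, Fintype.expect_const]
    _ ≤ 9 / D + 𝔼 pg, ind (|(Y pg:ℝ)| < η * M) := by
        gcongr; exact gcdbad X Y L hX hY hYL D hD
    _ ≤ _ := by
        gcongr
        rw [div_le_iff₀ (by exact_mod_cast hD)]; linarith
section dom
variable {M P : ℕ} [NeZero P] (hP : P = 16 * M ^ 2)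
theorem sp_le (hP : P = 16 * M ^ 2) (m : ℕ) (hm : 0 < m) (hmM : m < M) (α β : ℤ) (hα : |α| ≤ 4 * M) (hβ : |β| ≤ 4 * M) (hβ0 : β ≠ 0)
    (t : ZMod P) : sp m (α : ZMod P) (β : ZMod P) t ≤ ((m:ℝ) * Int.gcd α β / |(β:ℝ)| + 1) / m ^ 2 := by
  classical
  have : NeZero m := ⟨hm.ne'⟩
  unfold sp nu
  rw [expect_comm]
  refine ele fun b => ?_
  set n : ZMod P := t + (β * ((b.2:ℕ) : ZMod P) - α * ((b.1:ℕ) : ZMod P)) with hn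
  have ea : (𝔼 a : Fin m × Fin m, if (β * ((a.2:ℕ) : ZMod P) - α * ((a.1:ℕ) : ZMod P)) - (β * ((b.2:ℕ) : ZMod P) - α * ((b.1:ℕ) : ZMod P)) = t then (1:ℝ) else 0)
     = (#{a : Fin m × Fin m | (β * ((a.2:ℕ) : ZMod P) - α * ((a.1:ℕ) : ZMod P)) = n} : ℝ) / m ^ 2 := by
    rw [Fintype.expect_eq_sum_div_card, card_filter]
    simp only [Fintype.card_prod, Fintype.card_fin]
    push_cast
    rw [sq]
    congr 1
    refine sum_congr rfl fun a _ => ?_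
    simp only [sub_eq_iff_eq_add, hn]
  rw [ea]
  gcongr
  set g := Int.gcd α β with hg
  have hgpos : 0 < g := Int.gcd_pos_of_ne_zero_right _ hβ0
  obtain ⟨ph, hβ'⟩ : (g:ℤ) ∣ β := Int.gcd_dvd_right ..
  obtain ⟨pk, hα'⟩ : (g:ℤ) ∣ α := Int.gcd_dvd_left ..
  have hβ'0 : ph ≠ 0 := by rintro rfl; simp at hβ'; exact hβ0 hβ'
  have hcop : IsCoprime ph pk := by
    rw [Int.isCoprime_iff_gcd_eq_one, Int.gcd_comm]
    have ho : Int.gcd ((g:ℤ) * pk) (g * ph) = g := by rw [← hα', ← hβ']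
    rw [Int.gcd_mul_left] at ho
    rw [Int.natAbs_natCast] at ho
    exact Nat.eq_of_mul_eq_mul_left hgpos (ho.trans (mul_one g).symm)
  have key : ∀ a c : Fin m × Fin m, (β * ((a.2:ℕ) : ZMod P) - α * ((a.1:ℕ) : ZMod P)) = n →
      (β * ((c.2:ℕ) : ZMod P) - α * ((c.1:ℕ) : ZMod P)) = n → β * (((a.2:ℕ):ℤ) - ((c.2:ℕ):ℤ)) = α * (((a.1:ℕ):ℤ) - ((c.1:ℕ):ℤ)) := by
    intro a c ha hc
    have ho : (((β * (((a.2:ℕ):ℤ) - ((c.2:ℕ):ℤ)) - α * (((a.1:ℕ):ℤ) - ((c.1:ℕ):ℤ)) : ℤ)) : ZMod P) = 0 := by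
      push_cast; linear_combination ha - hc
    rw [ZMod.intCast_zmod_eq_zero_iff_dvd] at ho
    have jc : (0:ℤ) < M := by omega
    have ba : |((a.2:ℕ):ℤ) - ((c.2:ℕ):ℤ)| ≤ M - 1 := by
      have := a.2.2; have := c.2.2; rw [abs_le]; constructor <;> omega
    have bb : |((a.1:ℕ):ℤ) - ((c.1:ℕ):ℤ)| ≤ M - 1 := by
      have := a.1.2; have := c.1.2; rw [abs_le]; constructor <;> omega
    have jb := Int.eq_zero_of_abs_lt_dvd ho (by
      calc _ ≤ |β * (((a.2:ℕ):ℤ) - ((c.2:ℕ):ℤ))| + |α * (((a.1:ℕ):ℤ) - ((c.1:ℕ):ℤ))| := abs_sub _ _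
        _ ≤ 4 * M * (M - 1) + 4 * M * (M - 1) := by
            rw [abs_mul, abs_mul]
            gcongr
        _ < P := by rw [hP]; push_cast; nlinarith)
    linarith
  have hS := card_class m ph.natAbs (Int.natAbs_pos.mpr hβ'0)
    (image (fun a : Fin m × Fin m => (a.1:ℕ)) {a : Fin m × Fin m | (β * ((a.2:ℕ) : ZMod P) - α * ((a.1:ℕ) : ZMod P)) = n})
    (by
      intro x hx
      obtain ⟨a, _, rfl⟩ := mem_image.mp hx
      exact a.1.2)
    (by
      intro x hx y hy
      obtain ⟨a, ha, rfl⟩ := mem_image.mp hx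
      obtain ⟨c, hc, rfl⟩ := mem_image.mp hy
      have jd := key a c (mem_filter.mp ha).2 (mem_filter.mp hc).2
      rw [hβ', hα', mul_assoc, mul_assoc] at jd
      have je := mul_left_cancel₀ (by exact_mod_cast hgpos.ne') jd
      have jg : ph ∣ ((a.1:ℕ):ℤ) - ((c.1:ℕ):ℤ) := hcop.dvd_of_dvd_mul_left ⟨_, je.symm⟩
      exact (Nat.modEq_iff_dvd.mpr (Int.natAbs_dvd.mpr jg)).symm)
  rw [card_image_of_injOn] at hS
  · have hb : (ph.natAbs : ℝ) = |(β:ℝ)| / g := by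
      rw [hβ']; push_cast
      rw [abs_mul, Nat.abs_cast, Nat.cast_natAbs]; push_cast
      field_simp
    calc _ ≤ ((m / ph.natAbs + 1 : ℕ):ℝ) := by exact_mod_cast hS
      _ ≤ (m:ℝ) / ph.natAbs + 1 := by push_cast; gcongr; exact Nat.cast_div_le
      _ = _ := by rw [hb]; field_simp
  · intro a ha c hc hac
    have jd := key a c (mem_filter.mp (mem_coe.mp ha)).2 (mem_filter.mp (mem_coe.mp hc)).2
    simp only at hac
    rw [hac, sub_self, mul_zero] at jd
    have := (mul_eq_zero.mp jd).resolve_left hβ0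
    ext
    · exact hac
    · omega
theorem sp_good (hP : P = 16 * M ^ 2) (m : ℕ) (hm : 0 < m) (hmM : m < M) (η : ℝ) (hη : 0 < η) (hη2 : η ≤ 1/2) (hηm : η * M ≤ m)
    (X Y : ℤ) (hX : |X| ≤ 2 * M) (hY : |Y| ≤ 2 * M) (hg : Good η M X Y) (t : ZMod P) :
    sp m ((2 * X : ℤ) : ZMod P) ((2 * Y : ℤ) : ZMod P) t ≤ (η ^ 9)⁻¹ / Fintype.card (ZMod P) := by
  have hM : (0:ℝ) < M := by exact_mod_cast (by omega : 0 < M)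
  have hm' : (0:ℝ) < m := by exact_mod_cast hm
  have hYp : 0 < |(Y:ℝ)| := lt_of_lt_of_le (by positivity) hg.1
  have hY0 : Y ≠ 0 := by rintro rfl; simp at hYp
  refine (sp_le hP m hm hmM (2 * X) (2 * Y) (by rw [abs_mul]; norm_num; omega) (by rw [abs_mul]; norm_num; omega) (by omega) t).trans ?_
  rw [ZMod.card, hP, Int.gcd_mul_left]
  have ho : (m:ℝ) * ((Int.natAbs 2 * Int.gcd X Y : ℕ):ℝ) / |((2 * Y : ℤ) : ℝ)| ≤ 1 / η ^ 2 := by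
    push_cast
    rw [abs_mul]
    have : (|2| : ℝ) = 2 := by norm_num
    rw [this, div_le_div_iff₀ (by positivity) (by positivity)]
    have ea : (m:ℝ) ≤ M := by exact_mod_cast hmM.le
    have eb := hg.1
    have ec := hg.2
    have ed : (0:ℝ) ≤ Int.gcd X Y := by positivity
    calc (m:ℝ) * (((Int.natAbs 2:ℕ):ℝ) * Int.gcd X Y) * η ^ 2 = (m * η) * (Int.gcd X Y * (2 * η)) := by simp; ring
      _ ≤ (M * η) * 1 := by gcongr
      _ ≤ _ := by nlinarith
  calc _ ≤ (1 / η ^ 2 + 1) / (m:ℝ) ^ 2 := by gcongr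
    _ ≤ (1 / η ^ 2 + 1) / (η * M) ^ 2 := by gcongr
    _ = (16 * (1 + η ^ 2) * η ^ 5) * ((η ^ 9)⁻¹ / (16 * M ^ 2)) := by field_simp
    _ ≤ 1 * ((η ^ 9)⁻¹ / (16 * M ^ 2)) := by
        gcongr
        have : η ^ 5 ≤ (1/2) ^ 5 := by gcongr
        have : η ^ 2 ≤ (1/2) ^ 2 := by gcongr
        nlinarith [pow_pos hη 5, pow_pos hη 2]
    _ = _ := by push_cast; ring
end dom
def df {m : ℕ} (p : Fin m × Fin m) : ℤ := ((p.2:ℕ):ℤ) - ((p.1:ℕ):ℤ)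
theorem df_abs {m : ℕ} (p : Fin m × Fin m) : |df p| ≤ m := by
  unfold df; have := p.1.2; have := p.2.2; rw [abs_le]; constructor <;> omega
theorem df_dv (L : ℕ) (hL : 0 < L) (s : ℤ) (d : ℕ) (hd : 0 < d) (ks : d ≤ 2 * L) :
    𝔼 p : Fin L × Fin L, ind ((d:ℤ) ∣ df p + s) ≤ 3 / d := by
  rw [eprod]; exact dv L hL s d hd ks
theorem df_small (L : ℕ) (hL : 0 < L) (s : ℤ) (θ : ℝ) (hθ : 0 ≤ θ) :
    𝔼 p : Fin L × Fin L, ind (|((df p + s : ℤ) : ℝ)| < θ) ≤ (2 * θ + 1) / L := by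
  rw [eprod]
  have := small L hL s θ hθ
  simp only [df]; push_cast at this ⊢; exact this
section
variable {G : Type} [AddCommGroup G] [Fintype G] {M P : ℕ} [NeZero P] (γ : ZMod P →+ G)
def ca (P : ℕ) (x : ℤ) : ZMod P := ((2 * x : ℤ) : ZMod P)
theorem repl {Ω : Type} [Fintype Ω] [Nonempty Ω] (hP : P = 16 * M ^ 2) (m : ℕ) (hm : 0 < m) (hmM : m < M) {ρ : ℝ} (hρ : 0 < ρ) (hρ2 : ρ ≤ 1/2)
    (hηm : ρ ^ 9 * M ≤ m) (X Y : Ω → ℤ) (hX : ∀ ω, |X ω| ≤ 2 * M) (hY : ∀ ω, |Y ω| ≤ 2 * M)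
    (l : Ω → List (ZMod P → ℝ)) (hl : ∀ ω, ∀ ν ∈ l ω, IsNu ν) (ki : ∀ ω, l ω ≠ []) (f : G → ℂ) (hf : ∀ x, ‖f x‖ ≤ 1)
    (hbad : 𝔼 ω, ind (¬ Good (ρ ^ 9) M (X ω) (Y ω)) ≤ 39 * ρ ^ 8)
    (h : ρ ≤ 𝔼 ω, Box γ (sp m (ca P (X ω)) (ca P (Y ω)) :: l ω) f) :
    ρ ^ 83 ≤ 𝔼 ω, Box γ (full :: l ω) f := by
  have : NeZero m := ⟨hm.ne'⟩
  have js : ρ ^ 9 ≤ 1/2 := (epl hρ hρ2 (a := 1) (by norm_num)).trans (by simpa using hρ2)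
  have ho : ∀ ω, Box γ (sp m (ca P (X ω)) (ca P (Y ω)) :: l ω) f ≤ (ρ ^ 81)⁻¹ * Box γ (full :: l ω) f + ind (¬ Good (ρ ^ 9) M (X ω) (Y ω)) := by
    intro ω
    by_cases hg : Good (ρ ^ 9) M (X ω) (Y ω)
    · rw [indf (by simpa using hg), add_zero]
      refine Box_dom γ (fun t => ?_) (l ω) (hl ω) (ki ω) f
      have := sp_good hP m hm hmM (ρ ^ 9) (by positivity) js hηm (X ω) (Y ω) (hX ω) (hY ω) hg t
      rwa [← pow_mul] at this
    · rw [indt hg]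
      have ea : Box γ (sp m (ca P (X ω)) (ca P (Y ω)) :: l ω) f ≤ 1 := Boxo γ _ (by
        intro ν hν
        rcases List.mem_cons.mp hν with rfl | hν
        · exact isNu_sp ..
        · exact hl ω ν hν) f hf
      have eb : 0 ≤ Box γ (full :: l ω) f := Boxn γ _ (by
        intro ν hν
        rcases List.mem_cons.mp hν with rfl | hν
        · exact isNu_full
        · exact hl ω ν hν) (by simp) f
      have : 0 ≤ (ρ ^ 81)⁻¹ * Box γ (full :: l ω) f := by positivity
      linarith
  have jb := h.trans (emono ho)
  rw [expect_add_distrib, ← mul_expect] at jb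
  have jd : 39 * ρ ^ 8 ≤ ρ / 2 := by
    have := epm hρ hρ2 2 6 (c := 64) (by norm_num)
    norm_num at this
    have := pow_pos hρ 8
    nlinarith
  have je : ρ / 2 ≤ (ρ ^ 81)⁻¹ * 𝔼 ω, Box γ (full :: l ω) f := by linarith
  have jg : ρ ^ 2 ≤ ρ / 2 := by nlinarith
  have jl := mul_le_mul_of_nonneg_left (jg.trans je) (pow_nonneg hρ.le 81)
  rw [mul_inv_cancel_left₀ (by positivity)] at jl
  calc ρ ^ 83 = ρ ^ 81 * ρ ^ 2 := by rw [← pow_add]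
    _ ≤ _ := jl
theorem S5 {ε : ℝ} (hε : 0 < ε) (hε2 : ε ≤ 1/2) (hP : P = 16 * M ^ 2) (m : ℕ) (hmM : m ≤ M) (hεm : ε * M ≤ m) (hM : 1 ≤ ε ^ 200 * M)
    (f : G → ℂ) (hf : ∀ x, ‖f x‖ ≤ 1)
    (h : ε ≤ 𝔼 p : Fin m × Fin m, Box γ ([full, full, full, full] ++ [ap m (ca P (df p))]) f) :
    ε ^ 996 ≤ Box γ (List.replicate 5 full) f := by
  have jc : (0:ℝ) < M := by by_contra hh; nlinarith [pow_pos hε 200]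
  have jf : 0 < m := by
    have : (0:ℝ) < m := lt_of_lt_of_le (by positivity) hεm
    exact_mod_cast this
  have : NeZero m := ⟨jf.ne'⟩
  have jo : 1 ≤ ε ^ 7 * m := by
    have := szm hε hε2 (by norm_num : 8 ≤ 200) jc.le hM
    calc 1 ≤ ε ^ 7 * (ε * M) := by linarith [pow_succ ε 7]
      _ ≤ _ := by gcongr
  obtain ⟨mb, hm'0, hm'1, hm'2⟩ := xlen hε hε2 7 jo
  have ho := concat1 γ hε hε2 m mb jf hm'0 hm'1 (fun p : Fin m × Fin m => ca P (df p)) [full, full, full, full] (by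
    intro ν hν; simp at hν; subst hν; exact isNu_full) f hf h
  have ee : ε ^ 7 ≤ 1/2 := (epl hε hε2 (a := 1) (by norm_num)).trans (by simpa using hε2)
  have e12 : ε ^ 12 ≤ 1/2 := (epl hε hε2 (a := 1) (by norm_num)).trans (by simpa using hε2)
  have hm'M : mb < M := by
    have : (mb:ℝ) < M := by
      have : (m:ℝ) ≤ M := by exact_mod_cast hmM
      have : ε ^ 7 * m ≤ 1/2 * M := by gcongr
      linarith
    exact_mod_cast this
  have jb := repl (Ω := (Fin m × Fin m) × (Fin m × Fin m)) γ hP mb hm'0 hm'M (ρ := ε ^ 12) (by positivity) e12 (by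
      rw [← pow_mul]
      calc ε ^ 108 * M ≤ ε ^ 9 * M := by gcongr ?_ * _; exact epl hε hε2 (by norm_num)
        _ = ε ^ 8 * (ε * M) := by ring
        _ ≤ ε ^ 8 * m := by gcongr
        _ ≤ _ := hm'2) (fun q => df q.1) (fun q => df q.2) (fun q => (df_abs _).trans (by omega)) (fun q => (df_abs _).trans (by omega))
      (fun _ => [full, full, full, full]) (by
    intro _ ν hν; simp at hν; subst hν; exact isNu_full) (by simp) f hf ?_ ?_
  · simp only [Fintype.expect_const] at jb
    rw [← pow_mul] at jb
    exact jb
  · rw [eprod]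
    refine (bad_prob (fun p : Fin m × Fin m => df p) (fun p : Fin m × Fin m => df p) (2 * m) M ?_ ?_ ?_ _ (by positivity) ?_ (by exact_mod_cast jc)).trans ?_
    · intro d ho jb; have := df_dv m jf 0 d ho jb; simpa using this
    · intro d ho jb; have := df_dv m jf 0 d ho jb; simpa using this
    · intro p; have := df_abs p; push_cast; omega
    · rw [← pow_mul]; exact (epl hε hε2 (a := 1) (by norm_num)).trans (by simpa using hε2)
    · have := df_small m jf 0 ((ε ^ 12) ^ 9 * M) (by positivity)
      simp only [add_zero] at this
      have jd : (2 * ((ε ^ 12) ^ 9 * M) + 1) / m ≤ 3 * (ε ^ 12) ^ 8 := by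
        rw [div_le_iff₀ (by exact_mod_cast jf), ← pow_mul, ← pow_mul]
        norm_num
        have := szm hε hε2 (by norm_num : 108 ≤ 200) jc.le hM
        calc 2 * (ε ^ 108 * M) + 1 ≤ 3 * (ε ^ 108 * M) := by linarith
          _ ≤ 3 * (ε ^ 97 * M) := by gcongr 3 * (?_ * _); exact epl hε hε2 (by norm_num)
          _ = 3 * ε ^ 96 * (ε * M) := by ring
          _ ≤ _ := by gcongr
      have je : (ε ^ 12) ^ 9 ≤ (ε ^ 12) ^ 8 := epl (by positivity) e12 (by norm_num)
      linarith
  · rw [eprod]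
    refine ho.trans (le_of_eq ?_)
    refine expect_congr rfl fun p _ => expect_congr rfl fun p' _ => ?_
    apply Box_perm
    exact List.perm_append_comm
theorem Boxo' (l : List (ZMod P → ℝ)) (hl : ∀ ν ∈ l, IsNu ν) (f : G → ℂ) (hf : ∀ x, ‖f x‖ ≤ 1) {Ω : Type} [Fintype Ω] [Nonempty Ω] (β : Ω → ZMod P) (m : ℕ) [NeZero m] :
    𝔼 ω, Box γ (l ++ [ap m (β ω)]) f ≤ 1 :=
  ele fun ω => Boxo γ _ (by
    intro ν hν
    rcases List.mem_append.mp hν with hν | hν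
    · exact hl ν hν
    · simp at hν; subst hν; exact isNu_ap ..) f hf
theorem bad_k {ρ : ℝ} (hρ : 0 < ρ) (hρ2 : ρ ≤ 1/2) (hM : 1 ≤ ρ ^ 9 * M) (jc : 0 < M) (s sd : ℤ) (hs : |sd| ≤ M) :
    𝔼 k : Fin M × Fin M, 𝔼 pj : Fin M × Fin M, ind (¬ Good (ρ ^ 9) M (df k + s) (df pj + sd)) ≤ 39 * ρ ^ 8 := by
  have : NeZero M := ⟨jc.ne'⟩
  have e8 : ρ ^ 9 ≤ ρ ^ 8 := epl hρ hρ2 (by norm_num)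
  refine (bad_prob (fun p : Fin M × Fin M => df p + s) (fun p : Fin M × Fin M => df p + sd) (2 * M) M ?_ ?_ ?_ _ (by positivity) ?_ jc).trans ?_
  · intro d ho jb; exact df_dv M jc s d ho jb
  · intro d ho jb; exact df_dv M jc sd d ho jb
  · intro p; have := df_abs p; rw [abs_le] at *; push_cast; omega
  · exact (epl hρ hρ2 (a := 1) (by norm_num)).trans (by simpa using hρ2)
  · have ho := df_small M jc sd (ρ ^ 9 * M) (by positivity)
    have jd : (2 * (ρ ^ 9 * M) + 1) / M ≤ 3 * ρ ^ 9 := by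
      rw [div_le_iff₀ (by exact_mod_cast jc)]
      linarith
    linarith
theorem S34 {ε : ℝ} (hε : 0 < ε) (hε2 : ε ≤ 1/2) (hP : P = 16 * M ^ 2) (m ma : ℕ) (jf : 0 < m) (hmM : m ≤ M) (hm2M : ma ≤ M) (hεm : ε * M ≤ ma) (hM : 1 ≤ ε ^ 300 * M)
    (f : G → ℂ) (hf : ∀ x, ‖f x‖ ≤ 1)
    (h : ε ≤ 𝔼 p : Fin m × Fin m, 𝔼 k : Fin M × Fin M, Box γ ([full, full, full, ap m (ca P (df p))] ++ [ap ma (ca P (df k + df p))]) f) :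
    ε ^ 2158 ≤ 𝔼 p : Fin m × Fin m, Box γ ([full, full, full, full] ++ [ap m (ca P (df p))]) f := by
  have jc : (0:ℝ) < M := by by_contra hh; nlinarith [pow_pos hε 300]
  have jc' : 0 < M := by exact_mod_cast jc
  have jx : 0 < ma := by
    have : (0:ℝ) < ma := lt_of_lt_of_le (by positivity) hεm
    exact_mod_cast this
  have : NeZero m := ⟨jf.ne'⟩
  have : NeZero M := ⟨jc'.ne'⟩
  have : NeZero ma := ⟨jx.ne'⟩
  have jo : 1 ≤ ε ^ 14 * ma := by
    have := szm hε hε2 (by norm_num : 15 ≤ 300) jc.le hM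
    calc 1 ≤ ε ^ 14 * (ε * M) := by linarith [pow_succ ε 14]
      _ ≤ _ := by gcongr
  obtain ⟨mb, hm'0, hm'1, hm'2⟩ := xlen hε hε2 14 jo
  have : NeZero mb := ⟨hm'0.ne'⟩
  have eb : ε ^ 2 ≤ ε / 2 := by nlinarith
  have hnu : ∀ p : Fin m × Fin m, ∀ ν ∈ [full, full, full, ap m (ca P (df p))], IsNu ν := by
    intro p ν hν; simp at hν; rcases hν with rfl | rfl
    · exact isNu_full
    · exact isNu_ap ..
  have ho := popular (F := fun p : Fin m × Fin m => 𝔼 k : Fin M × Fin M, 𝔼 pj : Fin M × Fin M, Box γ ([full, full, full, ap m (ca P (df p))] ++ [sp mb (ca P (df k + df p)) (ca P (df pj + df p))]) f)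
    (η := (ε ^ 2) ^ 12) hε.le (by positivity) (fun p => Boxo' γ _ (hnu p) f hf (fun k : Fin M × Fin M => ca P (df k + df p)) ma)
    (fun p => expect_nn fun k => expect_nn fun pj => Boxn γ _ (by
      intro ν hν
      rcases List.mem_append.mp hν with hν | hν
      · exact hnu p ν hν
      · simp at hν; subst hν; exact isNu_sp ..) (by simp) f)
    (fun p hp => concat1 γ (by positivity) (eb.trans (by linarith)) ma mb jx hm'0 (by rw [← pow_mul]; exact hm'1) (fun k : Fin M × Fin M => ca P (df k + df p)) _ (hnu p) f hf (eb.trans hp)) h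
  have e26 : ε ^ 26 ≤ 1/2 := (epl hε hε2 (a := 1) (by norm_num)).trans (by simpa using hε2)
  have ho' : ε ^ 26 ≤ ε / 2 * (ε ^ 2) ^ 12 := by
    calc ε ^ 26 = ε ^ 2 * (ε ^ 2) ^ 12 := by ring
      _ ≤ _ := by gcongr
  have ho : ε ^ 26 ≤ 𝔼 p : Fin m × Fin m, 𝔼 k : Fin M × Fin M, 𝔼 pj : Fin M × Fin M, Box γ ([full, full, full, ap m (ca P (df p))] ++ [sp mb (ca P (df k + df p)) (ca P (df pj + df p))]) f := ho'.trans ho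
  have ho : ε ^ 26 ≤ 𝔼 p : Fin m × Fin m, 𝔼 k : Fin M × Fin M, 𝔼 pj : Fin M × Fin M, Box γ (sp mb (ca P (df k + df p)) (ca P (df pj + df p)) :: [full, full, full, ap m (ca P (df p))]) f :=
    ho.trans (emono fun p => emono fun k => emono fun pj => (Box_perm γ List.perm_append_comm f).le)
  have hm'M : mb < M := by
    have ee : ε ^ 14 ≤ 1/2 := (epl hε hε2 (a := 1) (by norm_num)).trans (by simpa using hε2)
    have : (mb:ℝ) < M := by
      have : (ma:ℝ) ≤ M := by exact_mod_cast hm2M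
      have : ε ^ 14 * ma ≤ 1/2 * M := by gcongr
      linarith
    exact_mod_cast this
  have habs : ∀ (p : Fin m × Fin m) (k : Fin M × Fin M), |df k + df p| ≤ 2 * M := by
    intro p k; have := df_abs p; have := df_abs k; rw [abs_le] at *; omega
  have jb := repl (Ω := (Fin m × Fin m) × ((Fin M × Fin M) × (Fin M × Fin M))) γ hP mb hm'0 hm'M (ρ := ε ^ 26) (by positivity) e26 (by
      rw [← pow_mul]
      calc ε ^ 234 * M ≤ ε ^ 16 * M := by gcongr ?_ * _; exact epl hε hε2 (by norm_num)
        _ = ε ^ 15 * (ε * M) := by ring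
        _ ≤ ε ^ 15 * ma := by gcongr
        _ ≤ _ := hm'2) (fun q => df q.2.1 + df q.1) (fun q => df q.2.2 + df q.1) (fun q => habs _ _) (fun q => habs _ _)
      (fun q => [full, full, full, ap m (ca P (df q.1))]) (fun q => hnu q.1) (by simp) f hf ?_ ?_
  · simp only [eprod (ι := Fin m × Fin m), Fintype.expect_const] at jb
    rw [← pow_mul, (by norm_num : 26 * 83 = 2158)] at jb
    exact jb
  · rw [eprod]
    refine ele fun p => ?_
    rw [eprod]
    refine bad_k (ρ := ε ^ 26) (by positivity) e26 ?_ jc' (df p) (df p) ((df_abs p).trans (by omega))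
    rw [← pow_mul]
    exact szm hε hε2 (by norm_num) jc.le hM
  · rw [eprod]
    simp only [eprod (ι := Fin M × Fin M)]
    exact ho
theorem bad_3 {ρ : ℝ} (hρ : 0 < ρ) (hρ2 : ρ ≤ 1/2) (hM : 1 ≤ ρ ^ 9 * M) (m : ℕ) (hm : 0 < m) (hρm : ρ * M ≤ m) (hmM : m ≤ M) :
    𝔼 p : Fin m × Fin m, 𝔼 pj : Fin M × Fin M, ind (¬ Good (ρ ^ 9) M (df pj + df p) (df pj)) ≤ 39 * ρ ^ 8 := by
  have jc : 0 < M := by omega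
  have : NeZero M := ⟨jc.ne'⟩
  have : NeZero m := ⟨hm.ne'⟩
  have e9 : 2 * ρ ^ 9 ≤ ρ ^ 8 := epm hρ hρ2 8 1 (c := 2) (by norm_num)
  have js : ρ ^ 9 ≤ 1/2 := (epl hρ hρ2 (a := 1) (by norm_num)).trans (by simpa using hρ2)
  have key : ∀ (p : Fin m × Fin m) (pj : Fin M × Fin M), ind (¬ Good (ρ ^ 9) M (df pj + df p) (df pj)) ≤
      ind (¬ Good (ρ ^ 9) M (df pj) (df p)) + ind (|(df pj : ℝ)| < ρ ^ 9 * M) := by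
    intro p pj
    by_cases hk : |(df pj : ℝ)| < ρ ^ 9 * M
    · rw [indt hk]; linarith [ind_le_one (¬ Good (ρ ^ 9) M (df pj + df p) (df pj)), indn (¬ Good (ρ ^ 9) M (df pj) (df p))]
    · rw [indf hk, add_zero]
      apply ind_mono
      intro ho jb
      refine ho ⟨not_lt.mp hk, ?_⟩
      rw [add_comm, Int.gcd_add_right_left_of_dvd _ (dvd_refl _), Int.gcd_comm]
      exact jb.2
  refine (emono fun p => emono (key p)).trans ?_
  simp only [expect_add_distrib, Fintype.expect_const]
  have hb : 𝔼 p : Fin m × Fin m, 𝔼 pj : Fin M × Fin M, ind (¬ Good (ρ ^ 9) M (df pj) (df p)) ≤ 36 * ρ ^ 9 + 3 * ρ ^ 8 := by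
    rw [expect_comm]
    refine (bad_prob (fun p : Fin M × Fin M => df p) (fun p : Fin m × Fin m => df p) m M ?_ ?_ ?_ _ (by positivity) js jc).trans ?_
    · intro d ho jb; have := df_dv M jc 0 d ho (by omega); simpa using this
    · intro d ho jb; have := df_dv m hm 0 d ho (by omega); simpa using this
    · exact df_abs
    · have ho := df_small m hm 0 (ρ ^ 9 * M) (by positivity)
      simp only [add_zero] at ho
      have jd : (2 * (ρ ^ 9 * M) + 1) / m ≤ 3 * ρ ^ 8 := by
        rw [div_le_iff₀ (by exact_mod_cast hm)]
        calc 2 * (ρ ^ 9 * M) + 1 ≤ 3 * (ρ ^ 9 * M) := by linarith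
          _ = 3 * ρ ^ 8 * (ρ * M) := by ring
          _ ≤ _ := by gcongr
      linarith
  have ho := df_small M jc 0 (ρ ^ 9 * M) (by positivity)
  simp only [add_zero] at ho
  have jd : (2 * (ρ ^ 9 * M) + 1) / M ≤ 3 * ρ ^ 9 := by
    rw [div_le_iff₀ (by exact_mod_cast jc)]; linarith
  have := pow_pos hρ 8
  linarith
theorem S12_core {ρ : ℝ} (hρ : 0 < ρ) (hρ2 : ρ ≤ 1/2) (hP : P = 16 * M ^ 2) (m ma : ℕ) (jf : 0 < m) (hmM : m ≤ M) (hρm : ρ * M ≤ m) (jx : 0 < ma) (hm2M : ma < M) (hεm : ρ * M ≤ ma) (hM : 1 ≤ ρ ^ (83 * 83 * 9) * M)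
    (f : G → ℂ) (hf : ∀ x, ‖f x‖ ≤ 1)
    (h : ρ ≤ 𝔼 p : Fin m × Fin m, 𝔼 k : Fin M × Fin M, 𝔼 pj : Fin M × Fin M, Box γ ([ap m (ca P (df p))] ++ [sp ma (ca P (df k)) (ca P (df pj)),
      sp ma (ca P (df k + df p)) (ca P (df pj)), sp ma (ca P (df pj + df p)) (ca P (df pj)), ap ma (ca P (df pj + df p))]) f) :
    ρ ^ (83 * 83 * 83) ≤ 𝔼 p : Fin m × Fin m, 𝔼 k : Fin M × Fin M, Box γ ([full, full, full, ap m (ca P (df p))] ++ [ap ma (ca P (df k + df p))]) f := by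
  have jc : 0 < M := by omega
  have jc' : (0:ℝ) < M := by exact_mod_cast jc
  have : NeZero m := ⟨jf.ne'⟩
  have : NeZero M := ⟨jc.ne'⟩
  have : NeZero ma := ⟨jx.ne'⟩
  have hk : ∀ a b : ℕ, 1 ≤ a → ρ ^ a * M ≤ ma := fun a b ha => by
    refine le_trans ?_ hεm
    have := epl hρ hρ2 ha
    rw [pow_one] at this
    gcongr
  have hle : ∀ a : ℕ, 1 ≤ a → ρ ^ a ≤ ρ := fun a ha => by have := epl hρ hρ2 ha; rwa [pow_one] at this
  have jt : ∀ (k : Fin M × Fin M), |df k| ≤ 2 * M := by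
    intro k; have := df_abs k; omega
  have habs : ∀ (p : Fin m × Fin m) (k : Fin M × Fin M), |df k + df p| ≤ 2 * M := by
    intro p k; have := df_abs p; have := df_abs k; rw [abs_le] at *; omega
  let Ω := (Fin m × Fin m) × ((Fin M × Fin M) × (Fin M × Fin M))
  have eqΩ : ∀ F : (Fin m × Fin m) → (Fin M × Fin M) → (Fin M × Fin M) → ℝ, 𝔼 p, 𝔼 k, 𝔼 pj, F p k pj = 𝔼 q : Ω, F q.1 q.2.1 q.2.2 := by
    intro F
    rw [eprod (ι := Fin m × Fin m)]
    simp only [eprod (ι := Fin M × Fin M)]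
  have hsp := fun a b : ZMod P => isNu_sp ma a b
  have hap := fun a : ZMod P => isNu_ap ma a
  have hap' := fun a : ZMod P => isNu_ap m a
  have hfu := isNu_full (A := ZMod P)
  have hs1 : ∀ {po : ℝ}, 0 < po → po ≤ 1/2 → 1 ≤ po ^ 9 * M → 𝔼 p : Fin m × Fin m, 𝔼 k : Fin M × Fin M, 𝔼 pj : Fin M × Fin M, ind (¬ Good (po ^ 9) M (df k) (df pj)) ≤ 39 * po ^ 8 := by
    intro po ho jb jd
    refine ele fun p => ?_
    have := bad_k ho jb jd jc 0 0 (by simp)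
    simpa only [add_zero] using this
  have hs2 : ∀ {po : ℝ}, 0 < po → po ≤ 1/2 → 1 ≤ po ^ 9 * M → 𝔼 p : Fin m × Fin m, 𝔼 k : Fin M × Fin M, 𝔼 pj : Fin M × Fin M, ind (¬ Good (po ^ 9) M (df k + df p) (df pj)) ≤ 39 * po ^ 8 := by
    intro po ho jb jd
    refine ele fun p => ?_
    have := bad_k ho jb jd jc (df p) 0 (by simp)
    simpa only [add_zero] using this
  have hs3 : ∀ {po : ℝ}, 0 < po → po ≤ 1/2 → 1 ≤ po ^ 9 * M → po * M ≤ m → 𝔼 p : Fin m × Fin m, 𝔼 k : Fin M × Fin M, 𝔼 pj : Fin M × Fin M, ind (¬ Good (po ^ 9) M (df pj + df p) (df pj)) ≤ 39 * po ^ 8 := by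
    intro po ho jb jd je
    simp only [Fintype.expect_const]
    exact bad_3 ho jb jd m jf je hmM
  rw [eqΩ] at h
  have rd := repl (Ω := Ω) γ hP ma jx hm2M hρ hρ2 (hk 9 0 (by norm_num)) (fun q => df q.2.1) (fun q => df q.2.2) (fun q => jt _) (fun q => jt _)
    (fun q => [sp ma (ca P (df q.2.1 + df q.1)) (ca P (df q.2.2)), sp ma (ca P (df q.2.2 + df q.1)) (ca P (df q.2.2)), ap m (ca P (df q.1)), ap ma (ca P (df q.2.2 + df q.1))])
    (by intro q ν hν; simp at hν; rcases hν with rfl | rfl | rfl | rfl <;> apply_assumption) (by simp) f hf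
    (by rw [← eqΩ (fun p k pj => ind (¬ Good (ρ ^ 9) M (df k) (df pj)))]; exact hs1 hρ hρ2 (szm hρ hρ2 (by norm_num) jc'.le hM))
    (h.trans (emono fun q => (Box_perm γ (by grind) f).le))
  have rc := repl (Ω := Ω) γ hP ma jx hm2M (ρ := ρ ^ 83) (by positivity) ((hle _ (by norm_num)).trans hρ2) (by rw [← pow_mul]; exact hk _ 0 (by norm_num)) (fun q => df q.2.1 + df q.1) (fun q => df q.2.2) (fun q => habs _ _) (fun q => jt _)
    (fun q => [full, sp ma (ca P (df q.2.2 + df q.1)) (ca P (df q.2.2)), ap m (ca P (df q.1)), ap ma (ca P (df q.2.2 + df q.1))])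
    (by intro q ν hν; simp at hν; rcases hν with rfl | rfl | rfl | rfl <;> apply_assumption) (by simp) f hf
    (by rw [← eqΩ (fun p k pj => ind (¬ Good ((ρ ^ 83) ^ 9) M (df k + df p) (df pj)))]; exact hs2 (by positivity) ((hle _ (by norm_num)).trans hρ2) (by rw [← pow_mul]; exact szm hρ hρ2 (by norm_num) jc'.le hM))
    (rd.trans (emono fun q => (Box_perm γ (by grind) f).le))
  rw [← pow_mul] at rc
  have rb := repl (Ω := Ω) γ hP ma jx hm2M (ρ := ρ ^ (83 * 83)) (by positivity) ((hle _ (by norm_num)).trans hρ2) (by rw [← pow_mul]; exact hk _ 0 (by norm_num)) (fun q => df q.2.2 + df q.1) (fun q => df q.2.2) (fun q => habs _ _) (fun q => jt _)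
    (fun q => [full, full, ap m (ca P (df q.1)), ap ma (ca P (df q.2.2 + df q.1))])
    (by intro q ν hν; simp at hν; rcases hν with rfl | rfl | rfl <;> apply_assumption) (by simp) f hf
    (by
      rw [← eqΩ (fun p k pj => ind (¬ Good ((ρ ^ (83 * 83)) ^ 9) M (df pj + df p) (df pj)))]
      refine hs3 (by positivity) ((hle _ (by norm_num)).trans hρ2) (by rw [← pow_mul]; exact hM) (le_trans ?_ hρm)
      gcongr; exact hle _ (by norm_num))
    (rc.trans (emono fun q => (Box_perm γ (by grind) f).le))
  rw [← pow_mul] at rb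
  rw [← eqΩ (fun p k pj => Box γ [full, full, full, ap m (ca P (df p)), ap ma (ca P (df pj + df p))] f)] at rb
  simp only [Fintype.expect_const] at rb
  exact rb
end
section
variable {G : Type} [AddCommGroup G] [Fintype G] {M P : ℕ} [NeZero P] (γ : ZMod P →+ G)
theorem S12 {ε : ℝ} (hε : 0 < ε) (hε2 : ε ≤ 1/2) (hP : P = 16 * M ^ 2) (m : ℕ) (hmM : m ≤ M) (hεm : ε * M ≤ m) (hM : 1 ≤ ε ^ (166 * (83 * 83 * 9)) * M)
    (f : G → ℂ) (hf : ∀ x, ‖f x‖ ≤ 1)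
    (h : ε ≤ 𝔼 p : Fin m × Fin m, 𝔼 k : Fin M × Fin M, Box γ ([ap m (ca P (df p))] ++ [ap m (ca P (df k)), ap m (ca P (df k + df p))]) f) :
    ∃ ma : ℕ, ma ≤ M ∧ ε ^ 22 * M ≤ ma ∧
    ε ^ (166 * (83 * 83 * 83)) ≤ 𝔼 p : Fin m × Fin m, 𝔼 k : Fin M × Fin M, Box γ ([full, full, full, ap m (ca P (df p))] ++ [ap ma (ca P (df k + df p))]) f := by
  have jc : (0:ℝ) < M := by by_contra hh; nlinarith [pow_pos hε (166 * (83 * 83 * 9))]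
  have jc' : 0 < M := by exact_mod_cast jc
  have jf : 0 < m := by
    have : (0:ℝ) < m := lt_of_lt_of_le (by positivity) hεm
    exact_mod_cast this
  have : NeZero m := ⟨jf.ne'⟩
  have : NeZero M := ⟨jc'.ne'⟩
  have jo : 1 ≤ ε ^ 20 * m := by
    have := szm hε hε2 (by norm_num : 21 ≤ (166 * (83 * 83 * 9))) jc.le hM
    calc 1 ≤ ε ^ 20 * (ε * M) := by linarith [pow_succ ε 20]
      _ ≤ _ := by gcongr
  obtain ⟨mb, hm'0, hm'1, hm'2⟩ := xlen hε hε2 20 jo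
  have : NeZero mb := ⟨hm'0.ne'⟩
  have hm'3 : ε ^ 22 * M ≤ mb := by
    calc ε ^ 22 * M = ε ^ 21 * (ε * M) := by ring
      _ ≤ ε ^ 21 * m := by gcongr
      _ ≤ _ := hm'2
  have hm'M : mb < M := by
    have ee : ε ^ 20 ≤ 1/2 := (epl hε hε2 (a := 1) (by norm_num)).trans (by simpa using hε2)
    have : (mb:ℝ) < M := by
      have : (m:ℝ) ≤ M := by exact_mod_cast hmM
      have : ε ^ 20 * m ≤ 1/2 * M := by gcongr
      linarith
    exact_mod_cast this
  refine ⟨mb, hm'M.le, hm'3, ?_⟩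
  have eb : ε ^ 2 ≤ ε / 2 := by nlinarith
  have hsp := fun a b : ZMod P => isNu_sp mb a b
  have hap := fun a : ZMod P => isNu_ap mb a
  have hap' := fun a : ZMod P => isNu_ap m a
  have ho := popular (F := fun p : Fin m × Fin m => 𝔼 k : Fin M × Fin M, 𝔼 pj : Fin M × Fin M, Box γ ([ap m (ca P (df p))] ++ [sp mb (ca P (df k)) (ca P (df pj)),
      sp mb (ca P (df k + df p)) (ca P (df pj)), sp mb (ca P (df pj + df p)) (ca P (df pj)), ap mb (ca P (df pj + df p))]) f)
    (η := (ε ^ 2) ^ 82) hε.le (by positivity) (fun p => ele fun k => Boxo γ _ (by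
      intro ν hν; simp at hν; rcases hν with rfl | rfl | rfl <;> apply_assumption) f hf)
    (fun p => expect_nn fun k => expect_nn fun pj => Boxn γ _ (by
      intro ν hν; simp at hν; rcases hν with rfl | rfl | rfl | rfl | rfl <;> apply_assumption) (by simp) f)
    (fun p hp => concat2 γ (by positivity) (eb.trans (by linarith)) m mb jf hm'0 (by rw [← pow_mul]; exact hm'1) (fun k : Fin M × Fin M => ca P (df k)) (fun k : Fin M × Fin M => ca P (df k + df p)) _ (by
      intro ν hν; simp at hν; subst hν; apply_assumption) f hf (eb.trans hp)) h
  have ho' : ε ^ 166 ≤ ε / 2 * (ε ^ 2) ^ 82 := by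
    calc ε ^ 166 = ε ^ 2 * (ε ^ 2) ^ 82 := by ring
      _ ≤ _ := by gcongr
  have jb := S12_core γ (ρ := ε ^ 166) (by positivity) ((epl hε hε2 (a := 1) (by norm_num)).trans (by simpa using hε2)) hP m mb jf hmM
    (by
      refine le_trans ?_ hεm
      have := epl hε hε2 (a := 1) (b := 166) (by norm_num)
      rw [pow_one] at this
      gcongr) hm'0 hm'M
    (by
      refine le_trans ?_ hm'3
      have := epl hε hε2 (a := 22) (b := 166) (by norm_num)
      gcongr) (by rw [← pow_mul]; exact hM) f hf (ho'.trans ho)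
  rw [← pow_mul] at jb
  exact jb
theorem c2_eq (a b : ℕ) : (2 * ((a : ZMod P) - (b : ZMod P))) = ca P ((a:ℤ) - b) := by
  unfold ca; push_cast; ring
theorem L6 : ∃ K : ℕ, ∀ {G : Type} [AddCommGroup G] [Fintype G] {M P : ℕ} [NeZero P] (γ : ZMod P →+ G) (e : G) {ε : ℝ}, 0 < ε → ε ≤ 1/2 →
    P = 16 * M ^ 2 → 1 ≤ ε ^ K * M → ∀ fb fa fc : G → ℂ, (∀ x, ‖fb x‖ ≤ 1) → (∀ x, ‖fa x‖ ≤ 1) → (∀ x, ‖fc x‖ ≤ 1) →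
    ε ≤ ‖TT γ e M fb fa fc‖ → ε ^ K ≤ Box γ (List.replicate 5 full) fc := by
  obtain ⟨ka, jr⟩ : ∃ K : ℕ, K = 166 * (83 * 83 * 83) := ⟨_, rfl⟩
  refine ⟨72 * (ka * 9) + 72 * ka * 300 + 72 * ka * 2158 * 996, ?_⟩
  intro G _ _ M P _ γ e ε hε hε2 hP hM fb fa fc ja ho jb h
  have jc : (0:ℝ) < M := by by_contra hh; nlinarith [pow_pos hε (72 * (ka * 9) + 72 * ka * 300 + 72 * ka * 2158 * 996)]
  have jc' : 0 < M := by exact_mod_cast jc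
  have jr' : 72 ≤ ka := by rw [jr]; norm_num
  have sz : ∀ a, a ≤ 72 * (ka * 9) + 72 * ka * 300 + 72 * ka * 2158 * 996 → 1 ≤ ε ^ a * M := fun a ha => szm hε hε2 ha jc.le hM
  have hh : ∀ a, 1 ≤ a → ε ^ a ≤ 1/2 := fun a ha => (epl hε hε2 (a := 1) ha).trans (by simpa using hε2)
  obtain ⟨m, jf, jo, jw, hb⟩ := pet γ e hε hε2 M (sz _ (by omega)) fb fa fc ja ho jb h
  have hmM : m ≤ M := by
    have := hh 14 (by norm_num)
    have : (m:ℝ) ≤ M := by nlinarith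
    exact_mod_cast this
  have hle : ∀ a, 15 ≤ a → ε ^ a * M ≤ m := fun a ha => by
    refine le_trans ?_ jw
    have := epl hε hε2 ha
    gcongr
  obtain ⟨ma, hm2M, hm22, sa⟩ := S12 γ (ε := ε ^ 72) (by positivity) (hh _ (by norm_num)) hP m hmM (hle _ (by norm_num)) (by
    rw [← pow_mul]
    apply sz
    have : 166 * (83 * 83 * 9) ≤ ka * 9 := by rw [jr]; norm_num
    omega) fc jb (by
    rw [eprod]
    refine hb.trans (emono fun a => emono fun ac => ?_)
    rw [eprod]
    refine emono fun y => emono fun z => le_of_eq ?_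
    have : ca P (df (y, z) + df (a, ac)) = 2 * (((ac:ℕ):ZMod P) - ((a:ℕ):ZMod P)) + 2 * (((z:ℕ):ZMod P) - ((y:ℕ):ZMod P)) := by
      unfold ca df; push_cast; ring
    rw [this, c2_eq, c2_eq]
    rfl)
  rw [← jr, ← pow_mul] at sa
  have kc : 1 ≤ 72 * ka := by omega
  have sb := S34 γ (ε := ε ^ (72 * ka)) (by positivity) (hh _ kc) hP m ma jf hmM hm2M (by
    refine le_trans ?_ hm22
    rw [← pow_mul]
    have := epl hε hε2 (a := 72 * 22) (b := 72 * ka) (by omega)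
    gcongr) (by rw [← pow_mul]; apply sz; omega) fc jb sa
  rw [← pow_mul] at sb
  have sc := S5 γ (ε := ε ^ (72 * ka * 2158)) (by positivity) (hh _ (by omega)) hP m hmM (hle _ (by omega)) (by rw [← pow_mul]; apply sz; omega) fc jb sb
  rw [← pow_mul] at sc
  exact (epl hε hε2 (by omega)).trans sc
end
section
variable {P : ℕ} [NeZero P]
noncomputable def ch (x : ZMod P) : ℂ := ZMod.stdAddChar x
theorem ch_add (x y : ZMod P) : ch (x + y) = ch x * ch y := AddChar.map_add_eq_mul ..
theorem ch_zero : ch (0 : ZMod P) = 1 := AddChar.map_zero_eq_one _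
theorem chn (x : ZMod P) : ‖ch x‖ = 1 := by
  unfold ch; rw [ZMod.stdAddChar_apply]; exact Circle.norm_coe _
theorem ch_neg (x : ZMod P) : ch (-x) = conj (ch x) := by
  unfold ch; rw [ZMod.stdAddChar_apply, ZMod.stdAddChar_apply, AddChar.map_neg_eq_inv, Circle.coe_inv_eq_conj]
theorem ch_sub (x y : ZMod P) : ch (x - y) = ch x * conj (ch y) := by
  rw [sub_eq_add_neg, ch_add, ch_neg]
theorem ch_mul_conj (x : ZMod P) : ch x * conj (ch x) = 1 := by rw [← ch_sub, sub_self, ch_zero]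
theorem ch_sum (b : ZMod P) : ∑ x, ch (x * b) = if b = 0 then (P:ℂ) else 0 := by
  have := AddChar.sum_mulShift b (ZMod.isPrimitive_stdAddChar P)
  rw [ZMod.card] at this
  exact this.trans (by split_ifs <;> simp)
theorem parseval (A : ZMod P → ℂ) : ∑ ξ, ‖𝔼 t, A t * ch (ξ * t)‖ ^ 2 = 𝔼 t, ‖A t‖ ^ 2 := by
  have hP : (P:ℂ) ≠ 0 := by exact_mod_cast NeZero.ne P
  simp_rw [nse]
  rw [← Complex.re_sum]
  have : ∑ ξ : ZMod P, 𝔼 i, 𝔼 j, A i * ch (ξ * i) * conj (A j * ch (ξ * j)) = 𝔼 i, A i * conj (A i) := by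
    rw [← expect_sum_comm]
    refine expect_congr rfl fun i _ => ?_
    rw [← expect_sum_comm]
    have : ∀ j, ∑ ξ : ZMod P, A i * ch (ξ * i) * conj (A j * ch (ξ * j)) = if j = i then (P:ℂ) * (A i * conj (A i)) else 0 := by
      intro j
      have ho : ∀ ξ : ZMod P, A i * ch (ξ * i) * conj (A j * ch (ξ * j)) = A i * conj (A j) * ch (ξ * (i - j)) := by
        intro ξ; rw [mul_sub, ch_sub, map_mul]; ring
      simp_rw [ho, ← mul_sum, ch_sum, sub_eq_zero]
      by_cases h : i = j
      · subst h; simp; ring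
      · rw [if_neg h, if_neg (Ne.symm h), mul_zero]
    simp_rw [this]
    rw [Fintype.expect_eq_sum_div_card, sum_ite_eq' univ i, if_pos (mem_univ _), ZMod.card]
    field_simp
  rw [this, re_expect]
  refine expect_congr rfl fun i _ => (norm_sq_re _).symm
theorem u2_line (k : ZMod P → ℂ) (hk : ∀ t, ‖k t‖ ≤ 1) :
    ∃ ξ : ZMod P, 𝔼 t, ‖𝔼 a, k (a + t) * conj (k a)‖ ^ 2 ≤ ‖𝔼 a, k a * ch (ξ * a)‖ ^ 2 := by
  obtain ⟨ξ, -, hξ⟩ := exists_max_image univ (fun ξ : ZMod P => ‖𝔼 a, k a * ch (ξ * a)‖ ^ 2) univ_nonempty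
  refine ⟨ξ, ?_⟩
  rw [← parseval]
  have ho : ∀ η : ZMod P, ‖𝔼 t, (𝔼 a, k (a + t) * conj (k a)) * ch (η * t)‖ ^ 2 = ‖𝔼 a, k a * ch (η * a)‖ ^ 2 * ‖𝔼 a, k a * ch (η * a)‖ ^ 2 := by
    intro η
    have : 𝔼 t, (𝔼 a, k (a + t) * conj (k a)) * ch (η * t) = (𝔼 a, k a * ch (η * a)) * conj (𝔼 a, k a * ch (η * a)) := by
      simp_rw [expect_mul, conj_expect, mul_expect]
      rw [expect_comm]
      conv_rhs => rw [expect_comm]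
      refine expect_congr rfl fun a _ => ?_
      refine Eq.trans ?_ (eshift a _)
      refine expect_congr rfl fun t _ => ?_
      rw [map_mul, mul_add, ch_add, add_comm t a]
      linear_combination (-(k (a + t) * (starRingEnd ℂ) (k a) * ch (η * t))) * ch_mul_conj (η * a)
    rw [this, norm_mul, RCLike.norm_conj]; ring
  simp_rw [ho]
  calc _ ≤ ∑ η : ZMod P, ‖𝔼 a, k a * ch (ξ * a)‖ ^ 2 * ‖𝔼 a, k a * ch (η * a)‖ ^ 2 :=
        sum_le_sum fun η _ => mul_le_mul_of_nonneg_right (hξ η (mem_univ _)) (by positivity)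
    _ = ‖𝔼 a, k a * ch (ξ * a)‖ ^ 2 * 𝔼 a, ‖k a‖ ^ 2 := by rw [← mul_sum, parseval]
    _ ≤ ‖𝔼 a, k a * ch (ξ * a)‖ ^ 2 * 1 := by
        gcongr
        refine ele fun a => ?_
        have := hk a
        have := norm_nonneg (k a)
        nlinarith
    _ = _ := mul_one _
variable {G : Type} [AddCommGroup G] [Fintype G] (γ : ZMod P →+ G)
theorem u2_inv (g : G → ℂ) (hg : ∀ x, ‖g x‖ ≤ 1) :
    ∃ ξ : G → ZMod P, Box γ [full, full] g ≤ 𝔼 x, ‖𝔼 t, g (x + γ t) * ch (ξ x * t)‖ ^ 2 := by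
  choose ξ hξ using fun x : G => u2_line (fun t => g (x + γ t)) (fun t => hg _)
  refine ⟨ξ, le_trans (le_of_eq ?_) (emono hξ)⟩
  rw [Box_full, full_eq, expect_comm]
  refine expect_congr rfl fun t _ => ?_
  rw [Box_one]
  refine expect_congr rfl fun x _ => ?_
  simp only [dd, map_add, add_assoc]
noncomputable def Dl : (s : ℕ) → (Fin s → ZMod P) → (G → ℂ) → G → ℂ
  | 0, _, f => f
  | s+1, h, f => Dl s (Fin.tail h) (dd γ (h 0) f)
theorem Dl_bdd (s : ℕ) (h : Fin s → ZMod P) (f : G → ℂ) (hf : ∀ x, ‖f x‖ ≤ 1) (x : G) : ‖Dl γ s h f x‖ ≤ 1 := by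
  induction s generalizing f with
  | zero => exact hf x
  | succ s ih => exact ih _ _ (dd_bdd γ hf _)
theorem Box_rep (s : ℕ) (l : List (ZMod P → ℝ)) (f : G → ℂ) :
    Box γ (List.replicate s full ++ l) f = 𝔼 h : Fin s → ZMod P, Box γ l (Dl γ s h f) := by
  induction s generalizing f with
  | zero => simp [Dl]
  | succ s ih =>
    rw [List.replicate_succ, List.cons_append, Box_full, expect_cons]
    refine expect_congr rfl fun t _ => ?_
    rw [ih]
    rfl
theorem Dl_factor (s : ℕ) (f : G → ℂ) (hf : ∀ x, ‖f x‖ ≤ 1) : ∃ B : Fin s → G → (Fin s → ZMod P) → ℂ,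
    (∀ i x h, ‖B i x h‖ ≤ 1) ∧ (∀ i x h pm, (∀ j, j ≠ i → h j = pm j) → B i x h = B i x pm) ∧
    ∀ h x, Dl γ s h f x = (∏ i, B i x h) * f (x + γ (∑ i, h i)) := by
  induction s generalizing f with
  | zero => exact ⟨fun _ _ _ => 1, by simp, by simp, by simp [Dl]⟩
  | succ s ih =>
    choose B ho jb jd using fun t : ZMod P => ih (dd γ t f) (dd_bdd γ hf t)
    refine ⟨Fin.cons (fun x h => conj (f (x + γ (∑ i, h (Fin.succ i))))) (fun i x h => B (h 0) i x (Fin.tail h)), ?_, ?_, ?_⟩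
    · intro i x h
      induction i using Fin.cases with
      | zero => exact ncl (hf _)
      | succ i => exact ho _ _ _ _
    · intro i x h pm hh
      induction i using Fin.cases with
      | zero =>
        simp only [Fin.cons_zero]
        congr 5; ext i
        exact hh _ (Fin.succ_ne_zero i)
      | succ i =>
        simp only [Fin.cons_succ]
        rw [hh 0 (Fin.succ_ne_zero i).symm]
        apply jb
        intro j hj
        exact hh _ (fun e => hj (Fin.succ_injective _ e))
    · intro h x
      rw [Dl, jd, Fin.prod_univ_succ, Fin.sum_univ_succ]
      simp only [Fin.cons_zero, Fin.cons_succ, dd, Fin.tail]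
      rw [add_comm (h 0), map_add, add_assoc]; ring
noncomputable def nn (a : ZMod P) : ℝ := |(a.valMinAbs : ℝ)| / P
theorem nnn (a : ZMod P) : 0 ≤ nn a := by unfold nn; positivity
theorem Ppos : (0:ℝ) < P := by exact_mod_cast NeZero.pos P
theorem nn_zero : nn (0 : ZMod P) = 0 := by simp [nn]
theorem nn_add (a b : ZMod P) : nn (a + b) ≤ nn a + nn b := by
  unfold nn
  rw [← add_div]
  apply div_le_div_of_nonneg_right _ Ppos.le
  have ho := ZMod.natAbs_valMinAbs_add_le a b
  have jb := Int.natAbs_add_le a.valMinAbs b.valMinAbs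
  have jd := ho.trans jb
  rw [← Int.cast_abs, ← Int.cast_abs, ← Int.cast_abs, Int.abs_eq_natAbs, Int.abs_eq_natAbs, Int.abs_eq_natAbs]
  exact_mod_cast jd
theorem nn_neg (a : ZMod P) : nn (-a) = nn a := by
  unfold nn
  rw [← Int.cast_abs, ← Int.cast_abs, Int.abs_eq_natAbs, Int.abs_eq_natAbs, ZMod.natAbs_valMinAbs_neg]
theorem nn_sub (a b : ZMod P) : nn (a - b) ≤ nn a + nn b := by
  rw [sub_eq_add_neg, ← nn_neg b]; exact nn_add _ _
theorem nn_nat_mul (n : ℕ) (a : ZMod P) : nn ((n : ZMod P) * a) ≤ n * nn a := by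
  induction n with
  | zero => simp [nn_zero]
  | succ n ih =>
    push_cast
    rw [add_mul, one_mul]
    linarith [nn_add ((n:ZMod P) * a) a]
theorem nn_lin (n : ℕ) (a : ZMod P) (h : n * nn a < 1/2) : nn ((n : ZMod P) * a) = n * nn a := by
  unfold nn at *
  have hP : (0:ℝ) < P := Ppos
  have ho : (n:ℝ) * |(a.valMinAbs:ℝ)| * 2 < P := by
    rw [← mul_div_assoc, div_lt_iff₀ hP] at h; linarith
  rw [← Int.cast_abs] at ho
  have jb : (n:ℤ) * |a.valMinAbs| * 2 < P := by exact_mod_cast ho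
  have jd : ((n:ZMod P) * a).valMinAbs = n * a.valMinAbs := by
    rw [ZMod.valMinAbs_spec]
    refine ⟨by push_cast; rfl, ?_⟩
    have : |(n:ℤ) * a.valMinAbs * 2| < P := by rw [abs_mul, abs_mul]; simpa using jb
    rw [abs_lt] at this
    rw [Set.mem_Ioc]
    constructor <;> linarith
  rw [jd]; push_cast; rw [abs_mul, Nat.abs_cast, mul_div_assoc]
theorem ch_dist (a : ZMod P) : ‖1 - ch a‖ ≤ 7 * nn a ∧ 4 * nn a ≤ ‖1 - ch a‖ := by
  have hP : (0:ℝ) < P := Ppos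
  set v := a.valMinAbs with hv
  have ho : ch a = Complex.exp (Complex.I * ((2 * Real.pi * v / P : ℝ) : ℂ)) := by
    unfold ch
    rw [← ZMod.coe_valMinAbs a, ZMod.stdAddChar_coe]
    push_cast; congr 1; ring
  have jb : ‖1 - ch a‖ = 2 * |Real.sin (Real.pi * v / P)| := by
    rw [norm_sub_rev, ho, Complex.norm_exp_I_mul_ofReal_sub_one, norm_mul, Real.norm_eq_abs, Real.norm_eq_abs]
    norm_num; congr 2; ring
  have hb : |(v:ℝ)| * 2 ≤ P := by
    have := ZMod.valMinAbs_mem_Ioc a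
    rw [Set.mem_Ioc] at this
    have : |v * 2| ≤ P := by rw [abs_le]; constructor <;> linarith
    rw [abs_mul] at this
    have jd : |v| * 2 ≤ P := by simpa using this
    rw [← Int.cast_abs]; exact_mod_cast jd
  have ea : |Real.pi * v / P| = Real.pi * nn a := by
    unfold nn; rw [abs_div, abs_mul, abs_of_pos Real.pi_pos, abs_of_pos hP]; ring
  constructor
  · rw [jb]
    have := Real.abs_sin_le_abs (x := Real.pi * v / P)
    rw [ea] at this
    have := Real.pi_lt_d2
    nlinarith [nnn a]
  · rw [jb]
    have jd : |Real.pi * v / P| ≤ Real.pi / 2 := by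
      rw [ea]
      have : nn a ≤ 1/2 := by unfold nn; rw [div_le_iff₀ hP]; linarith
      nlinarith [Real.pi_pos]
    have := Real.mul_abs_le_abs_sin jd
    rw [ea] at this
    have jg : 2 / Real.pi * (Real.pi * nn a) = 2 * nn a := by field_simp
    linarith
theorem geom (J : ℕ) (β : ZMod P) : ‖𝔼 j : Fin J, ch (((j:ℕ) : ZMod P) * β)‖ * (nn β * J) ≤ 1 := by
  rcases Nat.eq_zero_or_pos J with rfl | hJ
  · simp
  have hJ' : (0:ℝ) < J := by exact_mod_cast hJ
  rw [expect_fin J (fun j => ch ((j : ZMod P) * β)), norm_div, Complex.norm_natCast]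
  have ho : ∀ j : ℕ, ch ((j : ZMod P) * β) = (ch β) ^ j := by
    intro j
    unfold ch
    rw [← AddChar.map_nsmul_eq_pow, nsmul_eq_mul]
  simp_rw [ho]
  have jb := geom_sum_mul_neg (ch β) J
  have jd : ‖∑ i ∈ range J, ch β ^ i‖ * ‖1 - ch β‖ ≤ 2 := by
    rw [← norm_mul, jb]
    refine (norm_sub_le _ _).trans ?_
    rw [norm_pow, chn]; norm_num
  have je := (ch_dist β).2
  have jg := norm_nonneg (∑ i ∈ range J, ch β ^ i)
  have : ‖∑ i ∈ range J, ch β ^ i‖ / J * (nn β * J) = ‖∑ i ∈ range J, ch β ^ i‖ * nn β := by field_simp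
  rw [this]
  nlinarith
end
section
variable {P : ℕ} [NeZero P]
theorem far_pair (T : Finset ℕ) (n : ℕ) (h : n < T.card) : ∃ a ∈ T, ∃ b ∈ T, a + n ≤ b := by
  have hne : T.Nonempty := card_pos.1 (by omega)
  refine ⟨T.min' hne, min'_mem _ _, T.max' hne, max'_mem _ _, ?_⟩
  have ho : T ⊆ Icc (T.min' hne) (T.max' hne) := fun x hx => mem_Icc.2 ⟨min'_le _ _ hx, le_max' _ _ hx⟩
  have jb := card_le_card ho
  rw [Nat.card_Icc] at jb
  omega
theorem vino {ε : ℝ} (ja : 0 < ε) (ho : ε ≤ 1/2) {M : ℕ} (S : Finset ℕ) (hS : ∀ k ∈ S, k < M) (hc : ε * M ≤ S.card)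
    (ξ c : ZMod P) (hk : ∀ k ∈ S, nn ((k : ZMod P) * ξ - c) * (ε * M) ≤ 1) (hM : 1 ≤ ε ^ 11 * M) :
    ∃ r : ℕ, 0 < r ∧ r * ε ^ 11 ≤ 1 ∧ nn ((r : ZMod P) * ξ) * (ε ^ 11 * M ^ 2) ≤ 1 := by
  have jc : (0:ℝ) < M := by
    by_contra h
    have : (M:ℝ) = 0 := le_antisymm (not_lt.1 h) (Nat.cast_nonneg _)
    rw [this] at hM; norm_num at hM
  have hd : ∀ a ∈ S, ∀ b ∈ S, a ≤ b → nn (((b - a : ℕ) : ZMod P) * ξ) * (ε ^ 2 * M) ≤ 1 := by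
    intro a ha b hb hab
    have e : ((b - a : ℕ) : ZMod P) * ξ = ((b : ZMod P) * ξ - c) - ((a : ZMod P) * ξ - c) := by
      rw [Nat.cast_sub hab]; ring
    have jb := nn_sub ((b : ZMod P) * ξ - c) ((a : ZMod P) * ξ - c)
    rw [← e] at jb
    have jd := hk a ha
    have je := hk b hb
    have jg : nn (((b - a : ℕ) : ZMod P) * ξ) * (ε * M) ≤ 2 := by
      calc _ ≤ (nn ((b : ZMod P) * ξ - c) + nn ((a : ZMod P) * ξ - c)) * (ε * M) := by gcongr
        _ ≤ 2 := by linarith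
    nlinarith [nnn (((b - a : ℕ) : ZMod P) * ξ)]
  obtain ⟨r, ji, kd, hτ⟩ : ∃ r : ℕ, 0 < r ∧ r * ε ^ 3 ≤ 1 ∧ nn ((r : ZMod P) * ξ) * (ε ^ 2 * M) ≤ 1 := by
    set R := ⌈1 / ε ^ 2⌉₊ with hR
    have jm : 1 / ε ^ 2 ≤ R := Nat.le_ceil _
    have jq : (R:ℝ) < 1 / ε ^ 2 + 1 := Nat.ceil_lt_add_one (by positivity)
    have hR3 : 1 ≤ R * ε ^ 2 := by rwa [div_le_iff₀ (by positivity)] at jm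
    have hR4 : R * ε ^ 3 ≤ 1 := by
      have : R * ε ^ 2 < 1 + ε ^ 2 := by
        have := mul_lt_mul_of_pos_right jq (show 0 < ε ^ 2 by positivity)
        rwa [add_mul, one_mul, one_div_mul_cancel (by positivity)] at this
      nlinarith
    have kj : 0 < R := by
      rcases Nat.eq_zero_or_pos R with h | h
      · rw [h] at hR3; norm_num at hR3
      · exact h
    have hcard : (range (M / R + 1)).card < S.card := by
      rw [card_range]
      have jb : ((M / R : ℕ) : ℝ) ≤ ε ^ 2 * M := by
        refine Nat.cast_div_le.trans ?_
        rw [div_le_iff₀ (by exact_mod_cast kj)]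
        nlinarith
      have jd : (1:ℝ) < ε ^ 2 * M := by
        have := epm ja ho 2 9 (c := 2) (by norm_num)
        have := mul_le_mul_of_nonneg_right this jc.le
        norm_num at this; linarith
      have je : ε ^ 2 * M * 2 ≤ ε * M := by nlinarith
      have : (((M / R + 1 : ℕ)) : ℝ) < S.card := by push_cast; linarith
      exact_mod_cast this
    obtain ⟨a, ha, b, hb, hab, he⟩ := exists_ne_map_eq_of_card_lt_of_maps_to hcard (f := fun k => k / R)
      (fun k hk => by
        have := Nat.div_le_div_right (c := R) (hS k hk).le
        simp only [coe_range, Set.mem_Iio]; omega)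
    wlog hlt : a < b generalizing a b
    · exact this b hb a ha hab.symm he.symm (by omega)
    refine ⟨b - a, by omega, ?_, hd a ha b hb hlt.le⟩
    have : b - a ≤ R := by
      have ea := Nat.div_add_mod a R
      have eb := Nat.div_add_mod b R
      have ec := Nat.mod_lt b kj
      rw [he] at ea; omega
    have : ((b - a : ℕ) : ℝ) ≤ R := by exact_mod_cast this
    nlinarith [show 0 < ε ^ 3 by positivity]
  obtain ⟨W, kt, hW1, hW2⟩ := xlen ja ho 4 (szm ja ho (show 4 ≤ 11 by norm_num) jc.le hM)
  have hW3 : 1 ≤ ε ^ 3 * W := by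
    have : ε ^ 3 * (ε ^ 5 * M) ≤ ε ^ 3 * W := by gcongr
    have jb : ε ^ 11 * M ≤ ε ^ 8 * M := mul_le_mul_of_nonneg_right (epl ja ho (by norm_num)) jc.le
    linarith [show ε ^ 3 * (ε ^ 5 * M) = ε ^ 8 * M by ring]
  obtain ⟨n, ju, kk, kl⟩ := xlen ja ho 3 hW3
  have kt' : (0:ℝ) < W := by exact_mod_cast kt
  have ji' : (0:ℝ) < r := by exact_mod_cast ji
  have hrW : (r:ℝ) * W ≤ M := by
    calc (r:ℝ) * W ≤ r * (ε ^ 4 * M) := by gcongr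
      _ = (r * ε ^ 3) * (ε * M) := by ring
      _ ≤ 1 * (1 * M) := by gcongr; linarith
      _ = M := by ring
  have hcard : (range r ×ˢ range (M / (r * W) + 1)).card * n < S.card := by
    rw [card_product, card_range, card_range]
    have jb : ((M / (r * W) : ℕ) : ℝ) ≤ M / (r * W) := by
      refine Nat.cast_div_le.trans ?_; push_cast; exact le_rfl
    have jd : ((r * (M / (r * W) + 1) * n : ℕ) : ℝ) < S.card := by
      push_cast
      calc (r:ℝ) * (((M / (r * W) : ℕ) : ℝ) + 1) * n ≤ r * (M / (r * W) + M / (r * W)) * (ε ^ 3 * W) := by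
            gcongr
            rw [le_div_iff₀ (by positivity)]; linarith
        _ = 2 * ε ^ 3 * M := by field_simp; ring
        _ < ε * M := by
            have : 2 * ε ^ 3 < ε := by nlinarith [mul_pos ja ja]
            gcongr
        _ ≤ _ := hc
    exact_mod_cast jd
  obtain ⟨⟨u, v⟩, -, hf⟩ := exists_lt_card_fiber_of_mul_lt_card_of_maps_to (f := fun k => (k % r, k / (r * W)))
      (fun k hk => by
        have := Nat.div_le_div_right (c := r * W) (hS k hk).le
        simp only [mem_product, mem_range]
        exact ⟨Nat.mod_lt _ ji, by omega⟩) hcard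
  set T := ({x ∈ S | (x % r, x / (r * W)) = (u, v)} : Finset ℕ) with hT
  have hTm : ∀ x ∈ T, x ∈ S ∧ x % r = u ∧ x / (r * W) = v := by
    intro x hx; rw [hT, mem_filter, Prod.mk.injEq] at hx; exact hx
  have hci : (T.image (fun k => k / r)).card = T.card := by
    apply card_image_of_injOn
    intro x hx y hy hxy
    have jb := (hTm x hx).2.1
    have jd := (hTm y hy).2.1
    have ea := Nat.div_add_mod x r
    have eb := Nat.div_add_mod y r
    simp only at hxy
    rw [jb, hxy] at ea; rw [jd] at eb; omega
  obtain ⟨ac, ha', bf, pp, hab⟩ := far_pair (T.image (fun k => k / r)) n (by rw [hci]; exact hf)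
  rw [mem_image] at ha' pp
  obtain ⟨a, ha, rfl⟩ := ha'
  obtain ⟨b, hb, rfl⟩ := pp
  obtain ⟨haS, jt, ha2⟩ := hTm a ha
  obtain ⟨hbS, hb1, ku⟩ := hTm b hb
  set j := b / r - a / r with hj
  have hjn : n ≤ j := by omega
  have hba : b - a = j * r ∧ a ≤ b := by
    have ea := Nat.div_add_mod a r
    have eb := Nat.div_add_mod b r
    have ec : b / r = a / r + j := by omega
    rw [ec, mul_add] at eb
    rw [mul_comm j r]; omega
  have hjW : j ≤ W := by
    have ea : a / r / W = v := by rw [Nat.div_div_eq_div_mul]; exact ha2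
    have eb : b / r / W = v := by rw [Nat.div_div_eq_div_mul]; exact ku
    have ec := Nat.div_add_mod (a / r) W
    have ed := Nat.div_add_mod (b / r) W
    have := Nat.mod_lt (b / r) kt
    rw [ea] at ec; rw [eb] at ed; omega
  have hdd := hd a haS b hbS hba.2
  rw [hba.1, Nat.cast_mul, mul_assoc] at hdd
  set τ := (r : ZMod P) * ξ with hτd
  have hjW' : (j:ℝ) ≤ W := by exact_mod_cast hjW
  have hjn' : (n:ℝ) ≤ j := by exact_mod_cast hjn
  have hnτ := nnn τ
  rw [nn_lin j τ] at hdd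
  · refine ⟨r, ji, ?_, ?_⟩
    · refine le_trans ?_ kd
      exact mul_le_mul_of_nonneg_left (epl ja ho (by norm_num)) ji'.le
    · calc nn τ * (ε ^ 11 * M ^ 2) = (ε ^ 4 * (ε ^ 5 * M)) * nn τ * (ε ^ 2 * M) := by ring
        _ ≤ (ε ^ 4 * W) * nn τ * (ε ^ 2 * M) := by gcongr
        _ ≤ j * nn τ * (ε ^ 2 * M) := by gcongr; exact kl.trans hjn'
        _ ≤ 1 := hdd
  · calc j * nn τ ≤ (ε ^ 4 * M) * nn τ := by gcongr; linarith
      _ = ε ^ 2 * (nn τ * (ε ^ 2 * M)) := by ring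
      _ ≤ ε ^ 2 * 1 := by gcongr
      _ < 1/2 := by nlinarith
end
section
variable {P : ℕ} [NeZero P]
theorem szp {ε : ℝ} {M : ℝ} {k : ℕ} (ja : 0 < ε) (h : 1 ≤ ε ^ k * M) : 0 < M := by
  by_contra hM
  have := mul_nonpos_of_nonneg_of_nonpos (show 0 ≤ ε ^ k by positivity) (not_lt.1 hM)
  linarith
theorem vinoE {ε : ℝ} (ja : 0 < ε) (ho : ε ≤ 1/2) {M : ℕ} (w : ℕ → ℝ) (hw : ∀ k, w k ≤ 1) (hE : ε ≤ 𝔼 k : Fin M, w k)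
    (ξ c : ZMod P) (hk : ∀ k < M, ε / 2 ≤ w k → nn ((k : ZMod P) * ξ - c) * (ε ^ 2 * M) ≤ 1) (hM : 1 ≤ ε ^ 22 * M) :
    ∃ r : ℕ, 0 < r ∧ r * ε ^ 22 ≤ 1 ∧ nn ((r : ZMod P) * ξ) * (ε ^ 22 * M ^ 2) ≤ 1 := by
  classical
  have jc : (0:ℝ) < M := szp ja hM
  have : NeZero M := ⟨by rintro rfl; simp at jc⟩
  have jd := popular (F := fun k : Fin M => ind (ε / 2 ≤ w k)) ja.le zero_le_one (fun k => hw k) (fun k => indn _)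
    (fun k hk => by rw [indt hk]) hE
  rw [expect_ind_fin M (fun k => ε / 2 ≤ w k), le_div_iff₀ jc] at jd
  have := vino (P := P) (ε := ε ^ 2) (by positivity) (by nlinarith) ((range M).filter (fun k => ε / 2 ≤ w k)) (fun k hk => mem_range.1 (mem_filter.1 hk).1)
    (by nlinarith) ξ c (fun k h => hk k (mem_range.1 (mem_filter.1 h).1) (mem_filter.1 h).2) (by rw [← pow_mul]; exact hM)
  simpa only [← pow_mul] using this
theorem geom' {J : ℕ} {β : ZMod P} {a : ℝ} (ha : a ≤ ‖𝔼 j : Fin J, ch (((j:ℕ) : ZMod P) * β)‖) : a * (nn β * J) ≤ 1 :=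
  (mul_le_mul_of_nonneg_right ha (mul_nonneg (nnn _) (Nat.cast_nonneg _))).trans (geom J β)
theorem weyl {ε : ℝ} (ja : 0 < ε) (ho : ε ≤ 1/2) {M : ℕ} (hM : 1 ≤ ε ^ 210 * M) (α β : ZMod P)
    (h : ε ≤ ‖𝔼 y : Fin M, ch (α * ((y:ℕ) : ZMod P) ^ 2 + β * ((y:ℕ) : ZMod P))‖) :
    ∃ r : ℕ, 0 < r ∧ r * ε ^ 210 ≤ 1 ∧ nn ((r : ZMod P) * α) * (ε ^ 210 * M ^ 2) ≤ 1 ∧ nn ((r : ZMod P) * β) * (ε ^ 210 * M) ≤ 1 := by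
  have jc : (0:ℝ) < M := szp ja hM
  have : NeZero M := ⟨by rintro rfl; simp at jc⟩
  set z : ℕ → ℂ := fun y => ch (α * (y : ZMod P) ^ 2 + β * (y : ZMod P)) with hz
  have km : ∀ y, ‖z y‖ ≤ 1 := fun y => (chn _).le
  obtain ⟨r, ji, jn, jk⟩ : ∃ r : ℕ, 0 < r ∧ r * ε ^ 89 ≤ 1 ∧ nn ((r : ZMod P) * α) * (ε ^ 96 * M ^ 2) ≤ 1 := by
    obtain ⟨m, jf, jo, jw⟩ := xlen ja ho 3 (szm ja ho (show 3 ≤ 210 by norm_num) jc.le hM)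
    have : NeZero m := ⟨jf.ne'⟩
    have jb := shift_avg (I := Fin m) M m (fun b => b) (fun b => b.2.le) z km
    have jd : 2 * (m:ℝ) / M ≤ ε / 2 := by
      rw [div_le_iff₀ jc]; nlinarith [show ε ^ 3 ≤ ε / 4 by have := epm ja ho 1 2 (c := 4) (by norm_num); norm_num at this; linarith, mul_pos ja jc]
    have je : ε / 2 ≤ ‖𝔼 b : Fin m, 𝔼 y : Fin M, z (y + b)‖ := by
      have := norm_sub_norm_le (𝔼 y : Fin M, z y) (𝔼 b : Fin m, 𝔼 y : Fin M, z (y + b))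
      linarith
    rw [expect_comm] at je
    have jg : (ε / 2) ^ 2 ≤ 𝔼 bf : Fin m, 𝔼 b : Fin m, ‖𝔼 y : Fin M, ch (((y:ℕ) : ZMod P) * ((((b:ℕ) : ZMod P) * (2 * α)) - ((bf:ℕ) : ZMod P) * (2 * α)))‖ := by
      refine (pow_le_pow_left₀ (by positivity) je 2).trans ((norm_sq_expect_le _).trans ?_)
      simp_rw [nse]
      rw [← re_expect]
      have e : 𝔼 y : Fin M, 𝔼 b : Fin m, 𝔼 bf : Fin m, z (y + b) * conj (z (y + bf)) =
          𝔼 bf : Fin m, 𝔼 b : Fin m, (z b * conj (z bf)) * 𝔼 y : Fin M, ch (((y:ℕ) : ZMod P) * ((((b:ℕ) : ZMod P) * (2 * α)) - ((bf:ℕ) : ZMod P) * (2 * α))) := by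
        rw [expect_comm]
        conv_lhs => enter [2, b]; rw [expect_comm]
        rw [expect_comm]
        refine expect_congr rfl fun bf _ => expect_congr rfl fun b _ => ?_
        rw [mul_expect]
        refine expect_congr rfl fun y _ => ?_
        simp only [hz]
        rw [← ch_sub, ← ch_sub, ← ch_add]
        congr 1; push_cast; ring
      rw [e]
      refine (Complex.re_le_norm _).trans ((nee _).trans (emono fun bf => (nee _).trans (emono fun b => ?_)))
      rw [norm_mul]
      exact mul_le_of_le_one_left (norm_nonneg _) (nml (km _) (ncl (km _)))
    obtain ⟨bf, pp⟩ := ege jg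
    have hMm : ε ^ 4 * M ≤ m := jw
    obtain ⟨r, ji, jn, jk⟩ := vinoE (P := P) (ε := ε ^ 4) (by positivity) (by nlinarith [pow_le_one₀ ja.le (show ε ≤ 1 by linarith) (n := 3), epm ja ho 0 4 (c := 2) (by norm_num)])
      (M := m) (fun b => ‖𝔼 y : Fin M, ch (((y:ℕ) : ZMod P) * (((b : ZMod P) * (2 * α)) - ((bf:ℕ) : ZMod P) * (2 * α)))‖)
      (fun k => neo fun y => (chn _).le) (le_trans (by nlinarith [show ε ^ 4 = ε ^ 2 * ε ^ 2 by ring, show ε ^ 2 ≤ 1/4 by nlinarith, pow_pos ja 2]) pp) (2 * α) (((bf:ℕ) : ZMod P) * (2 * α))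
      (fun b hb hw => by
        have jl := geom' hw
        set t := nn ((b : ZMod P) * (2 * α) - ((bf:ℕ) : ZMod P) * (2 * α))
        have ht : 0 ≤ t := nnn _
        calc t * ((ε ^ 4) ^ 2 * m) ≤ t * ((ε ^ 4) ^ 2 * (1 * M)) := by
              gcongr
              exact jo.trans (mul_le_mul_of_nonneg_right (pow_le_one₀ ja.le (by linarith)) jc.le)
          _ = (2 * ε ^ 4) * (ε ^ 4 / 2 * (t * M)) := by ring
          _ ≤ 1 * 1 := by gcongr; exact epm ja ho 0 4 (by norm_num)
          _ = 1 := by norm_num)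
      (by
        rw [← pow_mul]
        calc (1:ℝ) ≤ ε ^ 92 * M := szm ja ho (by norm_num) jc.le hM
          _ = ε ^ 88 * (ε ^ 4 * M) := by ring
          _ ≤ ε ^ (4 * 22) * m := by gcongr)
    refine ⟨2 * r, by omega, ?_, ?_⟩
    · push_cast
      calc 2 * (r:ℝ) * ε ^ 89 = 2 * ε * (r * (ε ^ 4) ^ 22) := by ring
        _ ≤ 1 * 1 := by gcongr; linarith
        _ = 1 := by norm_num
    · have e : ((2 * r : ℕ) : ZMod P) * α = (r : ZMod P) * (2 * α) := by push_cast; ring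
      rw [e]
      refine le_trans ?_ jk
      have := nnn ((r : ZMod P) * (2 * α))
      calc nn ((r : ZMod P) * (2 * α)) * (ε ^ 96 * M ^ 2) = nn ((r : ZMod P) * (2 * α)) * ((ε ^ 4) ^ 22 * (ε ^ 4 * M) ^ 2) := by ring
        _ ≤ _ := by gcongr
  obtain ⟨J, ke, kf, jv⟩ := xlen ja ho 200 (szm ja ho (show 200 ≤ 210 by norm_num) jc.le hM)
  have : NeZero J := ⟨ke.ne'⟩
  have ji' : (0:ℝ) < r := by exact_mod_cast ji
  have hrJ : (r:ℝ) * J ≤ ε ^ 100 * M := by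
    calc (r:ℝ) * J ≤ r * (ε ^ 200 * M) := by gcongr
      _ = (r * ε ^ 89) * (ε ^ 111 * M) := by ring
      _ ≤ 1 * (ε ^ 100 * M) := by gcongr ?_ * ?_; exact mul_le_mul_of_nonneg_right (epl ja ho (by norm_num)) jc.le
      _ = _ := one_mul _
  have jb := shift_avg (I := Fin J) M (r * J) (fun j => r * j) (fun j => Nat.mul_le_mul le_rfl j.2.le) z km
  have e8 : 16 * ε ^ 100 ≤ ε := by
    have := epm ja ho 1 99 (c := 16) (by norm_num); simpa using this
  have jd : 2 * ((r * J : ℕ):ℝ) / M ≤ ε / 2 := by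
    push_cast
    rw [div_le_iff₀ jc]; nlinarith
  have je : ε / 2 ≤ ‖𝔼 j : Fin J, 𝔼 y : Fin M, z (y + r * j)‖ := by
    have := norm_sub_norm_le (𝔼 y : Fin M, z y) (𝔼 j : Fin J, 𝔼 y : Fin M, z (y + r * j))
    linarith
  rw [expect_comm] at je
  obtain ⟨y, hy⟩ := egn je
  have hn := nnn ((r : ZMod P) * α)
  have jg : ε / 4 ≤ ‖𝔼 j : Fin J, ch (((j:ℕ) : ZMod P) * ((r : ZMod P) * β))‖ := by
    have jl : ∀ j : Fin J, ‖z (y + r * j) - z y * ch (((j:ℕ) : ZMod P) * ((r : ZMod P) * β))‖ ≤ ε / 4 := by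
      intro j
      have e : z (y + r * j) = z y * ch (((j:ℕ) : ZMod P) * ((r : ZMod P) * β)) * ch (((2 * y * j + r * j ^ 2 : ℕ) : ZMod P) * ((r : ZMod P) * α)) := by
        simp only [hz]; rw [← ch_add, ← ch_add]; congr 1; push_cast; ring
      have eb : z (y + r * j) - z y * ch (((j:ℕ) : ZMod P) * ((r : ZMod P) * β)) = - (z y * ch (((j:ℕ) : ZMod P) * ((r : ZMod P) * β)) * (1 - ch (((2 * y * j + r * j ^ 2 : ℕ) : ZMod P) * ((r : ZMod P) * α)))) := by rw [e]; ring
      rw [eb, norm_neg, norm_mul, norm_mul, hz, chn, chn, one_mul, one_mul]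
      refine (ch_dist _).1.trans ?_
      have jp := nn_nat_mul (2 * y * j + r * j ^ 2) ((r : ZMod P) * α)
      have hj : ((j:ℕ):ℝ) ≤ J := by exact_mod_cast j.2.le
      have hyM : ((y:ℕ):ℝ) ≤ M := by exact_mod_cast y.2.le
      have kb : ((2 * y * j + r * j ^ 2 : ℕ) : ℝ) ≤ 3 * (ε ^ 200 * M ^ 2) := by
        push_cast
        have hrJ' : (r:ℝ) * J ≤ M := hrJ.trans (mul_le_of_le_one_left jc.le (pow_le_one₀ ja.le (by linarith)))
        calc 2 * ((y:ℕ):ℝ) * ((j:ℕ):ℝ) + r * ((j:ℕ):ℝ) ^ 2 ≤ 2 * (M:ℝ) * J + r * (J:ℝ) ^ 2 := by gcongr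
          _ = 2 * (M:ℝ) * J + (r * J) * J := by ring
          _ ≤ 2 * (M:ℝ) * J + M * J := by gcongr
          _ = 3 * (M:ℝ) * J := by ring
          _ ≤ 3 * (M:ℝ) * (ε ^ 200 * M) := by gcongr
          _ = _ := by ring
      calc 7 * nn (((2 * y * j + r * j ^ 2 : ℕ) : ZMod P) * ((r : ZMod P) * α)) ≤ 7 * ((3 * (ε ^ 200 * M ^ 2)) * nn ((r : ZMod P) * α)) := by
            gcongr; exact jp.trans (by gcongr)
        _ = 21 * ε ^ 104 * (nn ((r : ZMod P) * α) * (ε ^ 96 * M ^ 2)) := by ring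
        _ ≤ 21 * ε ^ 104 * 1 := by gcongr
        _ ≤ ε / 4 := by
          have := epm ja ho 1 103 (c := 84) (by norm_num)
          norm_num at this; linarith
    have js : ‖𝔼 j : Fin J, z (y + r * j) - 𝔼 j : Fin J, z y * ch (((j:ℕ) : ZMod P) * ((r : ZMod P) * β))‖ ≤ ε / 4 := by
      rw [← expect_sub_distrib]; exact nel jl
    rw [← mul_expect] at js
    have h10 := norm_sub_norm_le (𝔼 j : Fin J, z (y + r * j)) (z y * 𝔼 j : Fin J, ch (((j:ℕ) : ZMod P) * ((r : ZMod P) * β)))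
    rw [norm_mul, show ‖z y‖ = 1 from chn _, one_mul] at h10
    linarith
  have jl := geom' jg
  have hb := nnn ((r : ZMod P) * β)
  refine ⟨r, ji, ?_, ?_, ?_⟩
  · exact (mul_le_mul_of_nonneg_left (epl ja ho (by norm_num)) ji'.le).trans jn
  · exact (mul_le_mul_of_nonneg_left (mul_le_mul_of_nonneg_right (epl ja ho (by norm_num)) (by positivity)) hn).trans jk
  · calc nn ((r : ZMod P) * β) * (ε ^ 210 * M) = nn ((r : ZMod P) * β) * (ε ^ 9 * (ε ^ (200 + 1) * M)) := by ring
      _ ≤ nn ((r : ZMod P) * β) * (ε ^ 9 * J) := by gcongr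
      _ = (4 * ε ^ 8) * (ε / 4 * (nn ((r : ZMod P) * β) * J)) := by ring
      _ ≤ 1 * 1 := by gcongr; exact epm ja ho 0 8 (by norm_num)
      _ = 1 := one_mul 1
end
theorem pigeon_r {ι : Type} [Fintype ι] (p : ι → ℕ → Prop) {θ η : ℝ} (hθ : 0 < θ) (hη : 0 < η)
    (h : θ ≤ 𝔼 i, ind (∃ r : ℕ, 0 < r ∧ r * η ≤ 1 ∧ p i r)) : ∃ r : ℕ, 0 < r ∧ r * η ≤ 1 ∧ θ * η ≤ 𝔼 i, ind (p i r) := by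
  by_contra hc
  push Not at hc
  have hm : ∀ r ∈ Icc 1 ⌊1 / η⌋₊, 0 < r ∧ (r:ℝ) * η ≤ 1 := by
    intro r hr
    rw [mem_Icc, Nat.le_floor_iff (by positivity), le_div_iff₀ hη] at hr
    exact ⟨hr.1, hr.2⟩
  have ho : 𝔼 i, ind (∃ r : ℕ, 0 < r ∧ r * η ≤ 1 ∧ p i r) ≤ ∑ r ∈ Icc 1 ⌊1 / η⌋₊, 𝔼 i, ind (p i r) := by
    rw [← expect_sum_comm]
    refine emono fun i => ?_
    by_cases hp : ∃ r : ℕ, 0 < r ∧ r * η ≤ 1 ∧ p i r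
    · obtain ⟨r, jb, jd, je⟩ := id hp
      rw [indt hp]
      refine le_trans (le_of_eq (indt je).symm) ?_
      refine single_le_sum (f := fun r => ind (p i r)) (fun _ _ => indn _) ?_
      rw [mem_Icc, Nat.le_floor_iff (by positivity), le_div_iff₀ hη]
      exact ⟨jb, jd⟩
    · rw [indf hp]; exact sum_nonneg fun _ _ => indn _
  have jb : (⌊1 / η⌋₊ : ℝ) * η ≤ 1 := by
    have := Nat.floor_le (show 0 ≤ 1 / η by positivity)
    rwa [le_div_iff₀ hη] at this
  have je : ∑ r ∈ Icc 1 ⌊1 / η⌋₊, 𝔼 i, ind (p i r) < θ := by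
    rcases (Icc 1 ⌊1 / η⌋₊).eq_empty_or_nonempty with he | hne
    · rw [he]; simpa using hθ
    · calc _ < ∑ r ∈ Icc 1 ⌊1 / η⌋₊, θ * η := sum_lt_sum_of_nonempty hne fun r hr => hc r (hm r hr).1 (hm r hr).2
        _ = θ * (⌊1 / η⌋₊ * η) := by simp; ring
        _ ≤ θ * 1 := by gcongr
        _ = θ := mul_one _
  linarith
section
variable {P : ℕ} [NeZero P] {G : Type} [AddCommGroup G] [Fintype G]
theorem major_aux {ρ : ℝ} (ja : 0 < ρ) (ho : ρ ≤ 1/2) {M m : ℕ} (hm : ρ ^ 2 * M ≤ m) (hmM : m ≤ M) (hM : 1 ≤ ρ ^ 4900 * M)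
    (φ : ℕ → ZMod P) (b : ℕ → ℂ) (hb : ∀ y, ‖b y‖ ≤ 1) (ya : ℕ) (pn : ZMod P)
    (h : 2 * ρ ≤ 𝔼 y : Fin M, ‖b y‖ * ‖𝔼 k : Fin m, ch (φ y * (((y:ℕ):ZMod P) + ((k:ℕ):ZMod P)) ^ 2 - pn * ((ya:ZMod P) + ((k:ℕ):ZMod P)) ^ 2)‖) :
    ∃ r : ℕ, 0 < r ∧ r * ρ ^ 4900 ≤ 1 ∧ nn ((r : ZMod P) * pn) * (ρ ^ 4900 * M ^ 2) ≤ 1 := by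
  have jc : (0:ℝ) < M := szp ja hM
  have : NeZero M := ⟨by rintro rfl; simp at jc⟩
  have jf : (0:ℝ) < m := lt_of_lt_of_le (by positivity) hm
  have : NeZero m := ⟨by rintro rfl; simp at jf⟩
  set g : ℕ → ℕ → Prop := fun y r => nn ((r : ZMod P) * (φ y - pn)) * (ρ ^ 210 * m ^ 2) ≤ 1 ∧
    nn ((r : ZMod P) * (2 * ((y:ZMod P) * φ y - (ya:ZMod P) * pn))) * (ρ ^ 210 * m) ≤ 1 with hg
  have jb := popular (F := fun y : Fin M => ind (∃ r : ℕ, 0 < r ∧ r * ρ ^ 210 ≤ 1 ∧ g y r)) (by positivity) zero_le_one (fun y => ?_) (fun y => indn _)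
    (fun y hy => ?_) h
  rotate_left
  · exact mul_le_one₀ (hb _) (norm_nonneg _) (neo fun _ => (chn _).le)
  · rw [indt]
    have kv : ρ ≤ ‖𝔼 k : Fin m, ch (φ y * (((y:ℕ):ZMod P) + ((k:ℕ):ZMod P)) ^ 2 - pn * ((ya:ZMod P) + ((k:ℕ):ZMod P)) ^ 2)‖ := by
      have := mul_le_of_le_one_left (norm_nonneg (𝔼 k : Fin m, ch (φ y * (((y:ℕ):ZMod P) + ((k:ℕ):ZMod P)) ^ 2 - pn * ((ya:ZMod P) + ((k:ℕ):ZMod P)) ^ 2))) (hb y)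
      linarith
    have e : 𝔼 k : Fin m, ch (φ y * (((y:ℕ):ZMod P) + ((k:ℕ):ZMod P)) ^ 2 - pn * ((ya:ZMod P) + ((k:ℕ):ZMod P)) ^ 2) =
      ch (φ y * ((y:ℕ):ZMod P) ^ 2 - pn * (ya:ZMod P) ^ 2) * 𝔼 k : Fin m, ch ((φ y - pn) * ((k:ℕ):ZMod P) ^ 2 + (2 * (((y:ℕ):ZMod P) * φ y - (ya:ZMod P) * pn)) * ((k:ℕ):ZMod P)) := by
      rw [mul_expect]
      refine expect_congr rfl fun k _ => ?_
      rw [← ch_add]; congr 1; ring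
    rw [e, norm_mul, chn, one_mul] at kv
    refine weyl ja ho ?_ _ _ kv
    calc (1:ℝ) ≤ ρ ^ 212 * M := szm ja ho (by norm_num) jc.le hM
      _ = ρ ^ 210 * (ρ ^ 2 * M) := by ring
      _ ≤ _ := by gcongr
  rw [mul_one, mul_div_cancel_left₀ _ (by norm_num : (2:ℝ) ≠ 0)] at jb
  obtain ⟨ra, ji, jn, jk⟩ := pigeon_r (fun (y : Fin M) r => g y r) ja (by positivity) jb
  have jk' : ρ ^ 211 ≤ 𝔼 y : Fin M, ind (g y ra) := le_trans (by rw [pow_succ']) jk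
  have hk : ∀ y < M, ρ ^ 211 / 2 ≤ ind (g y ra) → nn ((y : ZMod P) * (2 * (ra : ZMod P) * pn) - (ya : ZMod P) * (2 * (ra : ZMod P) * pn)) * ((ρ ^ 211) ^ 2 * M) ≤ 1 := by
    intro y hy hw
    have hgy : g y ra := by
      by_contra hn
      rw [indf hn] at hw
      linarith [pow_pos ja 211]
    obtain ⟨g1, g2⟩ := hgy
    have e : (y : ZMod P) * (2 * ra * pn) - ya * (2 * ra * pn) = (ra : ZMod P) * (2 * ((y:ZMod P) * φ y - (ya:ZMod P) * pn)) - ((2 * y : ℕ) : ZMod P) * ((ra : ZMod P) * (φ y - pn)) := by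
      push_cast; ring
    rw [e]
    have jd := nn_sub ((ra : ZMod P) * (2 * ((y:ZMod P) * φ y - (ya:ZMod P) * pn))) (((2 * y : ℕ) : ZMod P) * ((ra : ZMod P) * (φ y - pn)))
    have je := nn_nat_mul (2 * y) ((ra : ZMod P) * (φ y - pn))
    set u := nn ((ra : ZMod P) * (2 * ((y:ZMod P) * φ y - (ya:ZMod P) * pn)))
    set v := nn ((ra : ZMod P) * (φ y - pn))
    have hu : 0 ≤ u := nnn _
    have hv : 0 ≤ v := nnn _
    have hyM : (y:ℝ) ≤ M := by exact_mod_cast hy.le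
    push_cast at je
    have g3 : u * (ρ ^ 212 * M) ≤ 1 := by
      refine le_trans ?_ g2
      have : ρ ^ 212 * M = ρ ^ 210 * (ρ ^ 2 * M) := by ring
      rw [this]; gcongr
    have g4 : v * (ρ ^ 214 * M ^ 2) ≤ 1 := by
      refine le_trans ?_ g1
      have : ρ ^ 214 * M ^ 2 = ρ ^ 210 * (ρ ^ 2 * M) ^ 2 := by ring
      rw [this]; gcongr
    calc _ ≤ (u + 2 * M * v) * ((ρ ^ 211) ^ 2 * M) := by
          gcongr; exact jd.trans (add_le_add le_rfl (by push_cast; exact je.trans (by gcongr)))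
      _ = ρ ^ 210 * (u * (ρ ^ 212 * M)) + 2 * ρ ^ 208 * (v * (ρ ^ 214 * M ^ 2)) := by ring
      _ ≤ ρ ^ 208 * 1 + 2 * ρ ^ 208 * 1 := by
          gcongr ?_ * ?_ + 2 * ρ ^ 208 * ?_
          exact epl ja ho (by norm_num)
      _ ≤ 1 := by
          have := epm ja ho 0 208 (c := 3) (by norm_num)
          norm_num at this; linarith
  obtain ⟨r, hrr, kd, hr4⟩ := vinoE (P := P) (ε := ρ ^ 211) (by positivity) ((epl ja ho (show 1 ≤ 211 by norm_num)).trans (by linarith)) (M := M)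
    (fun k => ind (g k ra)) (fun _ => ind_le_one _) jk' (2 * ra * pn) (ya * (2 * ra * pn)) hk (by rw [← pow_mul]; exact szm ja ho (by norm_num) jc.le hM)
  · refine ⟨2 * ra * r, by positivity, ?_, ?_⟩
    · push_cast
      have e : (2 * (ra:ℝ) * r) * ρ ^ 4900 = (ra * ρ ^ 210) * (r * (ρ ^ 211) ^ 22) * (2 * ρ ^ 48) := by ring
      rw [e]
      have := epm ja ho 0 48 (c := 2) (by norm_num)
      norm_num at this
      exact mul_le_one₀ (mul_le_one₀ jn (by positivity) kd) (by positivity) this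
    · have e : ((2 * ra * r : ℕ) : ZMod P) * pn = (r : ZMod P) * (2 * ra * pn) := by push_cast; ring
      rw [e]
      refine le_trans (mul_le_mul_of_nonneg_left (mul_le_mul_of_nonneg_right ?_ (by positivity)) (nnn _)) hr4
      rw [← pow_mul]; exact epl ja ho (by norm_num)
theorem major {ε : ℝ} (ja : 0 < ε) (ho : ε ≤ 1/2) {M : ℕ} (hM : 1 ≤ ε ^ 19600 * M) (e : G) (a g : G → ℂ)
    (ha : ∀ x, ‖a x‖ ≤ 1) (hg : ∀ x, ‖g x‖ ≤ 1) (Φ : G → ZMod P)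
    (h : ε ≤ ‖𝔼 x, 𝔼 y : Fin M, a x * g (x + (y:ℕ) • e) * ch (Φ x * ((y:ℕ):ZMod P) ^ 2)‖) :
    ∃ x, a x ≠ 0 ∧ ∃ r : ℕ, 0 < r ∧ r * ε ^ 19600 ≤ 1 ∧ nn ((r : ZMod P) * Φ x) * (ε ^ 19600 * M ^ 2) ≤ 1 := by
  have jc : (0:ℝ) < M := szp ja hM
  have : NeZero M := ⟨by rintro rfl; simp at jc⟩
  obtain ⟨m, jf, jo, jw⟩ := xlen ja ho 5 (szm ja ho (show 5 ≤ 19600 by norm_num) jc.le hM)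
  have : NeZero m := ⟨jf.ne'⟩
  have ed : ε ^ 4 ≤ 1/16 := by
    have := epm ja ho 0 4 (c := 16) (by norm_num); norm_num at this; linarith
  set A : G → ℕ → ℂ := fun w y => a (w - y • e) * ch (Φ (w - y • e) * (y:ZMod P) ^ 2) with hA
  have hA1 : ∀ w y, ‖A w y‖ ≤ 1 := fun w y => nml (ha _) (chn _).le
  have ea : 𝔼 x, 𝔼 y : Fin M, a x * g (x + (y:ℕ) • e) * ch (Φ x * ((y:ℕ):ZMod P) ^ 2) = 𝔼 w, g w * 𝔼 y : Fin M, A w y := by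
    simp_rw [mul_expect]
    rw [expect_comm, expect_comm (t := (univ : Finset (Fin M)))]
    refine expect_congr rfl fun y _ => ?_
    refine Eq.trans ?_ (eshift ((y:ℕ) • e) _)
    refine expect_congr rfl fun x _ => ?_
    simp only [hA, add_sub_cancel_right]; ring
  rw [ea] at h
  have jb : ε ^ 2 ≤ 𝔼 w, ‖𝔼 y : Fin M, A w y‖ ^ 2 := (pow_le_pow_left₀ ja.le h 2).trans (cs_kill _ _ hg)
  simp_rw [nse] at jb
  rw [← re_expect] at jb
  have jd : ‖𝔼 w, 𝔼 y : Fin M, 𝔼 ya : Fin M, A w y * conj (A w ya) - 𝔼 w, 𝔼 b : Fin m, 𝔼 y : Fin M, 𝔼 ya : Fin M, A w (y + b) * conj (A w (ya + b))‖ ≤ 4 * m / M := by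
    rw [← expect_sub_distrib]
    exact nel fun w => shift_avg2 (I := Fin m) M m (fun b => b) (fun b => b) (fun b => b.2.le) (fun b => b.2.le) (fun y ya => A w y * conj (A w ya))
      (fun y ya => nml (hA1 _ _) (ncl (hA1 _ _)))
  have je : 4 * (m:ℝ) / M ≤ ε ^ 2 / 2 := by
    rw [div_le_iff₀ jc]
    have := epm ja ho 2 3 (c := 8) (by norm_num)
    have := mul_le_mul_of_nonneg_right this jc.le
    norm_num at this; linarith
  have jg : ε ^ 2 / 2 ≤ 𝔼 w, 𝔼 ya : Fin M, 𝔼 y : Fin M, ‖a (w - (y:ℕ) • e) * conj (a (w - (ya:ℕ) • e))‖ *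
      ‖𝔼 k : Fin m, ch (Φ (w - (y:ℕ) • e) * (((y:ℕ):ZMod P) + ((k:ℕ):ZMod P)) ^ 2 - Φ (w - (ya:ℕ) • e) * (((ya:ℕ):ZMod P) + ((k:ℕ):ZMod P)) ^ 2)‖ := by
    have jl := Complex.re_le_norm (𝔼 w, 𝔼 y : Fin M, 𝔼 ya : Fin M, A w y * conj (A w ya))
    have jp := norm_sub_norm_le (𝔼 w, 𝔼 y : Fin M, 𝔼 ya : Fin M, A w y * conj (A w ya)) (𝔼 w, 𝔼 b : Fin m, 𝔼 y : Fin M, 𝔼 ya : Fin M, A w (y + b) * conj (A w (ya + b)))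
    have eb : 𝔼 w, 𝔼 b : Fin m, 𝔼 y : Fin M, 𝔼 ya : Fin M, A w (y + b) * conj (A w (ya + b)) =
      𝔼 w, 𝔼 ya : Fin M, 𝔼 y : Fin M, (a (w - (y:ℕ) • e) * conj (a (w - (ya:ℕ) • e))) * 𝔼 k : Fin m, ch (Φ (w - (y:ℕ) • e) * (((y:ℕ):ZMod P) + ((k:ℕ):ZMod P)) ^ 2 - Φ (w - (ya:ℕ) • e) * (((ya:ℕ):ZMod P) + ((k:ℕ):ZMod P)) ^ 2) := by
      have ec : 𝔼 w, 𝔼 b : Fin m, 𝔼 y : Fin M, 𝔼 ya : Fin M, A w (y + b) * conj (A w (ya + b)) =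
        𝔼 w, 𝔼 b : Fin m, 𝔼 y : Fin M, 𝔼 ya : Fin M, (a (w - (y:ℕ) • e) * conj (a (w - (ya:ℕ) • e))) * ch (Φ (w - (y:ℕ) • e) * (((y:ℕ):ZMod P) + ((b:ℕ):ZMod P)) ^ 2 - Φ (w - (ya:ℕ) • e) * (((ya:ℕ):ZMod P) + ((b:ℕ):ZMod P)) ^ 2) := by
        rw [expect_comm, expect_comm (t := (univ : Finset (Fin m)))]
        refine expect_congr rfl fun b _ => ?_
        refine Eq.trans (eshift ((b:ℕ) • e) _).symm ?_
        refine expect_congr rfl fun w _ => expect_congr rfl fun y _ => expect_congr rfl fun ya _ => ?_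
        simp only [hA]
        have : ∀ n : ℕ, w + (b:ℕ) • e - (n + b) • e = w - n • e := by intro n; rw [add_smul]; abel
        rw [this, this, ch_sub, map_mul]; push_cast; ring
      rw [ec]
      refine expect_congr rfl fun w _ => ?_
      rw [expect_comm]
      simp_rw [mul_expect]
      conv_lhs => enter [2, y]; rw [expect_comm]
      rw [expect_comm]
    rw [eb] at jd jp
    refine le_trans (le_trans (by linarith) (show ε ^ 2 - 4 * m / M ≤ _ by linarith [jp])) ((nee _).trans (emono fun w => (nee _).trans (emono fun ya => (nee _).trans (emono fun y => (norm_mul _ _).le))))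
  obtain ⟨w, hw⟩ := ege jg
  obtain ⟨ya, hy'⟩ := ege hw
  refine ⟨w - (ya:ℕ) • e, ?_, ?_⟩
  · intro hx
    rw [hx] at hy'
    simp at hy'
    nlinarith [pow_pos ja 2]
  · have := major_aux (ρ := ε ^ 4) (P := P) (by positivity) (by linarith) (M := M) (m := m) ?_ ?_ (by rw [← pow_mul]; exact hM)
      (fun y => Φ (w - y • e)) (fun y => a (w - y • e) * conj (a (w - (ya:ℕ) • e))) (fun y => nml (ha _) (ncl (ha _))) ya (Φ (w - (ya:ℕ) • e)) (le_trans ?_ hy')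
    · simpa only [← pow_mul] using this
    · refine le_trans ?_ jw
      rw [← pow_mul]
      exact mul_le_mul_of_nonneg_right (epl ja ho (by norm_num)) jc.le
    · have : (m:ℝ) ≤ M := jo.trans (mul_le_of_le_one_left jc.le (pow_le_one₀ ja.le (by linarith)))
      exact_mod_cast this
    · have := epm ja ho 2 2 (c := 4) (by norm_num)
      norm_num at this; linarith
end
section
variable {P : ℕ} [NeZero P] {H : Type}
theorem cube_zero (s : ℕ) (F : (Fin s → H) → ℂ) (u v : Fin s → H) (h : F u = 0) : cube s F u v = 0 := by
  induction s with
  | zero => rw [cube]; rw [← h]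
  | succ s ih => rw [cube]; apply ih; rw [Fin.cons_self_tail, h, zero_mul]
def acube : (s : ℕ) → ((Fin s → H) → ZMod P) → (Fin s → H) → (Fin s → H) → ZMod P
  | 0, ξ, u, _ => ξ u
  | s+1, ξ, u, v => acube s (fun h => ξ (Fin.cons (u 0) h) - ξ (Fin.cons (v 0) h)) (Fin.tail u) (Fin.tail v)
theorem cube_ch (s : ℕ) (ξ : (Fin s → H) → ZMod P) (t : ZMod P) (u v : Fin s → H) :
    cube s (fun h => ch (ξ h * t)) u v = ch (acube s ξ u v * t) := by
  induction s with
  | zero => rw [cube, acube, Subsingleton.elim u ![]]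
  | succ s ih => rw [cube, acube, ← ih]; simp only [sub_mul, ch_sub]
theorem acube_split (s : ℕ) (ξ : (Fin s → H) → ZMod P) (v : Fin s → H) : ∃ ψ : Fin s → (Fin s → H) → ZMod P,
    (∀ i h pm, (∀ j, j ≠ i → h j = pm j) → ψ i h = ψ i pm) ∧ ∀ u, acube s ξ u v = ξ u + ∑ i, ψ i u := by
  induction s with
  | zero => exact ⟨fun i => i.elim0, fun i => i.elim0, fun u => by simp [acube]⟩
  | succ s ih =>
    choose ψ ho jb using fun a : H => ih (fun h => ξ (Fin.cons a h) - ξ (Fin.cons (v 0) h)) (Fin.tail v)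
    refine ⟨Fin.cons (fun u => - ξ (Fin.cons (v 0) (Fin.tail u))) (fun i u => ψ (u 0) i (Fin.tail u)), ?_, ?_⟩
    · intro i h pm hh
      induction i using Fin.cases with
      | zero =>
        simp only [Fin.cons_zero]
        congr 3; ext i
        exact hh _ (Fin.succ_ne_zero i)
      | succ i =>
        simp only [Fin.cons_succ]
        rw [hh 0 (Fin.succ_ne_zero i).symm]
        apply ho
        intro j hj
        exact hh _ (fun e => hj (Fin.succ_injective _ e))
    · intro u
      rw [acube, jb, Fin.sum_univ_succ]
      simp only [Fin.cons_zero, Fin.cons_succ, Fin.cons_self_tail]; ring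
end
section
variable {P : ℕ} [NeZero P] {G : Type} [AddCommGroup G] [Fintype G] (γ : ZMod P →+ G) (e : G)
theorem Box_shift (l : List (ZMod P → ℝ)) (f : G → ℂ) (c : G) : Box γ l (fun x => f (x + c)) = Box γ l f := by
  induction l generalizing f with
  | nil => simp only [Box]; rw [eshift c f]
  | cons ν l ih =>
    simp only [Box]
    refine sum_congr rfl fun t _ => ?_
    rw [← ih (dd γ t f)]
    congr 2; ext x; simp only [dd]; rw [add_right_comm]
theorem nu_ap_le {J r : ℕ} (hJ : 0 < J) (hr : 0 < r) (h : r * J ≤ P) (t : ZMod P) :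
    nu (fun j : Fin J => (r : ZMod P) * ((j:ℕ) : ZMod P)) t ≤ ((P:ℝ) / J) / (Fintype.card (ZMod P) : ℝ) := by
  have : NeZero J := ⟨hJ.ne'⟩
  have hP : (0:ℝ) < P := Ppos
  rw [ZMod.card, div_div_cancel_left' hP.ne']
  unfold nu
  refine ele fun a => ?_
  rw [Fintype.expect_eq_sum_div_card, Fintype.card_fin, div_eq_mul_inv]
  refine mul_le_of_le_one_left (by positivity) ?_
  rw [← Finset.sum_filter, sum_const, nsmul_eq_mul, mul_one]
  have : #{b : Fin J | (r : ZMod P) * ((a:ℕ) : ZMod P) - r * ((b:ℕ) : ZMod P) = t} ≤ 1 := by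
    rw [card_le_one]
    intro b hb bf pp
    rw [mem_filter] at hb pp
    have ho : ((r * b : ℕ) : ZMod P) = ((r * bf : ℕ) : ZMod P) := by
      push_cast; linear_combination pp.2 - hb.2
    have hl : ∀ b : Fin J, r * (b:ℕ) < P := fun b => lt_of_lt_of_le (Nat.mul_lt_mul_of_pos_left b.2 hr) h
    rw [ZMod.natCast_eq_natCast_iff', Nat.mod_eq_of_lt (hl b), Nat.mod_eq_of_lt (hl bf)] at ho
    exact Fin.ext (Nat.eq_of_mul_eq_mul_left hr ho)
  exact Nat.cast_le_one.2 this
theorem removal {J r : ℕ} (hJ : 0 < J) (k : ZMod P → ℂ) (hk : ∀ t, ‖k t‖ ≤ 1) (Φ ψ : ZMod P) {κ : ℝ} (hκ : nn ((r : ZMod P) * Φ) ≤ κ) :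
    ‖𝔼 t, k t * ch ((Φ + ψ) * t)‖ ≤ 𝔼 t, ‖𝔼 j : Fin J, k (t + (r:ZMod P) * ((j:ℕ) : ZMod P)) * ch (ψ * ((r:ZMod P) * ((j:ℕ) : ZMod P)))‖ + 7 * J * κ := by
  have : NeZero J := ⟨hJ.ne'⟩
  have hκ0 := (nnn ((r : ZMod P) * Φ)).trans hκ
  have ea : 𝔼 t, k t * ch ((Φ + ψ) * t) = 𝔼 t, ch ((Φ + ψ) * t) * 𝔼 j : Fin J, k (t + (r:ZMod P) * ((j:ℕ) : ZMod P)) * ch (ψ * ((r:ZMod P) * ((j:ℕ) : ZMod P))) * ch (((j:ℕ) : ZMod P) * ((r:ZMod P) * Φ)) := by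
    simp_rw [mul_expect]
    rw [expect_comm]
    symm
    rw [← Fintype.expect_const (ι := Fin J) (𝔼 t, k t * ch ((Φ + ψ) * t))]
    refine expect_congr rfl fun j _ => ?_
    refine Eq.trans ?_ (eshift ((r:ZMod P) * ((j:ℕ) : ZMod P)) _)
    refine expect_congr rfl fun t _ => ?_
    rw [show (Φ + ψ) * (t + (r:ZMod P) * ((j:ℕ) : ZMod P)) = (Φ + ψ) * t + (ψ * ((r:ZMod P) * ((j:ℕ) : ZMod P)) + ((j:ℕ) : ZMod P) * ((r:ZMod P) * Φ)) by ring, ch_add, ch_add]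
    ring
  rw [ea]
  refine (nee _).trans ?_
  rw [← Fintype.expect_const (ι := ZMod P) (7 * (J:ℝ) * κ), ← expect_add_distrib]
  refine emono fun t => ?_
  rw [norm_mul, chn, one_mul]
  have ho : ‖𝔼 j : Fin J, k (t + (r:ZMod P) * ((j:ℕ) : ZMod P)) * ch (ψ * ((r:ZMod P) * ((j:ℕ) : ZMod P))) - 𝔼 j : Fin J, k (t + (r:ZMod P) * ((j:ℕ) : ZMod P)) * ch (ψ * ((r:ZMod P) * ((j:ℕ) : ZMod P))) * ch (((j:ℕ) : ZMod P) * ((r:ZMod P) * Φ))‖ ≤ 7 * J * κ := by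
    rw [← expect_sub_distrib]
    refine nel fun j => ?_
    rw [← mul_one_sub, norm_mul]
    refine (mul_le_of_le_one_left (norm_nonneg _) (nml (hk _) (chn _).le)).trans ((ch_dist _).1.trans ?_)
    have jb := nn_nat_mul (j:ℕ) ((r:ZMod P) * Φ)
    have jd : ((j:ℕ):ℝ) ≤ J := by exact_mod_cast j.2.le
    rw [mul_assoc]
    gcongr
    exact jb.trans (mul_le_mul jd hκ (nnn _) (by positivity))
  rw [norm_sub_rev] at ho
  have := norm_sub_norm_le (𝔼 j : Fin J, k (t + (r:ZMod P) * ((j:ℕ) : ZMod P)) * ch (ψ * ((r:ZMod P) * ((j:ℕ) : ZMod P))) * ch (((j:ℕ) : ZMod P) * ((r:ZMod P) * Φ))) (𝔼 j : Fin J, k (t + (r:ZMod P) * ((j:ℕ) : ZMod P)) * ch (ψ * ((r:ZMod P) * ((j:ℕ) : ZMod P))))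
  linarith
theorem KM_ex : ∃ K : ℕ, K = 19600 := ⟨_, rfl⟩
noncomputable def KM : ℕ := Classical.choose KM_ex
theorem KM_eq : KM = 19600 := Classical.choose_spec KM_ex
theorem maj_bound {ρ : ℝ} (ja : 0 < ρ) (ho : ρ ≤ 1/2) {M : ℕ} (hM : 1 ≤ ρ ^ KM * M) (c qb qa : G → ℂ) (hc : ∀ x, ‖c x‖ ≤ 1)
    (hQ0 : ∀ x, ‖qb x‖ ≤ 1) (hQ1 : ∀ x, ‖qa x‖ ≤ 1) (Φ : G → ZMod P) :
    ‖𝔼 x, 𝔼 t, 𝔼 y : Fin M, c x * (qb (x + γ t - γ (((y:ℕ):ZMod P) ^ 2)) * qa (x + γ t - γ (((y:ℕ):ZMod P) ^ 2) + (y:ℕ) • e)) * ch (Φ x * t)‖ ≤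
    ρ + 𝔼 x, ind (∃ r : ℕ, 0 < r ∧ r * ρ ^ KM ≤ 1 ∧ c x ≠ 0 ∧ nn ((r : ZMod P) * Φ x) * (ρ ^ KM * M ^ 2) ≤ 1) := by
  rw [KM_eq] at hM ⊢
  have jc : (0:ℝ) < M := szp ja hM
  have : NeZero M := ⟨by rintro rfl; simp at jc⟩
  set mj : G → Prop := fun x => ∃ r : ℕ, 0 < r ∧ r * ρ ^ 19600 ≤ 1 ∧ c x ≠ 0 ∧ nn ((r : ZMod P) * Φ x) * (ρ ^ 19600 * M ^ 2) ≤ 1 with hmj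
  have ea : 𝔼 x, 𝔼 t, 𝔼 y : Fin M, c x * (qb (x + γ t - γ (((y:ℕ):ZMod P) ^ 2)) * qa (x + γ t - γ (((y:ℕ):ZMod P) ^ 2) + (y:ℕ) • e)) * ch (Φ x * t) =
    𝔼 t, 𝔼 x, 𝔼 y : Fin M, (c x * qb (x + γ t) * ch (Φ x * t)) * qa (x + (y:ℕ) • e + γ t) * ch (Φ x * ((y:ℕ):ZMod P) ^ 2) := by
    rw [expect_comm (s := (univ : Finset (ZMod P)))]
    refine expect_congr rfl fun x _ => ?_
    rw [expect_comm, expect_comm (t := (univ : Finset (Fin M)))]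
    refine expect_congr rfl fun y _ => ?_
    refine Eq.trans (eshift (((y:ℕ):ZMod P) ^ 2) _).symm ?_
    refine expect_congr rfl fun t _ => ?_
    rw [map_add, ← add_assoc, add_sub_cancel_right, mul_add, ch_add, add_right_comm x]; ring
  rw [ea]
  refine nel fun t => ?_
  classical
  set a : G → ℂ := fun x => c x * qb (x + γ t) * ch (Φ x * t) with ha
  have jt : ∀ x, ‖a x‖ ≤ 1 := fun x => nml (nml (hc _) (hQ0 _)) (chn _).le
  have eb : 𝔼 x, 𝔼 y : Fin M, a x * qa (x + (y:ℕ) • e + γ t) * ch (Φ x * ((y:ℕ):ZMod P) ^ 2) =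
    𝔼 x, 𝔼 y : Fin M, (if mj x then 0 else a x) * qa (x + (y:ℕ) • e + γ t) * ch (Φ x * ((y:ℕ):ZMod P) ^ 2) +
    𝔼 x, 𝔼 y : Fin M, (if mj x then a x else 0) * qa (x + (y:ℕ) • e + γ t) * ch (Φ x * ((y:ℕ):ZMod P) ^ 2) := by
    rw [← expect_add_distrib]
    refine expect_congr rfl fun x _ => ?_
    rw [← expect_add_distrib]
    refine expect_congr rfl fun y _ => ?_
    split_ifs <;> ring
  rw [eb]
  refine (norm_add_le _ _).trans (add_le_add ?_ ?_)
  · by_contra hcon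
    obtain ⟨x, hx, r, hr, jn, jk⟩ := major ja ho hM e (fun x => if mj x then 0 else a x) (fun x => qa (x + γ t)) (fun x => by
      split_ifs
      · simp
      · exact jt x) (fun x => hQ1 _) Φ (not_le.1 hcon).le
    by_cases hm : mj x
    · simp [hm] at hx
    · simp only [hm, if_false] at hx
      refine hm ⟨r, hr, jn, ?_, jk⟩
      intro h; apply hx; simp [ha, h]
  · refine (nee _).trans (emono fun x => ?_)
    by_cases hm : mj x
    · rw [indt hm]
      refine neo fun y => nml (nml ?_ (hQ1 _)) (chn _).le
      rw [if_pos hm]; exact jt x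
    · rw [indf hm]; simp [hm]
end
theorem sel {ι : Type} [Fintype ι] [Nonempty ι] (I : ι → ℂ) (hI : ∀ i, ‖I i‖ ≤ 1) {ε : ℝ} (ja : 0 ≤ ε) (h : ε ≤ 𝔼 i, ‖I i‖ ^ 2) :
    ∃ c : ι → ℂ, (∀ i, ‖c i‖ ≤ 1) ∧ (∀ i, c i ≠ 0 → ε / 2 ≤ ‖I i‖ ^ 2) ∧ ε / 2 ≤ ‖𝔼 i, c i * I i‖ := by
  classical
  refine ⟨fun i => if ε / 2 ≤ ‖I i‖ ^ 2 then conj (I i) else 0, fun i => ?_, fun i hi => ?_, ?_⟩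
  · dsimp only; split_ifs
    · exact ncl (hI i)
    · simp
  · by_contra hc; simp [hc] at hi
  · refine le_trans ?_ (Complex.re_le_norm _)
    rw [re_expect]
    have : 𝔼 i, ‖I i‖ ^ 2 ≤ 𝔼 i, (((if ε / 2 ≤ ‖I i‖ ^ 2 then conj (I i) else 0) * I i).re + ε / 2) := by
      refine emono fun i => ?_
      rw [norm_sq_re]
      split_ifs with hc
      · rw [mul_comm]; linarith
      · rw [← norm_sq_re] at hc ⊢; rw [zero_mul, Complex.zero_re]; linarith
    rw [expect_add_distrib, Fintype.expect_const] at this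
    linarith
section
variable {P : ℕ} [NeZero P] {G : Type} [AddCommGroup G] [Fintype G] (γ : ZMod P →+ G) (e : G)
noncomputable def FF (M : ℕ) (fb fa : G → ℂ) (x : G) : ℂ :=
  𝔼 y : Fin M, fb (x - γ (((y:ℕ):ZMod P) ^ 2)) * fa (x - γ (((y:ℕ):ZMod P) ^ 2) + (y:ℕ) • e)
theorem FF_bdd {M : ℕ} {fb fa : G → ℂ} (ja : ∀ x, ‖fb x‖ ≤ 1) (ho : ∀ x, ‖fa x‖ ≤ 1) (x : G) : ‖FF γ e M fb fa x‖ ≤ 1 :=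
  neo fun _ => nml (ja _) (ho _)
theorem dl1 (s : ℕ) {ε ρ : ℝ} (ja : 0 < ε) (ho : ε ≤ 1/2) (hρ : ρ = ε ^ (2 ^ (s+2) + 1)) {M : ℕ} (hM : 1 ≤ ρ ^ KM * M)
    (fb fa : G → ℂ) (jh : ∀ x, ‖fb x‖ ≤ 1) (jj : ∀ x, ‖fa x‖ ≤ 1) (ξ : (Fin (s+1) → ZMod P) → G → ZMod P)
    (hξ : ε ≤ 𝔼 h, 𝔼 x, ‖𝔼 t, Dl γ (s+1) h (FF γ e M fb fa) (x + γ t) * ch (ξ h x * t)‖ ^ 2) :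
    ∃ v, ρ ≤ 𝔼 u : (Fin (s+1) → ZMod P) × G, ind (∃ r : ℕ, 0 < r ∧ r * ρ ^ KM ≤ 1 ∧
      (ε / 2 ≤ ‖𝔼 t, Dl γ (s+1) u.1 (FF γ e M fb fa) (u.2 + γ t) * ch (ξ u.1 u.2 * t)‖ ^ 2 ∧
      nn ((r : ZMod P) * acube (s+1) (fun h => ξ h u.2) u.1 v) * (ρ ^ KM * M ^ 2) ≤ 1)) := by
  have hρ0 : 0 < ρ := by rw [hρ]; positivity
  have hρ1 : ρ ≤ 1/2 := by
    rw [hρ]; refine (epl ja ho (Nat.le_add_left 1 _)).trans (by simpa using ho)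
  obtain ⟨c, kw, kx, ky⟩ := sel (fun u : (Fin (s+1) → ZMod P) × G => 𝔼 t, Dl γ (s+1) u.1 (FF γ e M fb fa) (u.2 + γ t) * ch (ξ u.1 u.2 * t))
    (fun u => neo fun t => nml (Dl_bdd γ _ _ _ (FF_bdd γ e jh jj) _) (chn _).le) ja.le (by rw [eprod]; exact hξ)
  obtain ⟨B, kn, jz, ko⟩ := Dl_factor γ (s+1) (FF γ e M fb fa) (FF_bdd γ e jh jj)
  set Gf : G × ZMod P × Fin M → (Fin (s+1) → ZMod P) → ℂ := fun X h =>
    c (h, X.1) * (fb (X.1 + γ X.2.1 - γ (((X.2.2:ℕ):ZMod P) ^ 2) + γ (∑ i, h i)) * fa (X.1 + γ X.2.1 - γ (((X.2.2:ℕ):ZMod P) ^ 2) + (X.2.2:ℕ) • e + γ (∑ i, h i))) *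
      ch (ξ h X.1 * X.2.1) with hGf
  have ea : 𝔼 u : (Fin (s+1) → ZMod P) × G, c u * 𝔼 t, Dl γ (s+1) u.1 (FF γ e M fb fa) (u.2 + γ t) * ch (ξ u.1 u.2 * t) =
      𝔼 X : G × ZMod P × Fin M, 𝔼 h, (∏ i, B i (X.1 + γ X.2.1) h) * Gf X h := by
    rw [eprod, expect_comm, eprod]
    refine expect_congr rfl fun x _ => ?_
    simp_rw [mul_expect]
    rw [expect_comm, eprod]
    refine expect_congr rfl fun t _ => ?_
    dsimp only
    rw [expect_comm (s := (univ : Finset (Fin M)))]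
    refine expect_congr rfl fun h _ => ?_
    rw [ko]
    simp only [hGf, FF]
    rw [mul_expect, expect_mul, mul_expect]
    refine expect_congr rfl fun y _ => ?_
    rw [show x + γ t + γ (∑ i, h i) - γ (((y:ℕ):ZMod P) ^ 2) = x + γ t - γ (((y:ℕ):ZMod P) ^ 2) + γ (∑ i, h i) by abel, add_right_comm _ ((y:ℕ) • e)]
    ring
  have hb := boxCS s (fun i (X : G × ZMod P × Fin M) h => B i (X.1 + γ X.2.1) h) (fun i X h => kn _ _ _) (fun i X h pm hh => jz _ _ _ _ hh) Gf
  rw [← ea] at hb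
  have eb : 𝔼 X, 𝔼 u, 𝔼 v, cube (s+1) (Gf X) u v = 𝔼 v, 𝔼 u, 𝔼 x, 𝔼 t, 𝔼 y : Fin M,
      cube (s+1) (fun h => c (h, x)) u v * ((fun w => cube (s+1) (fun h => fb (w + γ (∑ i, h i))) u v) (x + γ t - γ (((y:ℕ):ZMod P) ^ 2)) *
      (fun w => cube (s+1) (fun h => fa (w + γ (∑ i, h i))) u v) (x + γ t - γ (((y:ℕ):ZMod P) ^ 2) + (y:ℕ) • e)) * ch (acube (s+1) (fun h => ξ h x) u v * t) := by
    rw [expect_comm]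
    simp_rw [expect_comm (s := (univ : Finset (G × ZMod P × Fin M)))]
    rw [expect_comm]
    refine expect_congr rfl fun v _ => expect_congr rfl fun u _ => ?_
    rw [eprod]
    refine expect_congr rfl fun x _ => ?_
    rw [eprod]
    refine expect_congr rfl fun t _ => expect_congr rfl fun y _ => ?_
    simp only [hGf, cube_mul, cube_ch]
  rw [eb] at hb
  have ku := hb.trans ((Complex.re_le_norm _).trans (nee _))
  have hb3 : (ε/2) ^ (2 ^ (s+1)) ≤ _ := (pow_le_pow_left₀ (by positivity) ky _).trans ku
  obtain ⟨v, hv⟩ := ege hb3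
  refine ⟨v, ?_⟩
  have hmb := fun u => maj_bound γ e hρ0 hρ1 hM (fun x => cube (s+1) (fun h => c (h, x)) u v) (fun w => cube (s+1) (fun h => fb (w + γ (∑ i, h i))) u v)
    (fun w => cube (s+1) (fun h => fa (w + γ (∑ i, h i))) u v)
    (fun x => cube_bdd _ _ (fun h => kw _) _ _) (fun x => cube_bdd _ _ (fun h => jh _) _ _) (fun x => cube_bdd _ _ (fun h => jj _) _ _) (fun x => acube (s+1) (fun h => ξ h x) u v)
  have hv2 := hv.trans ((nee _).trans (emono hmb))
  rw [expect_add_distrib, Fintype.expect_const] at hv2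
  have jb : 2 * ρ ≤ (ε/2) ^ (2 ^ (s+1)) := by
    have := epm ja ho (2 ^ (s+2)) 1 (c := 2) (by norm_num)
    rw [hρ]
    refine this.trans ?_
    rw [pow_succ 2 (s+1), mul_comm, pow_mul]
    refine pow_le_pow_left₀ (by positivity) (by nlinarith) _
  rw [eprod]
  refine le_trans (by linarith : ρ ≤ _) (emono fun u => emono fun x => ind_mono ?_)
  rintro ⟨r, ji, jn, jk, kd⟩
  refine ⟨r, ji, jn, kx (u, x) ?_, kd⟩
  intro hh; exact jk (cube_zero _ _ _ _ hh)
theorem dl2 (s : ℕ) {η : ℝ} (hη : 0 ≤ η) {J r : ℕ} (hJ : 0 < J) (hr : 0 < r) (hrJ : r * J ≤ P) (F : G → ℂ) (hF : ∀ x, ‖F x‖ ≤ 1)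
    (ψ : Fin (s+1) → G → (Fin (s+1) → ZMod P) → ZMod P) (hψ : ∀ i x h pm, (∀ j, j ≠ i → h j = pm j) → ψ i x h = ψ i x pm)
    (h : η ≤ 𝔼 u, 𝔼 x, 𝔼 t, ‖𝔼 j : Fin J, Dl γ (s+1) u F (x + γ t + γ ((r:ZMod P) * ((j:ℕ) : ZMod P))) * ch ((∑ i, ψ i x u) * ((r:ZMod P) * ((j:ℕ) : ZMod P)))‖ ^ 2) :
    η ^ (2 ^ (s+1)) ≤ (P:ℝ) / J * Box γ (List.replicate (s+2) full) F := by
  have : NeZero J := ⟨hJ.ne'⟩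
  obtain ⟨B, kn, jz, ko⟩ := Dl_factor γ (s+1) F hF
  set p : Fin J → ZMod P := fun j => (r:ZMod P) * ((j:ℕ) : ZMod P) with hp
  have ea : 𝔼 u, 𝔼 x, 𝔼 t, ‖𝔼 j : Fin J, Dl γ (s+1) u F (x + γ t + γ (p j)) * ch ((∑ i, ψ i x u) * p j)‖ ^ 2 =
    (𝔼 t, 𝔼 j, 𝔼 pl, 𝔼 x, 𝔼 u, (∏ i, (B i (x + γ t + γ (p j)) u * conj (B i (x + γ t + γ (p pl)) u) * ch (ψ i x u * (p j - p pl)))) *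
      (fun z => dd γ (p j - p pl) F (z + (γ t + γ (p pl)))) (x + γ (∑ i, (fun _ a => a) i (u i)))).re := by
    simp_rw [nse]
    simp only [re_expect]
    have sw : ∀ f : (Fin (s+1) → ZMod P) → G → ZMod P → Fin J → Fin J → ℝ, 𝔼 u, 𝔼 x, 𝔼 t, 𝔼 j, 𝔼 pl, f u x t j pl = 𝔼 t, 𝔼 j, 𝔼 pl, 𝔼 x, 𝔼 u, f u x t j pl := by
      intro f
      rw [expect_comm]
      simp_rw [expect_comm (s := (univ : Finset (Fin (s+1) → ZMod P)))]
      rw [expect_comm]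
      simp_rw [expect_comm (s := (univ : Finset G))]
    rw [sw]
    refine expect_congr rfl fun t _ => expect_congr rfl fun j _ => expect_congr rfl fun pl _ => expect_congr rfl fun x _ => expect_congr rfl fun u _ => ?_
    congr 1
    rw [ko, ko, prod_mul_distrib, prod_mul_distrib, sum_mul, sum_mul]
    have hs : ∀ g : Fin (s+1) → ZMod P, ch (∑ i, g i) = ∏ i, ch (g i) := fun g => by
      induction (univ : Finset (Fin (s+1))) using Finset.induction_on with
      | empty => simp [ch_zero]
      | insert a t ha ih => rw [sum_insert ha, prod_insert ha, ch_add, ih]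
    simp only [hs, mul_sub, ch_sub, dd, map_mul, map_prod, prod_mul_distrib, map_sub]
    rw [show x + γ (∑ i, u i) + (γ t + γ (p pl)) + (γ (p j) - γ (p pl)) = x + γ t + γ (p j) + γ (∑ i, u i) by abel,
      show x + γ (∑ i, u i) + (γ t + γ (p pl)) = x + γ t + γ (p pl) + γ (∑ i, u i) by abel]
    ring
  rw [ea] at h
  have jb := pow_le_pow_left₀ hη (h.trans (Complex.re_le_norm _)) (2 ^ (s+1))
  have jd : ∀ t j pl, ‖𝔼 x, 𝔼 u, (∏ i, (B i (x + γ t + γ (p j)) u * conj (B i (x + γ t + γ (p pl)) u) * ch (ψ i x u * (p j - p pl)))) *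
      (fun z => dd γ (p j - p pl) F (z + (γ t + γ (p pl)))) (x + γ (∑ i, (fun _ a => a) i (u i)))‖ ^ (2 ^ (s+1)) ≤ Box γ (List.replicate (s+1) full) (dd γ (p j - p pl) F) := by
    intro t j pl
    refine (boxCS_G γ s (fun i x u => B i (x + γ t + γ (p j)) u * conj (B i (x + γ t + γ (p pl)) u) * ch (ψ i x u * (p j - p pl))) (fun i x u => ?_) (fun i x u ub hu => ?_) (fun _ a => a) (fun z => dd γ (p j - p pl) F (z + (γ t + γ (p pl))))).trans (le_of_eq ?_)
    · exact nml (nml (kn _ _ _) (ncl (kn _ _ _))) (chn _).le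
    · rw [jz i _ u ub hu, jz i _ u ub hu, hψ i x u ub hu]
    · rw [Box_shift, ← full_eq, List.ofFn_const]
  have je : η ^ (2 ^ (s+1)) ≤ 𝔼 t : ZMod P, 𝔼 j, 𝔼 pl, Box γ (List.replicate (s+1) full) (dd γ (p j - p pl) F) := by
    refine jb.trans ((npe (s+1) _).trans (emono fun t => (npe (s+1) _).trans (emono fun j => (npe (s+1) _).trans (emono fun pl => jd t j pl))))
  rw [Fintype.expect_const, ← Box_nu] at je
  refine je.trans ?_
  rw [List.replicate_succ (n := s+1)]
  exact Box_dom γ (nu_ap_le hJ hr hrJ) _ (fun ν hν => by rw [List.eq_of_mem_replicate hν]; exact isNu_full) (by simp) F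
end
theorem exists_J {ε : ℝ} (ja : 0 < ε) (ho : ε ≤ 1/2) (b : ℕ) {M P r : ℕ} (hP : P = 16 * M ^ 2) (hM : 1 ≤ ε ^ (b + 8) * M) (hr : r * ε ^ b ≤ 1) :
    ∃ J : ℕ, 0 < J ∧ r * J ≤ P ∧ 7 * J * (1 / (ε ^ b * M ^ 2)) ≤ ε ^ 5 ∧ ε ^ (b + 13) * ((P:ℝ) / J) ≤ 1 ∧ ε ^ (b + 9) * M ^ 2 ≤ J := by
  have jc : (0:ℝ) < M := szp ja hM
  have jy : (1:ℝ) ≤ M := by exact_mod_cast jc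
  have hb : 0 < ε ^ b := by positivity
  have kb : ε ^ (b+8) = ε ^ b * ε ^ 8 := pow_add _ _ _
  obtain ⟨J, hJ, kf, jv⟩ := xlen ja ho (b+8) (M := (M:ℝ)^2) (hM.trans (by
    refine mul_le_mul_of_nonneg_left ?_ (by positivity); nlinarith))
  refine ⟨J, hJ, ?_, ?_, ?_, jv⟩
  · have : (r:ℝ) * J ≤ 16 * M ^ 2 := by
      calc (r:ℝ) * J ≤ r * (ε ^ b * ε ^ 8 * M ^ 2) := by rw [← kb]; gcongr
        _ = (r * ε ^ b) * (ε ^ 8 * M ^ 2) := by ring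
        _ ≤ 1 * (1 * M ^ 2) := by
          gcongr
          exact pow_le_one₀ ja.le (by linarith)
        _ ≤ _ := by nlinarith
    rw [hP]; exact_mod_cast this
  · have : (J:ℝ) * (1 / (ε ^ b * M ^ 2)) ≤ ε ^ 8 := by
      rw [mul_one_div, div_le_iff₀ (by positivity)]
      rw [kb] at kf; linarith
    have jp := epm ja ho 5 3 (c := 7) (by norm_num)
    norm_num at jp
    rw [mul_assoc]; linarith
  · rw [← mul_div_assoc, div_le_one (by exact_mod_cast hJ), hP]
    push_cast
    refine le_trans ?_ jv
    have := epm ja ho (b+9) 4 (c := 16) (by norm_num)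
    rw [show b + 9 + 4 = b + 13 by ring] at this
    nlinarith [sq_nonneg (M:ℝ)]
theorem dl (s : ℕ) : ∃ K : ℕ, ∀ {G : Type} [AddCommGroup G] [Fintype G] {M P : ℕ} [NeZero P] (γ : ZMod P →+ G) (e : G) {ε : ℝ},
    0 < ε → ε ≤ 1/2 → P = 16 * M ^ 2 → 1 ≤ ε ^ K * M → ∀ fb fa : G → ℂ, (∀ x, ‖fb x‖ ≤ 1) → (∀ x, ‖fa x‖ ≤ 1) →
    ε ≤ Box γ (List.replicate (s+3) full) (FF γ e M fb fa) → ε ^ K ≤ Box γ (List.replicate (s+2) full) (FF γ e M fb fa) := by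
  obtain ⟨L, hL⟩ : ∃ L, L = 2 ^ (s+2) + 1 := ⟨_, rfl⟩
  obtain ⟨b, hb⟩ : ∃ b, b = L * KM := ⟨_, rfl⟩
  refine ⟨(6 + (L + b)) * 2 ^ (s+1) + (b + 13), ?_⟩
  intro G _ _ M P _ γ e ε ja ho hP hM fb fa jh jj h
  have jc : (0:ℝ) < M := szp ja hM
  have hF := FF_bdd γ e (M := M) jh jj
  set F := FF γ e M fb fa with hFd
  rw [List.replicate_add (s+1) 2, Box_rep] at h
  choose ξ hξ using fun h => u2_inv γ (Dl γ (s+1) h F) (Dl_bdd γ (s+1) h F hF)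
  have hρ : (ε ^ L) ^ KM = ε ^ b := by rw [hb, pow_mul]
  obtain ⟨v, hv⟩ := dl1 γ e s ja ho (ρ := ε ^ L) (by rw [hL]) (M := M) (by rw [hρ]; exact szm ja ho (by omega) jc.le hM) fb fa jh jj ξ (h.trans (emono hξ))
  rw [hρ] at hv
  obtain ⟨r, ji, jn, jk⟩ := pigeon_r _ (by positivity) (by positivity) hv
  obtain ⟨J, hJ, hrJ, kf, jv, _⟩ := exists_J ja ho b hP (szm ja ho (by omega) jc.le hM) jn
  choose ψ hψ1 hψ2 using fun x : G => acube_split (s+1) (fun h => ξ h x) v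
  have key : ε ^ 6 * (ε ^ L * ε ^ b) ≤ 𝔼 u, 𝔼 x, 𝔼 t, ‖𝔼 j : Fin J, Dl γ (s+1) u F (x + γ t + γ ((r:ZMod P) * ((j:ℕ) : ZMod P))) * ch ((∑ i, (fun i x u => - ψ x i u) i x u) * ((r:ZMod P) * ((j:ℕ) : ZMod P)))‖ ^ 2 := by
    refine (mul_le_mul_of_nonneg_left jk (by positivity)).trans ?_
    rw [mul_expect, eprod]
    refine emono fun u => emono fun x => ?_
    dsimp only
    by_cases hp : ε / 2 ≤ ‖𝔼 t, Dl γ (s+1) u F (x + γ t) * ch (ξ u x * t)‖ ^ 2 ∧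
      nn ((r : ZMod P) * acube (s+1) (fun h => ξ h x) u v) * (ε ^ b * M ^ 2) ≤ 1
    · rw [indt hp, mul_one]
      refine le_trans ?_ (sq_expect_le _)
      have hrm := removal (P := P) (r := r) hJ (fun t => Dl γ (s+1) u F (x + γ t)) (fun t => Dl_bdd γ (s+1) u F hF _) (acube (s+1) (fun h => ξ h x) u v) (∑ i, - ψ x i u)
        (κ := 1 / (ε ^ b * M ^ 2)) (by rw [le_div_iff₀ (by positivity)]; exact hp.2)
      have ea : acube (s+1) (fun h => ξ h x) u v + ∑ i, - ψ x i u = ξ u x := by rw [hψ2, sum_neg_distrib, add_neg_cancel_right]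
      rw [ea] at hrm
      simp only [map_add, ← add_assoc] at hrm
      have hI : ‖𝔼 t, Dl γ (s+1) u F (x + γ t) * ch (ξ u x * t)‖ ≤ 1 :=
        neo fun t => nml (Dl_bdd γ (s+1) u F hF _) (chn _).le
      have jl : ε / 2 ≤ ‖𝔼 t, Dl γ (s+1) u F (x + γ t) * ch (ξ u x * t)‖ := hp.1.trans (by nlinarith [norm_nonneg (𝔼 t, Dl γ (s+1) u F (x + γ t) * ch (ξ u x * t))])
      have jp := epm ja ho 1 4 (c := 16) (by norm_num)
      have kb := epm ja ho 1 2 (c := 4) (by norm_num)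
      norm_num at jp kb
      rw [show ε ^ 6 = (ε ^ 3) ^ 2 by ring]
      refine pow_le_pow_left₀ (by positivity) ?_ 2
      linarith
    · rw [indf hp, mul_zero]
      exact expect_nn fun t => by positivity
  have hd := dl2 γ s (by positivity) hJ ji hrJ F hF (fun i x u => - ψ x i u) (fun i x u ub hu => by rw [hψ1 x i u ub hu]) key
  rw [← pow_add, ← pow_add, ← pow_mul] at hd
  have hB := Boxn γ (List.replicate (s+2) full) (fun ν hν => by rw [List.eq_of_mem_replicate hν]; exact isNu_full) (by simp) F
  rw [pow_add, mul_comm]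
  calc _ ≤ ε ^ (b + 13) * ((P:ℝ) / J * Box γ (List.replicate (s+2) full) F) := by gcongr
    _ = (ε ^ (b + 13) * ((P:ℝ) / J)) * Box γ (List.replicate (s+2) full) F := by ring
    _ ≤ _ := mul_le_of_le_one_left hB jv
theorem phase (z : ℂ) : ∃ w : ℂ, ‖w‖ ≤ 1 ∧ w * z = ‖z‖ := by
  by_cases hz : z = 0
  · exact ⟨0, by simp, by simp [hz]⟩
  · refine ⟨conj z / ‖z‖, ?_, ?_⟩
    · rw [norm_div, RCLike.norm_conj]; simp [hz]
    · have : (‖z‖:ℂ) ≠ 0 := by simpa using hz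
      rw [div_mul_eq_mul_div, mul_comm, Complex.mul_conj, div_eq_iff this, Complex.normSq_eq_norm_sq]
      push_cast; ring
theorem eps_half {ε : ℝ} (ja : 0 < ε) (ho : ε ≤ 1/2) (n : ℕ) : ε ^ (n+1) ≤ 1/2 := by
  simpa using (epl ja ho (Nat.le_add_left 1 n)).trans (by simpa using ho)
section
variable {G : Type} [AddCommGroup G] [Fintype G]
theorem smooth (d : G) {J : ℕ} (hJ : 0 < J) (F : G → ℂ) {η : ℝ} (h : η ≤ 𝔼 x, ‖𝔼 j : Fin J, F (x + (j:ℕ) • d)‖) :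
    ∃ φ : G → ℂ, (∀ x, ‖φ x‖ ≤ 1) ∧ (∀ x, ‖φ (x + d) - φ x‖ ≤ 2 / J) ∧ η ≤ ‖𝔼 x, F x * φ x‖ := by
  have : NeZero J := ⟨hJ.ne'⟩
  choose g kz hg2 using fun x => phase (𝔼 j : Fin J, F (x + (j:ℕ) • d))
  refine ⟨fun x => 𝔼 j : Fin J, g (x - (j:ℕ) • d), fun x => neo fun j => kz _, fun x => ?_, ?_⟩
  · dsimp only
    rw [Fintype.expect_eq_sum_div_card, Fintype.expect_eq_sum_div_card, Fintype.card_fin, ← sub_div, norm_div, Complex.norm_natCast]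
    gcongr
    rw [← sum_sub_distrib, Fin.sum_univ_eq_sum_range (fun j => g (x + d - j • d) - g (x - j • d))]
    have ea : ∀ j, g (x + d - j • d) - g (x - j • d) = (fun j => - g (x + d - j • d)) (j+1) - (fun j => - g (x + d - j • d)) j := fun j => by
      simp only [succ_nsmul]; rw [show x + d - (j • d + d) = x - j • d by abel]; ring
    rw [sum_congr rfl (fun j _ => ea j), Finset.sum_range_sub (fun j => - g (x + d - j • d)) J]
    refine (norm_sub_le _ _).trans ?_
    rw [norm_neg, norm_neg]; linarith [kz (x + d - J • d), kz (x + d - 0 • d)]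
  · refine h.trans (le_trans (le_of_eq ?_) (Complex.re_le_norm _))
    simp_rw [mul_expect]
    rw [expect_comm]
    have : ∀ j : Fin J, 𝔼 x, F x * g (x - (j:ℕ) • d) = 𝔼 x, g x * F (x + (j:ℕ) • d) := fun j => by
      rw [← eshift ((j:ℕ) • d)]; refine expect_congr rfl fun x _ => ?_; rw [add_sub_cancel_right, mul_comm]
    simp_rw [this]
    rw [expect_comm]
    simp_rw [← mul_expect, hg2]
    rw [re_expect]; simp
end
section
variable {P : ℕ} [NeZero P] {G : Type} [AddCommGroup G] [Fintype G] (γ : ZMod P →+ G) (e : G)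
theorem TT_FF {M : ℕ} (fb fa fc : G → ℂ) : TT γ e M fb fa fc = 𝔼 x, fc x * FF γ e M fb fa x := by
  unfold TT FF
  simp_rw [mul_expect]
  rw [expect_comm, expect_comm (s := (univ : Finset G))]
  refine expect_congr rfl fun y _ => ?_
  rw [← eshift (γ (((y:ℕ):ZMod P) ^ 2)) (fun x => fc x * _)]
  refine expect_congr rfl fun x _ => ?_
  rw [add_sub_cancel_right]; ring
theorem dual_sq {M : ℕ} {fb fa fc : G → ℂ} {ε : ℝ} (ja : 0 ≤ ε) (kg : ∀ x, ‖fc x‖ ≤ 1) (h : ε ≤ ‖TT γ e M fb fa fc‖) :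
    ε ^ 2 ≤ ‖TT γ e M (fun x => conj (fb x)) (fun x => conj (fa x)) (FF γ e M fb fa)‖ := by
  rw [TT_FF] at h ⊢
  have jb := (pow_le_pow_left₀ ja h 2).trans (cs_kill fc _ kg)
  refine jb.trans (le_trans (le_of_eq ?_) (Complex.re_le_norm _))
  rw [re_expect]
  refine expect_congr rfl fun x _ => ?_
  rw [norm_sq_re]
  congr 2
  simp only [FF, conj_expect, map_mul]
end
theorem boxFF : ∃ K : ℕ, ∀ {G : Type} [AddCommGroup G] [Fintype G] {M P : ℕ} [NeZero P] (γ : ZMod P →+ G) (e : G) {ε : ℝ},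
    0 < ε → ε ≤ 1/2 → P = 16 * M ^ 2 → 1 ≤ ε ^ K * M → ∀ fb fa fc : G → ℂ, (∀ x, ‖fb x‖ ≤ 1) → (∀ x, ‖fa x‖ ≤ 1) → (∀ x, ‖fc x‖ ≤ 1) →
    ε ≤ ‖TT γ e M fb fa fc‖ → ε ^ K ≤ Box γ [full, full] (FF γ e M fb fa) := by
  obtain ⟨kp, kc⟩ := L6
  obtain ⟨ka, jr⟩ := dl 2
  obtain ⟨K2, hK2⟩ := dl 1
  obtain ⟨K3, hK3⟩ := dl 0
  obtain ⟨nb, ju⟩ : ∃ n, n = 2 * kp + 1 := ⟨_, rfl⟩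
  obtain ⟨nc, kk⟩ : ∃ n, n = nb * ka + 1 := ⟨_, rfl⟩
  obtain ⟨na, kl⟩ : ∃ n, n = nc * K2 + 1 := ⟨_, rfl⟩
  refine ⟨na * K3 + na + nc + nb, ?_⟩
  intro G _ _ M P _ γ e ε ja ho hP hM fb fa fc jh jj kg h
  have jc : (0:ℝ) < M := szp ja hM
  have st : ∀ (n k : ℕ) (B : ℝ), (ε ^ n) ^ k ≤ B → ε ^ (n * k + 1) ≤ B := fun n k B hB => (epl ja ho (Nat.le_succ _)).trans (by rwa [pow_mul])
  have sz : ∀ n k, n * k ≤ na * K3 + na + nc + nb → 1 ≤ (ε ^ n) ^ k * M := fun n k hk => by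
    rw [← pow_mul]; exact szm ja ho hk jc.le hM
  have hF := FF_bdd γ e (M := M) jh jj
  have bc := st _ _ _ (kc γ e (ε := ε ^ 2) (by positivity) (eps_half ja ho 1) hP (sz _ _ (by omega)) _ _ _ (fun x => ncl (jh x)) (fun x => ncl (jj x)) hF (dual_sq γ e ja.le kg h))
  rw [← ju] at bc
  have ba := st _ _ _ (jr γ e (ε := ε ^ nb) (by positivity) (by rw [ju]; exact eps_half ja ho _) hP (sz _ _ (by omega)) _ _ jh jj bc)
  rw [← kk] at ba
  have bb := st _ _ _ (hK2 γ e (ε := ε ^ nc) (by positivity) (by rw [kk]; exact eps_half ja ho _) hP (sz _ _ (by omega)) _ _ jh jj ba)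
  rw [← kl] at bb
  have bd := hK3 γ e (ε := ε ^ na) (by positivity) (by rw [kl]; exact eps_half ja ho _) hP (sz _ _ (by omega)) _ _ jh jj bb
  rw [← pow_mul] at bd
  exact (epl ja ho (by omega)).trans bd
theorem core : ∃ K : ℕ, ∀ {G : Type} [AddCommGroup G] [Fintype G] {M P : ℕ} [NeZero P] (γ : ZMod P →+ G) (e : G) {ε : ℝ},
    0 < ε → ε ≤ 1/2 → P = 16 * M ^ 2 → 1 ≤ ε ^ K * M → ∀ fb fa fc : G → ℂ, (∀ x, ‖fb x‖ ≤ 1) → (∀ x, ‖fa x‖ ≤ 1) → (∀ x, ‖fc x‖ ≤ 1) →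
    ε ≤ ‖TT γ e M fb fa fc‖ → ∃ (r : ℕ) (φ : G → ℂ), 0 < r ∧ r * ε ^ K ≤ 1 ∧ (∀ x, ‖φ x‖ ≤ 1) ∧
      (∀ x, ‖φ (x + γ (r : ZMod P)) - φ x‖ * (ε ^ K * M ^ 2) ≤ 1) ∧ ε ^ K ≤ ‖TT γ e M fb fa φ‖ := by
  obtain ⟨kp, kc⟩ := boxFF
  obtain ⟨n, hn⟩ : ∃ n, n = kp + 1 := ⟨_, rfl⟩
  obtain ⟨b, hb⟩ : ∃ b, b = n * (3 * KM) := ⟨_, rfl⟩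
  refine ⟨6 * n + b + n * (3 * KM + 13), ?_⟩
  intro G _ _ M P _ γ e ε ja ho hP hM fb fa fc jh jj kg h
  have jc : (0:ℝ) < M := szp ja hM
  have hF := FF_bdd γ e (M := M) jh jj
  set F := FF γ e M fb fa with hFd
  have hbx := (epl ja ho (show kp ≤ n by omega)).trans (kc γ e ja ho hP (szm ja ho (by omega) jc.le hM) fb fa fc jh jj kg h)
  obtain ⟨τ, hτ⟩ : ∃ τ, τ = ε ^ n := ⟨_, rfl⟩
  have td : 0 < τ := by rw [hτ]; positivity
  have ta : τ ≤ 1/2 := by rw [hτ, hn]; exact eps_half ja ho _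
  have tb : (τ ^ 3) ^ KM = τ ^ (3 * KM) := (pow_mul _ _ _).symm
  have tn : ∀ k, τ ^ k = ε ^ (n * k) := fun k => by rw [hτ, pow_mul]
  rw [← hτ] at hbx
  obtain ⟨ξ, hξ⟩ := u2_inv γ F hF
  have hI : ∀ x, ‖𝔼 t, F (x + γ t) * ch (ξ x * t)‖ ≤ 1 := fun x => neo fun t => nml (hF _) (chn _).le
  obtain ⟨c, kw, kx, ky⟩ := sel (fun x => 𝔼 t, F (x + γ t) * ch (ξ x * t)) hI td.le (hbx.trans hξ)
  have hmb := maj_bound γ e (ρ := τ ^ 3) (by positivity) (eps_half td ta 2) (M := M) (by rw [tb, tn, ← hb]; exact szm ja ho (by omega) jc.le hM) c fb fa kw jh jj ξ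
  rw [tb] at hmb
  have ea : 𝔼 x, c x * 𝔼 t, F (x + γ t) * ch (ξ x * t) = 𝔼 x, 𝔼 t, 𝔼 y : Fin M, c x * (fb (x + γ t - γ (((y:ℕ):ZMod P) ^ 2)) * fa (x + γ t - γ (((y:ℕ):ZMod P) ^ 2) + (y:ℕ) • e)) * ch (ξ x * t) := by
    refine expect_congr rfl fun x _ => ?_
    rw [mul_expect]
    refine expect_congr rfl fun t _ => ?_
    rw [hFd, FF, expect_mul, mul_expect]
    refine expect_congr rfl fun y _ => ?_
    ring
  rw [← ea] at hmb
  have je := epm td ta 1 2 (c := 4) (by norm_num)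
  have jg := epm td ta 1 4 (c := 16) (by norm_num)
  norm_num at je jg
  have js := ky.trans hmb
  replace js : τ ^ 3 ≤ _ := le_of_add_le_add_left (le_trans (by linarith : τ ^ 3 + τ ^ 3 ≤ τ / 2) js)
  obtain ⟨r, ji, jn, jk⟩ := pigeon_r (fun x r => c x ≠ 0 ∧ nn ((r : ZMod P) * ξ x) * (τ ^ (3 * KM) * M ^ 2) ≤ 1) (θ := τ ^ 3) (by positivity) (by positivity) js
  obtain ⟨J, hJ, hrJ, kf, jv, hJ3⟩ := exists_J td ta (3 * KM) hP (by rw [tn]; exact szm ja ho (by rw [mul_add, mul_add]; omega) jc.le hM) jn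
  have key : τ ^ 3 * (τ ^ 3 * τ ^ (3 * KM)) ≤ 𝔼 x, ‖𝔼 j : Fin J, F (x + (j:ℕ) • γ (r : ZMod P))‖ := by
    refine (mul_le_mul_of_nonneg_left jk (by positivity)).trans ?_
    rw [mul_expect]
    refine le_trans (emono (g := fun x => 𝔼 t, ‖𝔼 j : Fin J, F (x + γ t + (j:ℕ) • γ (r : ZMod P))‖) fun x => ?_) (le_of_eq ?_)
    · by_cases hp : c x ≠ 0 ∧ nn ((r : ZMod P) * ξ x) * (τ ^ (3 * KM) * M ^ 2) ≤ 1
      · rw [indt hp, mul_one]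
        have hrm := removal (P := P) (r := r) hJ (fun t => F (x + γ t)) (fun t => hF _) (ξ x) 0
          (κ := 1 / (τ ^ (3 * KM) * M ^ 2)) (by rw [le_div_iff₀ (by positivity)]; exact hp.2)
        rw [add_zero] at hrm
        have jp := kx x hp.1
        have kb : τ / 2 ≤ ‖𝔼 t, F (x + γ t) * ch (ξ x * t)‖ := jp.trans (by nlinarith [norm_nonneg (𝔼 t, F (x + γ t) * ch (ξ x * t)), hI x])
        have eb : 𝔼 t, ‖𝔼 j : Fin J, F (x + γ (t + (r:ZMod P) * ((j:ℕ) : ZMod P))) * ch (0 * ((r:ZMod P) * ((j:ℕ) : ZMod P)))‖ = 𝔼 t, ‖𝔼 j : Fin J, F (x + γ t + (j:ℕ) • γ (r : ZMod P))‖ := by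
          refine expect_congr rfl fun t _ => ?_
          congr 1
          refine expect_congr rfl fun j _ => ?_
          rw [zero_mul, ch_zero, mul_one, map_add, ← add_assoc, ← map_nsmul, nsmul_eq_mul, mul_comm (r : ZMod P)]
        rw [eb] at hrm
        linarith
      · rw [indf hp, mul_zero]
        exact expect_nn fun t => by positivity
    · rw [expect_comm, ← Fintype.expect_const (ι := ZMod P) (𝔼 x, ‖𝔼 j : Fin J, F (x + (j:ℕ) • γ (r : ZMod P))‖)]
      refine expect_congr rfl fun t _ => ?_
      exact eshift (γ t) (fun x => ‖𝔼 j : Fin J, F (x + (j:ℕ) • γ (r : ZMod P))‖)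
  obtain ⟨φ, hφ1, hφ2, hφ3⟩ := smooth (γ (r : ZMod P)) hJ F key
  have ke : (0:ℝ) < J := by exact_mod_cast hJ
  refine ⟨r, φ, ji, ?_, hφ1, fun x => ?_, ?_⟩
  · refine le_trans (mul_le_mul_of_nonneg_left ?_ (Nat.cast_nonneg r)) jn
    rw [tn, ← hb]; exact epl ja ho (by omega)
  · refine (mul_le_mul (hφ2 x) (mul_le_mul_of_nonneg_right (epl ja ho (show n * (3 * KM + 10) ≤ _ by rw [mul_add n, mul_add n]; omega)) (by positivity)) (by positivity) (by positivity)).trans ?_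
    rw [← tn, div_mul_eq_mul_div, div_le_one ke, ← mul_assoc]
    refine le_trans (mul_le_mul_of_nonneg_right ?_ (by positivity)) hJ3
    have := epm td ta (3 * KM + 9) 1 (c := 2) (by norm_num)
    exact this
  · rw [TT_FF, ← hFd]
    simp_rw [mul_comm (φ _)]
    refine le_trans ?_ hφ3
    rw [← pow_add, ← pow_add, tn]
    exact epl ja ho (by rw [mul_add n, mul_add n, mul_add n]; omega)
theorem tele {G : Type} [AddCommGroup G] {φ : G → ℂ} {d : G} {κ : ℝ} (h : ∀ x, ‖φ (x + d) - φ x‖ ≤ κ) (n : ℕ) (x : G) :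
    ‖φ (x + n • d) - φ x‖ ≤ n * κ := by
  induction n with
  | zero => simp
  | succ n ih =>
    rw [succ_nsmul, ← add_assoc, ← sub_add_sub_cancel _ (φ (x + n • d))]
    refine (norm_add_le _ _).trans ?_
    push_cast; linarith [h (x + n • d)]
section
variable {P : ℕ} [NeZero P] {G : Type} [AddCommGroup G] [Fintype G] (γ : ZMod P →+ G) (e : G)
theorem stepII {ε : ℝ} (ja : 0 < ε) (ho : ε ≤ 1/2) (b : ℕ) {M r : ℕ} (hM : 1 ≤ ε ^ (b + 6) * M) (ji : 0 < r) (hr : r * ε ^ b ≤ 1)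
    (fb fa φ : G → ℂ) (jh : ∀ x, ‖fb x‖ ≤ 1) (jj : ∀ x, ‖fa x‖ ≤ 1) (hφ : ∀ x, ‖φ x‖ ≤ 1)
    (hs : ∀ x, ‖φ (x + γ (r : ZMod P)) - φ x‖ * (ε ^ b * M ^ 2) ≤ 1) (h : ε ≤ ‖TT γ e M fb fa φ‖) :
    ∃ φ1 : G → ℂ, (∀ x, ‖φ1 x‖ ≤ 1) ∧ (∀ x, ‖φ1 (x + r • e) - φ1 x‖ * (ε ^ (b + 8) * M) ≤ 1) ∧ ε ^ 2 ≤ ‖𝔼 x, fa x * φ1 x‖ := by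
  have jc : (0:ℝ) < M := szp ja hM
  have : NeZero M := ⟨by rintro rfl; simp at jc⟩
  have hb : 0 < ε ^ b := by positivity
  obtain ⟨J, hJ, kf, jv⟩ := xlen ja ho (b+6) hM
  have : NeZero J := ⟨hJ.ne'⟩
  have ke : (0:ℝ) < J := by exact_mod_cast hJ
  have hrJ : (r:ℝ) * J ≤ ε ^ 6 * M := by
    calc (r:ℝ) * J ≤ r * (ε ^ (b+6) * M) := by gcongr
      _ = (r * ε ^ b) * (ε ^ 6 * M) := by rw [pow_add]; ring
      _ ≤ _ := mul_le_of_le_one_left (by positivity) hr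
  have jl : ε ^ 6 ≤ 1 := pow_le_one₀ ja.le (by linarith)
  have hrJM : (r:ℝ) * J ≤ M := hrJ.trans (mul_le_of_le_one_left jc.le jl)
  set κ : ℝ := 1 / (ε ^ b * M ^ 2) with hκ
  have hs' : ∀ x, ‖φ (x + γ (r : ZMod P)) - φ x‖ ≤ κ := fun x => by rw [hκ, le_div_iff₀ (by positivity)]; exact hs x
  have hJκ : J * M * κ ≤ ε ^ 6 := by
    rw [hκ, mul_one_div, div_le_iff₀ (by positivity)]
    calc (J:ℝ) * M ≤ ε ^ (b+6) * M * M := by gcongr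
      _ = _ := by rw [pow_add]; ring
  have hκ0 : 0 ≤ κ := by positivity
  have pw : ∀ (x : G) (y : Fin M) (j : Fin J), ‖fb x * fa (x + ((y:ℕ) + r * (j:ℕ)) • e) * φ (x + γ ((((y:ℕ) + r * (j:ℕ) : ℕ) : ZMod P) ^ 2)) - fb x * fa (x + ((y:ℕ) + r * (j:ℕ)) • e) * φ (x + γ (((y:ℕ) : ZMod P) ^ 2))‖ ≤ 3 * ε ^ 6 := by
    intro x y j
    rw [← mul_sub, norm_mul]
    refine (mul_le_of_le_one_left (norm_nonneg _) (nml (jh _) (jj _))).trans ?_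
    have ea : x + γ ((((y:ℕ) + r * (j:ℕ) : ℕ) : ZMod P) ^ 2) = x + γ (((y:ℕ) : ZMod P) ^ 2) + (2 * (y:ℕ) * (j:ℕ) + r * (j:ℕ) * (j:ℕ)) • γ (r : ZMod P) := by
      rw [← map_nsmul, add_assoc, ← map_add, nsmul_eq_mul]; congr 2; push_cast; ring
    rw [ea]
    refine (tele hs' _ _).trans ?_
    have hy : ((y:ℕ):ℝ) ≤ M := by exact_mod_cast y.2.le
    have hj : ((j:ℕ):ℝ) ≤ J := by exact_mod_cast j.2.le
    push_cast
    have : (2 * ((y:ℕ):ℝ) * (j:ℕ) + r * (j:ℕ) * (j:ℕ)) ≤ 3 * (J * M) := by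
      have ab : ((y:ℕ):ℝ) * (j:ℕ) ≤ M * J := by gcongr
      have aa : (r:ℝ) * (j:ℕ) * (j:ℕ) ≤ r * J * J := by gcongr
      have a3 : (r:ℝ) * J * J ≤ M * J := by gcongr
      nlinarith
    calc _ ≤ 3 * (J * M) * κ := by gcongr
      _ = 3 * (J * M * κ) := by ring
      _ ≤ _ := by linarith
  have main : ε - 5 * ε ^ 6 ≤ ‖𝔼 x, 𝔼 j : Fin J, 𝔼 y : Fin M, fb x * fa (x + ((y:ℕ) + r * (j:ℕ)) • e) * φ (x + γ (((y:ℕ) : ZMod P) ^ 2))‖ := by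
    have d1 : ‖TT γ e M fb fa φ - 𝔼 x, 𝔼 j : Fin J, 𝔼 y : Fin M, fb x * fa (x + ((y:ℕ) + r * (j:ℕ)) • e) * φ (x + γ (((y:ℕ) : ZMod P) ^ 2))‖ ≤ 5 * ε ^ 6 := by
      unfold TT
      rw [← expect_sub_distrib]
      refine nel fun x => ?_
      have sa := shift_avg M (r * J) (fun j : Fin J => r * (j:ℕ)) (fun j => Nat.mul_le_mul_left r j.2.le) (fun y => fb x * fa (x + y • e) * φ (x + γ ((y : ZMod P) ^ 2)))
        (fun y => nml (nml (jh _) (jj _)) (hφ _))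
      have sb : 2 * ((r * J : ℕ):ℝ) / M ≤ 2 * ε ^ 6 := by
        rw [div_le_iff₀ jc]; push_cast; linarith
      have sc : ‖𝔼 j : Fin J, 𝔼 y : Fin M, fb x * fa (x + ((y:ℕ) + r * (j:ℕ)) • e) * φ (x + γ ((((y:ℕ) + r * (j:ℕ) : ℕ) : ZMod P) ^ 2)) - 𝔼 j : Fin J, 𝔼 y : Fin M, fb x * fa (x + ((y:ℕ) + r * (j:ℕ)) • e) * φ (x + γ (((y:ℕ) : ZMod P) ^ 2))‖ ≤ 3 * ε ^ 6 := by
        rw [← expect_sub_distrib]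
        refine nel fun j => ?_
        rw [← expect_sub_distrib]
        exact nel fun y => pw x y j
      refine (norm_sub_le_norm_sub_add_norm_sub _ _ _).trans ((add_le_add (sa.trans sb) sc).trans ?_)
      linarith
    have := norm_sub_norm_le (TT γ e M fb fa φ) (𝔼 x, 𝔼 j : Fin J, 𝔼 y : Fin M, fb x * fa (x + ((y:ℕ) + r * (j:ℕ)) • e) * φ (x + γ (((y:ℕ) : ZMod P) ^ 2)))
    linarith
  have key : ε ^ 2 ≤ 𝔼 x, ‖𝔼 j : Fin J, fa (x + (j:ℕ) • (r • e))‖ := by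
    have ab := epm ja ho 1 1 (c := 2) (by norm_num)
    have aa := epm ja ho 1 5 (c := 32) (by norm_num)
    norm_num at ab aa
    refine le_trans (by linarith : ε ^ 2 ≤ ε - 5 * ε ^ 6) (main.trans ?_)
    have eb : 𝔼 x, 𝔼 j : Fin J, 𝔼 y : Fin M, fb x * fa (x + ((y:ℕ) + r * (j:ℕ)) • e) * φ (x + γ (((y:ℕ) : ZMod P) ^ 2)) =
      𝔼 y : Fin M, 𝔼 x, fb x * φ (x + γ (((y:ℕ) : ZMod P) ^ 2)) * 𝔼 j : Fin J, fa (x + (y:ℕ) • e + (j:ℕ) • (r • e)) := by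
      rw [expect_comm (s := (univ : Finset (Fin M)))]
      refine expect_congr rfl fun x _ => ?_
      rw [expect_comm]
      refine expect_congr rfl fun y _ => ?_
      rw [mul_expect]
      refine expect_congr rfl fun j _ => ?_
      rw [add_nsmul, mul_comm r, mul_nsmul', ← add_assoc]; ring
    rw [eb]
    refine nel fun y => (nee _).trans ?_
    rw [← eshift ((y:ℕ) • e) (fun x => ‖𝔼 j : Fin J, fa (x + (j:ℕ) • (r • e))‖)]
    refine emono fun x => ?_
    rw [norm_mul]
    exact mul_le_of_le_one_left (norm_nonneg _) (nml (jh _) (hφ _))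
  obtain ⟨φ1, pa, pb, pc⟩ := smooth (r • e) hJ fa key
  refine ⟨φ1, pa, fun x => ?_, pc⟩
  refine (mul_le_mul_of_nonneg_right (pb x) (by positivity)).trans ?_
  rw [div_mul_eq_mul_div, div_le_one ke]
  refine le_trans ?_ jv
  have := mul_le_mul_of_nonneg_right (epm ja ho (b + 7) 1 (c := 2) (by norm_num)) jc.le
  rw [← mul_assoc]; exact this
end
structure Dat where
  G : Type
  grp : AddCommGroup G
  fin : Fintype G
  M : ℕ
  P : ℕ
  q : ℕ
  ne : NeZero P
  γ : ZMod P →+ G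
  e : G
  hP : P = 16 * M ^ 2
  hq : 0 < q
  hγ : γ 1 = q • e
instance (D : Dat) : AddCommGroup D.G := D.grp
instance (D : Dat) : Fintype D.G := D.fin
instance (D : Dat) : NeZero D.P := D.ne
def Bd {α : Type} (f : α → ℂ) : Prop := ∀ x, ‖f x‖ ≤ 1
noncomputable def TD (D : Dat) (f : Fin 3 → D.G → ℂ) : ℂ := TT D.γ D.e D.M (f 0) (f 1) (f 2)
def SM (D : Dat) (ε : ℝ) (K : ℕ) (Ψ : D.G → ℂ) : Prop := Bd Ψ ∧ ∃ R : ℕ, 0 < R ∧ R * ε ^ K ≤ 1 ∧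
  ∀ x, ‖Ψ (x + (D.q * R) • D.e) - Ψ x‖ * (ε ^ K * D.M) ≤ D.q
def COR (i : Fin 3) : Prop := ∃ K : ℕ, ∀ (D : Dat) (ε : ℝ), 0 < ε → ε ≤ 1/2 → 1 ≤ ε ^ K * D.M → ∀ f : Fin 3 → D.G → ℂ, (∀ i, Bd (f i)) →
  ε ≤ ‖TD D f‖ → ∃ Ψ, SM D ε K Ψ ∧ ε ^ K ≤ ‖𝔼 x, f i x * Ψ x‖
def REP (i : Fin 3) : Prop := ∃ K : ℕ, ∀ (D : Dat) (ε : ℝ), 0 < ε → ε ≤ 1/2 → 1 ≤ ε ^ K * D.M → ∀ f : Fin 3 → D.G → ℂ, (∀ i, Bd (f i)) →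
  ε ≤ ‖TD D f‖ → ∃ Ψ, SM D ε K Ψ ∧ ε ^ K ≤ ‖TD D (Function.update f i Ψ)‖
theorem SM_mono {D : Dat} {ε : ℝ} (ja : 0 < ε) (ho : ε ≤ 1/2) {a b : ℕ} (h : a ≤ b) {Ψ : D.G → ℂ} (hs : SM D ε a Ψ) : SM D ε b Ψ := by
  obtain ⟨hb, R, hR, jm, jq⟩ := hs
  have := epl ja ho h
  refine ⟨hb, R, hR, le_trans (by gcongr) jm, fun x => le_trans ?_ (jq x)⟩
  exact mul_le_mul_of_nonneg_left (mul_le_mul_of_nonneg_right this (Nat.cast_nonneg _)) (norm_nonneg _)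
theorem SM_pow {D : Dat} {ε : ℝ} {n K : ℕ} {Ψ : D.G → ℂ} (hs : SM D (ε ^ n) K Ψ) : SM D ε (n * K) Ψ := by
  unfold SM at *; rwa [pow_mul]
theorem SM_shift {D : Dat} {ε : ℝ} {K : ℕ} {Ψ : D.G → ℂ} (hs : SM D ε K Ψ) (c : D.G) : SM D ε K (fun x => Ψ (x + c)) := by
  obtain ⟨hb, R, hR, jm, jq⟩ := hs
  exact ⟨fun x => hb _, R, hR, jm, fun x => by dsimp only; rw [add_right_comm]; exact jq _⟩
theorem SM_conj {D : Dat} {ε : ℝ} {K : ℕ} {Ψ : D.G → ℂ} (hs : SM D ε K Ψ) : SM D ε K (fun x => conj (Ψ x)) := by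
  obtain ⟨hb, R, hR, jm, jq⟩ := hs
  exact ⟨fun x => ncl (hb _), R, hR, jm, fun x => by rw [← map_sub, RCLike.norm_conj]; exact jq _⟩
theorem SM_mul {D : Dat} {ε : ℝ} (ja : 0 < ε) (ho : ε ≤ 1/2) {K L : ℕ} {Ψ Φ : D.G → ℂ} (hM : 0 < D.M) (hs : SM D ε K Ψ) (ht : SM D ε L Φ) :
    SM D ε (K + L + 1) (fun x => Ψ x * Φ x) := by
  obtain ⟨hb, R, hR, jm, jq⟩ := hs
  obtain ⟨hc, S, hS, hS1, kr⟩ := ht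
  have jc : (0:ℝ) < D.M := by exact_mod_cast hM
  have two : ε ^ (K + L + 1) * 2 ≤ ε ^ K * ε ^ L := by
    have := epm ja ho (K + L) 1 (c := 2) (by norm_num)
    rw [← pow_add]; linarith
  have hKL : 0 < ε ^ K * ε ^ L := by positivity
  refine ⟨fun x => nml (hb _) (hc _), R * S, Nat.mul_pos hR hS, ?_, fun x => ?_⟩
  · push_cast
    calc (R:ℝ) * S * ε ^ (K + L + 1) ≤ R * S * (ε ^ K * ε ^ L) := by gcongr; linarith
      _ = (R * ε ^ K) * (S * ε ^ L) := by ring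
      _ ≤ 1 := mul_le_one₀ jm (by positivity) hS1
  · have ab := tele (fun x => (le_div_iff₀ (show 0 < ε ^ K * D.M by positivity)).2 (jq x)) S x
    have aa := tele (fun x => (le_div_iff₀ (show 0 < ε ^ L * D.M by positivity)).2 (kr x)) R x
    rw [smul_smul, show S * (D.q * R) = D.q * (R * S) by ring] at ab
    rw [smul_smul, show R * (D.q * S) = D.q * (R * S) by ring] at aa
    set d := (D.q * (R * S)) • D.e
    have ea : Ψ (x + d) * Φ (x + d) - Ψ x * Φ x = (Ψ (x + d) - Ψ x) * Φ (x + d) + Ψ x * (Φ (x + d) - Φ x) := by ring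
    have a3 : ‖Ψ (x + d) * Φ (x + d) - Ψ x * Φ x‖ ≤ S * (D.q / (ε ^ K * D.M)) + R * (D.q / (ε ^ L * D.M)) := by
      rw [ea]
      refine (norm_add_le _ _).trans ?_
      rw [norm_mul, norm_mul]
      exact add_le_add ((mul_le_of_le_one_right (norm_nonneg _) (hc _)).trans ab) ((mul_le_of_le_one_left (norm_nonneg _) (hb _)).trans aa)
    have a4 : (S:ℝ) * (D.q / (ε ^ K * D.M)) * (ε ^ K * ε ^ L * D.M) ≤ D.q := by
      have : (S:ℝ) * (D.q / (ε ^ K * D.M)) * (ε ^ K * ε ^ L * D.M) = (S * ε ^ L) * D.q := by field_simp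
      rw [this]; exact mul_le_of_le_one_left (Nat.cast_nonneg _) hS1
    have a5 : (R:ℝ) * (D.q / (ε ^ L * D.M)) * (ε ^ K * ε ^ L * D.M) ≤ D.q := by
      have : (R:ℝ) * (D.q / (ε ^ L * D.M)) * (ε ^ K * ε ^ L * D.M) = (R * ε ^ K) * D.q := by field_simp
      rw [this]; exact mul_le_of_le_one_left (Nat.cast_nonneg _) jm
    have a6 : ε ^ (K + L + 1) * D.M ≤ ε ^ K * ε ^ L * D.M / 2 := by
      have := mul_le_mul_of_nonneg_right two jc.le; linarith
    calc _ ≤ (S * (D.q / (ε ^ K * D.M)) + R * (D.q / (ε ^ L * D.M))) * (ε ^ K * ε ^ L * D.M / 2) := by gcongr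
      _ ≤ _ := by linarith
theorem dualT (D : Dat) (hM : 0 < D.M) (i : Fin 3) (f : Fin 3 → D.G → ℂ) (hf : ∀ i, Bd (f i)) : ∃ F, Bd F ∧ ∀ g, TD D (Function.update f i g) = 𝔼 x, g x * F x := by
  match i with
  | 0 =>
    refine ⟨fun x => 𝔼 y : Fin D.M, f 1 (x + (y:ℕ) • D.e) * f 2 (x + D.γ (((y:ℕ):ZMod D.P)^2)), fun x => neo fun y => nml (hf 1 _) (hf 2 _), fun g => ?_⟩
    unfold TD TT
    simp only [Function.update_self, ne_eq, Fin.reduceEq, not_false_eq_true, Function.update_of_ne, mul_expect, mul_assoc]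
  | 1 =>
    refine ⟨fun x => 𝔼 y : Fin D.M, f 0 (x - (y:ℕ) • D.e) * f 2 (x - (y:ℕ) • D.e + D.γ (((y:ℕ):ZMod D.P)^2)), fun x => neo fun y => nml (hf 0 _) (hf 2 _), fun g => ?_⟩
    unfold TD TT
    simp only [Function.update_self, ne_eq, Fin.reduceEq, not_false_eq_true, Function.update_of_ne, mul_expect]
    rw [expect_comm, expect_comm (s := (univ : Finset D.G))]
    refine expect_congr rfl fun y _ => ?_
    rw [← eshift ((y:ℕ) • D.e) (fun x => g x * _)]
    refine expect_congr rfl fun x _ => ?_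
    rw [add_sub_cancel_right]; ring
  | 2 =>
    refine ⟨FF D.γ D.e D.M (f 0) (f 1), FF_bdd _ _ (hf 0) (hf 1), fun g => ?_⟩
    unfold TD
    simp only [Function.update_self, ne_eq, Fin.reduceEq, not_false_eq_true, Function.update_of_ne, TT_FF]
theorem rep_of_cor {i : Fin 3} (h : COR i) : REP i := by
  obtain ⟨K, hK⟩ := h
  refine ⟨2 * K, fun D ε ja ho hM f hf h => ?_⟩
  have jc : 0 < D.M := by exact_mod_cast szp ja hM
  obtain ⟨F, hF, pd⟩ := dualT D jc i f hf
  have jb := pd (f i)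
  rw [Function.update_eq_self] at jb
  rw [jb] at h
  have jd := (pow_le_pow_left₀ ja.le h 2).trans (cs_kill (f i) F (hf i))
  have je : ε ^ 2 ≤ ‖TD D (Function.update f i (fun x => conj (F x)))‖ := by
    rw [pd]
    refine jd.trans (le_trans (le_of_eq ?_) (Complex.re_le_norm _))
    rw [re_expect]
    refine expect_congr rfl fun x _ => ?_
    rw [norm_sq_re, mul_comm]
  obtain ⟨Ψ, sa, sb⟩ := hK D (ε ^ 2) (by positivity) (eps_half ja ho 1) (by rwa [← pow_mul]) _ (fun j => by
    by_cases hj : j = i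
    · subst hj; rw [Function.update_self]; exact fun x => ncl (hF x)
    · rw [Function.update_of_ne hj]; exact hf j) je
  refine ⟨_, SM_conj (SM_pow sa), ?_⟩
  rw [pd, pow_mul]
  refine sb.trans (le_of_eq ?_)
  rw [← RCLike.norm_conj, conj_expect]
  congr 1
  refine expect_congr rfl fun x _ => ?_
  rw [Function.update_self, map_mul, Complex.conj_conj, mul_comm]
theorem γ_nat (D : Dat) (r : ℕ) : D.γ (r : ZMod D.P) = (D.q * r) • D.e := by
  rw [← nsmul_one r, map_nsmul, D.hγ, smul_smul, mul_comm]
theorem rep2 : REP 2 := by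
  obtain ⟨K, hK⟩ := core
  refine ⟨K, fun D ε ja ho hM f hf h => ?_⟩
  have jc : (0:ℝ) < D.M := szp ja hM
  have jy : (1:ℝ) ≤ D.M := by exact_mod_cast jc
  have kh : (1:ℝ) ≤ D.q := by exact_mod_cast D.hq
  obtain ⟨r, φ, pa, pb, pc, pe, pf⟩ := hK D.γ D.e ja ho D.hP hM _ _ _ (hf 0) (hf 1) (hf 2) h
  refine ⟨φ, ⟨pc, r, pa, pb, fun x => ?_⟩, ?_⟩
  · rw [← γ_nat]
    refine le_trans (mul_le_mul_of_nonneg_left (mul_le_mul_of_nonneg_left ?_ (by positivity)) (norm_nonneg _)) ((pe x).trans kh)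
    nlinarith
  · simpa [TD] using pf
theorem cor1 : COR 1 := by
  obtain ⟨K, hK⟩ := core
  refine ⟨(K+1) * 9, fun D ε ja ho hM f hf h => ?_⟩
  have jc : (0:ℝ) < D.M := szp ja hM
  obtain ⟨r, φ, pa, pb, pc, pe, pf⟩ := hK D.γ D.e ja ho D.hP (szm ja ho (by omega) jc.le hM) _ _ _ (hf 0) (hf 1) (hf 2) h
  have hle := epl ja ho (Nat.le_succ K)
  obtain ⟨φ1, sa, sb, sc⟩ := stepII D.γ D.e (ε := ε ^ (K+1)) (by positivity) (eps_half ja ho K) 1 (M := D.M) (r := r)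
    (by rw [← pow_mul]; exact szm ja ho (by omega) jc.le hM) pa (by rw [pow_one]; exact le_trans (by gcongr) pb) (f 0) (f 1) φ (hf 0) (hf 1) pc
    (fun x => by rw [pow_one]; exact le_trans (mul_le_mul_of_nonneg_left (mul_le_mul_of_nonneg_right hle (by positivity)) (norm_nonneg _)) (pe x)) (hle.trans pf)
  refine ⟨φ1, ⟨sa, r, pa, ?_, fun x => ?_⟩, ?_⟩
  · exact le_trans (mul_le_mul_of_nonneg_left (epl ja ho (by omega)) (Nat.cast_nonneg _)) pb
  · rw [← smul_smul, pow_mul]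
    have := tele (fun x => (le_div_iff₀ (show 0 < (ε ^ (K+1)) ^ 9 * D.M by positivity)).2 (sb x)) D.q x
    rwa [mul_one_div, le_div_iff₀ (by positivity)] at this
  · exact le_trans (by rw [← pow_mul]; exact epl ja ho (by omega)) sc
theorem rep1 : REP 1 := rep_of_cor cor1
theorem Bd_upd {α : Type} {f : Fin 3 → α → ℂ} (hf : ∀ i, Bd (f i)) (i : Fin 3) {g : α → ℂ} (hg : Bd g) (j : Fin 3) : Bd (Function.update f i g j) := by
  by_cases hj : j = i
  · subst hj; rwa [Function.update_self]
  · rw [Function.update_of_ne hj]; exact hf j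
theorem two_rep {i j : Fin 3} (hi : REP i) (hj : REP j) : ∃ K : ℕ, ∀ (D : Dat) (ε : ℝ), 0 < ε → ε ≤ 1/2 → 1 ≤ ε ^ K * D.M → ∀ f : Fin 3 → D.G → ℂ, (∀ i, Bd (f i)) →
    ε ≤ ‖TD D f‖ → ∃ Ψ Φ, SM D ε K Ψ ∧ SM D ε K Φ ∧ ε ^ K ≤ ‖TD D (Function.update (Function.update f i Ψ) j Φ)‖ := by
  obtain ⟨K, hK⟩ := hi
  obtain ⟨L, hL⟩ := hj
  refine ⟨K + (K + 1) * L, fun D ε ja ho hM f hf h => ?_⟩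
  have jc : (0:ℝ) < D.M := szp ja hM
  obtain ⟨Ψ, sa, sb⟩ := hK D ε ja ho (szm ja ho (by omega) jc.le hM) f hf h
  obtain ⟨Φ, ta, tc⟩ := hL D (ε ^ (K+1)) (by positivity) (eps_half ja ho K) (by rw [← pow_mul]; exact szm ja ho (by omega) jc.le hM) _ (Bd_upd hf i sa.1) ((epl ja ho (Nat.le_succ K)).trans sb)
  refine ⟨Ψ, Φ, SM_mono ja ho (by omega) sa, SM_mono ja ho (by omega) (SM_pow ta), le_trans ?_ tc⟩
  rw [← pow_mul]; exact epl ja ho (by omega)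
theorem cor0 : COR 0 := by
  obtain ⟨K, hK⟩ := two_rep rep2 rep1
  refine ⟨K + K + 1, fun D ε ja ho hM f hf h => ?_⟩
  have jc : (0:ℝ) < D.M := szp ja hM
  have jy : 0 < D.M := by exact_mod_cast jc
  have : NeZero D.M := ⟨jy.ne'⟩
  obtain ⟨Ψ, Φ, sa, ta, tc⟩ := hK D ε ja ho (szm ja ho (by omega) jc.le hM) f hf h
  unfold TD TT at tc
  rw [expect_comm] at tc
  obtain ⟨y, hy⟩ := egn tc
  refine ⟨_, SM_mul ja ho jy (SM_shift ta ((y:ℕ) • D.e)) (SM_shift sa (D.γ (((y:ℕ):ZMod D.P)^2))), (epl ja ho (by omega)).trans (hy.trans (le_of_eq ?_))⟩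
  congr 1
  refine expect_congr rfl fun x _ => ?_
  simp [mul_assoc]
theorem cor2 : COR 2 := by
  obtain ⟨K, hK⟩ := two_rep rep1 (rep_of_cor cor0)
  refine ⟨K + K + 1, fun D ε ja ho hM f hf h => ?_⟩
  have jc : (0:ℝ) < D.M := szp ja hM
  have jy : 0 < D.M := by exact_mod_cast jc
  have : NeZero D.M := ⟨jy.ne'⟩
  obtain ⟨Ψ, Φ, sa, ta, tc⟩ := hK D ε ja ho (szm ja ho (by omega) jc.le hM) f hf h
  unfold TD TT at tc
  rw [expect_comm] at tc
  obtain ⟨y, hy⟩ := egn tc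
  refine ⟨_, SM_mul ja ho jy (SM_shift ta (- D.γ (((y:ℕ):ZMod D.P)^2))) (SM_shift sa ((y:ℕ) • D.e - D.γ (((y:ℕ):ZMod D.P)^2))), (epl ja ho (by omega)).trans (hy.trans (le_of_eq ?_))⟩
  rw [← eshift (- D.γ (((y:ℕ):ZMod D.P)^2))]
  congr 1
  refine expect_congr rfl fun x _ => ?_
  simp [add_assoc, add_comm (- D.γ _), sub_eq_add_neg]
  ring
theorem cor (i : Fin 3) : COR i := by
  match i with
  | 0 => exact cor0
  | 1 => exact cor1
  | 2 => exact cor2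
theorem localise {ψ : ℤ → ℂ} (hb : ∀ x, ‖ψ x‖ ≤ 1) {d : ℕ} (hd : 0 < d) {κ R : ℝ} (hR : 0 < R) (h : ∀ x, ‖ψ (x + d) - ψ x‖ ≤ κ) :
    ∃ φ : ℤ → ℂ, (∀ x, ‖φ x‖ ≤ 1) ∧ IsLocalFunction φ R d ∧ ∀ x, ‖φ x - ψ x‖ ≤ R / d * κ := by
  have hκ : 0 ≤ κ := (norm_nonneg _).trans (h 0)
  have hd0 : (0:ℝ) < d := by exact_mod_cast hd
  let key : ℤ → ℤ × ℤ := fun x => (⌊((x:ℝ) - 0) / R⌋, x % (d:ℤ))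
  have hk : ∀ x, key (Function.invFun key (key x)) = key x := fun x => Function.invFun_eq ⟨x, rfl⟩
  have main : ∀ a b : ℤ, a ≤ b → key a = key b → ‖ψ b - ψ a‖ ≤ R / d * κ := by
    intro a b hab hkey
    have ho : ⌊((a:ℝ) - 0) / R⌋ = ⌊((b:ℝ) - 0) / R⌋ := (Prod.mk.inj hkey).1
    have jb : a % (d:ℤ) = b % (d:ℤ) := (Prod.mk.inj hkey).2
    obtain ⟨k, hk⟩ := (Int.ModEq.dvd jb : (d:ℤ) ∣ b - a)
    have hk0 : 0 ≤ k := by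
      by_contra hc
      have : (d:ℤ) * k < 0 := mul_neg_of_pos_of_neg (by exact_mod_cast hd) (not_le.1 hc)
      omega
    obtain ⟨n, rfl⟩ := Int.eq_ofNat_of_zero_le hk0
    have pp : b = a + n • (d:ℤ) := by rw [nsmul_eq_mul]; linarith
    have := Int.abs_sub_lt_one_of_floor_eq_floor ho
    rw [sub_zero, sub_zero, ← sub_div, abs_div, abs_of_pos hR, div_lt_one hR, abs_sub_comm] at this
    have jd : (n:ℝ) * d ≤ R := by
      refine le_trans (le_of_eq ?_) ((le_abs_self _).trans this.le)
      rw [pp]; push_cast; simp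
    rw [pp]
    refine (tele h n a).trans (mul_le_mul_of_nonneg_right ?_ hκ)
    rwa [le_div_iff₀ hd0]
  refine ⟨fun x => ψ (Function.invFun key (key x)), fun x => hb _, ⟨0, fun x y ho jb => ?_⟩, fun x => ?_⟩
  · have : key x = key y := Prod.ext ho jb
    simp only [this]
  · rcases le_total (Function.invFun key (key x)) x with hle | hle
    · rw [norm_sub_rev]; exact main _ _ hle (hk x)
    · exact main _ _ hle (hk x).symm
theorem val_cast_int {L : ℕ} [NeZero L] {x : ℤ} (ja : 0 ≤ x) (ho : x < L) : (((x : ZMod L).val : ℕ) : ℤ) = x := by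
  rw [ZMod.val_intCast, Int.emod_eq_of_lt ja ho]
theorem sum_lift {L N : ℕ} [NeZero L] (hN : N < L) {f : ℤ → ℂ} (hf : ∀ x, f x ≠ 0 → x ∈ Icc (1:ℤ) N) (H : ZMod L → ℂ) :
    ∑ x : ZMod L, f ((x.val : ℕ) : ℤ) * H x = ∑ x ∈ Icc (1:ℤ) N, f x * H (x : ZMod L) := by
  have hv : ∀ x ∈ Icc (1:ℤ) N, (((x : ZMod L).val : ℕ) : ℤ) = x := fun x hx => by
    rw [mem_Icc] at hx; exact val_cast_int (by omega) (by omega)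
  symm
  refine Finset.sum_of_injOn (fun x : ℤ => (x : ZMod L)) ?_ (fun _ _ => by simp) ?_ ?_
  · intro x hx y hy hxy
    rw [← hv x hx, ← hv y hy]
    dsimp only at hxy
    rw [hxy]
  · intro i _ hi
    by_contra hc
    apply hi
    refine ⟨((i.val : ℕ) : ℤ), hf _ (fun ja => hc (by rw [ja, zero_mul])), ?_⟩
    simp
  · intro x hx
    rw [hv x hx]
noncomputable def gam (q P : ℕ) : ZMod P →+ ZMod (q * P) :=
  ZMod.lift P ⟨(Int.castAddHom (ZMod (q * P))).comp (AddMonoidHom.mulLeft (q:ℤ)), by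
      have := ZMod.natCast_self (q * P)
      push_cast at this
      simpa using this⟩
theorem gam_nat (q P n : ℕ) : gam q P (n : ZMod P) = ((q * n : ℕ) : ZMod (q * P)) := by
  have := ZMod.lift_coe P (⟨(Int.castAddHom (ZMod (q * P))).comp (AddMonoidHom.mulLeft (q:ℤ)), by
      have := ZMod.natCast_self (q * P)
      push_cast at this
      simpa using this⟩ : { f : ℤ →+ ZMod (q * P) // f P = 0 }) n
  simpa [gam] using this
noncomputable def mkDat (q M : ℕ) (hq : 0 < q) (hM : 0 < M) : Dat :=
  haveI : NeZero (q * (16 * M ^ 2)) := ⟨by positivity⟩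
  { G := ZMod (q * (16 * M ^ 2))
    grp := inferInstance
    fin := inferInstance
    M := M
    P := 16 * M ^ 2
    q := q
    ne := ⟨by positivity⟩
    γ := gam q (16 * M ^ 2)
    e := 1
    hP := rfl
    hq := hq
    hγ := by
      have := gam_nat q (16 * M ^ 2) 1
      simpa using this }
theorem arith {q N : ℕ} (hq : 0 < q) (hN : q ≤ N) : 0 < Nat.sqrt (N / q) ∧ q * Nat.sqrt (N / q) ^ 2 ≤ N ∧ N < 4 * (q * Nat.sqrt (N / q) ^ 2) := by
  have ho : 0 < Nat.sqrt (N / q) := Nat.sqrt_pos.2 (Nat.div_pos hN hq)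
  refine ⟨ho, ?_, ?_⟩
  · exact (Nat.mul_le_mul_left q (Nat.sqrt_le' _)).trans (Nat.mul_div_le N q)
  · have jb := Nat.lt_mul_div_succ N hq
    have jd := Nat.succ_le_succ_sqrt' (N / q)
    have je : (Nat.sqrt (N / q)).succ ^ 2 ≤ 4 * Nat.sqrt (N / q) ^ 2 := by
      rw [Nat.succ_eq_add_one]; nlinarith
    calc N < q * (N / q + 1) := jb
      _ ≤ q * (4 * Nat.sqrt (N / q) ^ 2) := Nat.mul_le_mul_left q (jd.trans je)
      _ = _ := by ring
theorem TT_lift {q N M : ℕ} (hq : 0 < q) (hM : 0 < M) (ho : q * M ^ 2 ≤ N) (jb : N < 4 * (q * M ^ 2)) [NeZero (q * (16 * M ^ 2))] {f : Fin 3 → ℤ → ℂ}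
    (hf : ∀ i x, f i x ≠ 0 → x ∈ Icc (1:ℤ) N) :
    ((q * (16 * M ^ 2) : ℕ) : ℂ) * TT (gam q (16 * M ^ 2)) (1 : ZMod (q * (16 * M ^ 2))) M (fun x => f 0 ((x.val : ℕ) : ℤ)) (fun x => f 1 ((x.val : ℕ) : ℤ)) (fun x => f 2 ((x.val : ℕ) : ℤ)) =
    ∑ x ∈ Icc (1:ℤ) N, 𝔼 y : Fin M, f 0 x * f 1 (x + ((y:ℕ):ℤ)) * f 2 (x + (q:ℤ) * ((y:ℕ):ℤ) ^ 2) := by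
  have hL : N < q * (16 * M ^ 2) := by nlinarith
  have kq : ((q * (16 * M ^ 2) : ℕ) : ℂ) ≠ 0 := by exact_mod_cast (NeZero.ne (q * (16 * M ^ 2)))
  unfold TT
  rw [Fintype.expect_eq_sum_div_card, ZMod.card, mul_div_cancel₀ _ kq]
  have hs := sum_lift hL (hf 0) (fun x : ZMod (q * (16 * M ^ 2)) => 𝔼 y : Fin M, f 1 (((x + (y:ℕ) • (1 : ZMod (q * (16 * M ^ 2)))).val : ℕ) : ℤ) *
    f 2 (((x + gam q (16 * M ^ 2) (((y:ℕ) : ZMod (16 * M ^ 2)) ^ 2)).val : ℕ) : ℤ))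
  simp only [mul_expect, ← mul_assoc] at hs
  refine hs.trans (sum_congr rfl fun x hx => expect_congr rfl fun y _ => ?_)
  rw [mem_Icc] at hx
  have hy : (y:ℕ) < M := y.2
  have kv : q * (y:ℕ) ^ 2 ≤ q * M ^ 2 := by gcongr
  have hM2 : (y:ℕ) < q * M ^ 2 := by nlinarith [Nat.le_self_pow two_ne_zero M]
  have ea : (x : ZMod (q * (16 * M ^ 2))) + (y:ℕ) • (1 : ZMod (q * (16 * M ^ 2))) = ((x + ((y:ℕ):ℤ) : ℤ) : ZMod (q * (16 * M ^ 2))) := by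
    push_cast; simp
  have eb : (x : ZMod (q * (16 * M ^ 2))) + gam q (16 * M ^ 2) (((y:ℕ) : ZMod (16 * M ^ 2)) ^ 2) = ((x + ((q * (y:ℕ) ^ 2 : ℕ) : ℤ) : ℤ) : ZMod (q * (16 * M ^ 2))) := by
    rw [← Nat.cast_pow, gam_nat]; push_cast; rfl
  have hLe : q * (16 * M ^ 2) = 16 * (q * M ^ 2) := by ring
  rw [ea, eb, val_cast_int (by omega) (by omega), val_cast_int (by omega) (by omega)]
  push_cast
  rfl
theorem cnt_le {q N : ℕ} (hq : 0 < q) (hN : q ≤ N) {f : Fin 3 → ℤ → ℂ} (hb : ∀ i x, ‖f i x‖ ≤ 1) :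
    ‖cntOp q N (f 0) (f 1) (f 2)‖ ≤ 1 ∧ N * ‖cntOp q N (f 0) (f 1) (f 2)‖ ≤
    ‖∑ x ∈ Icc (1:ℤ) N, 𝔼 y : Fin (Nat.sqrt (N / q)), f 0 x * f 1 (x + ((y:ℕ):ℤ)) * f 2 (x + (q:ℤ) * ((y:ℕ):ℤ) ^ 2)‖ + N * (2 / Nat.sqrt (N / q)) := by
  obtain ⟨hM, -, -⟩ := arith hq hN
  have hN0 : (0:ℝ) < N := by exact_mod_cast (hq.trans_le hN)
  have e : (N:ℂ) * cntOp q N (f 0) (f 1) (f 2) = ∑ x ∈ Icc (1:ℤ) N, 𝔼 y : Fin (Nat.sqrt (N / q)), f 0 x * f 1 (x + (((y:ℕ) + 1 : ℕ):ℤ)) * f 2 (x + (q:ℤ) * (((y:ℕ) + 1 : ℕ):ℤ) ^ 2) := by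
    unfold cntOp
    generalize Nat.sqrt (N / q) = M at *
    have hN1 : (N:ℂ) ≠ 0 := by exact_mod_cast (hq.trans_le hN).ne'
    rw [mul_div_mul_left _ _ hN1 |> (mul_div_assoc _ _ _).symm.trans, sum_div]
    refine sum_congr rfl fun x _ => ?_
    rw [expect_fin M (fun y => f 0 x * f 1 (x + ((y + 1 : ℕ):ℤ)) * f 2 (x + (q:ℤ) * ((y + 1 : ℕ):ℤ) ^ 2))]
    congr 1
    symm
    refine Finset.sum_bij (fun y _ => ((y + 1 : ℕ):ℤ)) (fun y hy => ?_) (fun a _ b _ h => ?_) (fun b hb => ?_) (fun _ _ => rfl)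
    · rw [mem_range] at hy; rw [mem_Icc]; omega
    · omega
    · rw [mem_Icc] at hb; exact ⟨(b - 1).toNat, by rw [mem_range]; omega, by omega⟩
  have hz : ∀ (x y : ℤ) (w : ℤ), ‖f 0 x * f 1 y * f 2 w‖ ≤ 1 := fun x y w => by
    rw [norm_mul, norm_mul]
    exact mul_le_one₀ (mul_le_one₀ (hb _ _) (norm_nonneg _) (hb _ _)) (norm_nonneg _) (hb _ _)
  have hc : ((Icc (1:ℤ) N).card : ℝ) = N := by simp
  have en : (N:ℝ) * ‖cntOp q N (f 0) (f 1) (f 2)‖ = ‖(N:ℂ) * cntOp q N (f 0) (f 1) (f 2)‖ := by rw [norm_mul, Complex.norm_natCast]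
  constructor
  · have : (N:ℝ) * ‖cntOp q N (f 0) (f 1) (f 2)‖ ≤ N * 1 := by
      rw [en, e, ← hc, mul_one]
      refine (norm_sum_le _ _).trans ((sum_le_card_nsmul _ _ 1 fun x _ => ?_).trans (by simp))
      exact neo fun y => hz _ _ _
    exact le_of_mul_le_mul_left this hN0
  · rw [en, e, add_comm, ← sub_le_iff_le_add]
    refine (norm_sub_norm_le _ _).trans ?_
    rw [← sum_sub_distrib]
    refine (norm_sum_le _ _).trans ((sum_le_card_nsmul _ _ (2 / (Nat.sqrt (N / q) : ℝ)) fun x _ => ?_).trans (by rw [nsmul_eq_mul, hc]))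
    rw [norm_sub_rev]
    have := shift_one (Nat.sqrt (N / q)) 1 (fun y => f 0 x * f 1 (x + (y:ℤ)) * f 2 (x + (q:ℤ) * (y:ℤ) ^ 2)) (fun y => hz _ _ _)
    simpa using this
theorem corU : ∃ K : ℕ, 1 ≤ K ∧ ∀ i : Fin 3, ∀ (D : Dat) (ε : ℝ), 0 < ε → ε ≤ 1/2 → 1 ≤ ε ^ K * D.M → ∀ f : Fin 3 → D.G → ℂ, (∀ i, Bd (f i)) →
    ε ≤ ‖TD D f‖ → ∃ Ψ, SM D ε K Ψ ∧ ε ^ K ≤ ‖𝔼 x, f i x * Ψ x‖ := by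
  choose K hK using cor
  refine ⟨K 0 + K 1 + K 2 + 1, by omega, fun i D ε ja ho hM f hf h => ?_⟩
  have hi : K i ≤ K 0 + K 1 + K 2 + 1 := by
    match i with
    | 0 => omega
    | 1 => omega
    | 2 => omega
  obtain ⟨Ψ, sa, sb⟩ := hK i D ε ja ho (szm ja ho hi (szp ja hM).le hM) f hf h
  exact ⟨Ψ, SM_mono ja ho hi sa, (epl ja ho hi).trans sb⟩
theorem zinv : ∃ K : ℕ, 1 ≤ K ∧ ∀ (q N : ℕ), 0 < q → q ≤ N → ∀ δ : ℝ, 0 < δ → δ ≤ 1 → ∀ f : Fin 3 → ℤ → ℂ, (∀ i x, ‖f i x‖ ≤ 1) →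
    (∀ i x, f i x ≠ 0 → x ∈ Icc (1:ℤ) N) → ∀ i, δ / 2 ≤ ‖cntOp q N (f 0) (f 1) (f 2)‖ → 1 ≤ (δ / 128) ^ K * (Nat.sqrt (N / q) : ℕ) →
    ∃ (φ : ℤ → ℂ) (R : ℕ), (∀ x, ‖φ x‖ ≤ 1) ∧ 0 < R ∧ R * (δ / 128) ^ K ≤ 1 ∧
      IsLocalFunction φ ((δ / 128) ^ (2 * K + 2) * (Nat.sqrt (N / q) : ℕ)) (q * R) ∧ (δ / 128) ^ K / 2 * N ≤ ‖∑ x ∈ Icc (1:ℤ) N, f i x * φ x‖ := by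
  obtain ⟨K, jr, hK⟩ := corU
  refine ⟨K, jr, fun q N hq hN δ hδ hδ1 f hb hs i hc hM => ?_⟩
  obtain ⟨jc, ab, aa⟩ := arith hq hN
  obtain ⟨-, hcl⟩ := cnt_le hq hN hb
  generalize Nat.sqrt (N / q) = M at *
  set ε := δ / 128 with hε
  have ja : 0 < ε := by positivity
  have ho : ε ≤ 1/2 := by rw [hε]; linarith
  have hMr : (0:ℝ) < M := by exact_mod_cast jc
  have : NeZero (q * (16 * M ^ 2)) := ⟨by positivity⟩
  have hNr : (0:ℝ) < N := by exact_mod_cast (hq.trans_le hN)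
  have hL : N < q * (16 * M ^ 2) := by nlinarith
  have hLr : (N:ℝ) ≤ ((q * (16 * M ^ 2) : ℕ) : ℝ) := by exact_mod_cast hL.le
  have hLr2 : ((q * (16 * M ^ 2) : ℕ) : ℝ) ≤ 16 * N := by
    have : q * (16 * M ^ 2) ≤ 16 * N := by linarith
    exact_mod_cast this
  have kq : (0:ℝ) < ((q * (16 * M ^ 2) : ℕ) : ℝ) := hNr.trans_le hLr
  have hT : ε ≤ ‖TD (mkDat q M hq jc) (fun j x => f j ((ZMod.val (n := q * (16 * M ^ 2)) x : ℕ) : ℤ))‖ := by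
    have e := TT_lift hq jc ab aa hs
    rw [← e, norm_mul, Complex.norm_natCast] at hcl
    have jb : 2 / (M:ℝ) ≤ 2 * ε := by
      rw [div_le_iff₀ hMr]
      have : ε ^ K ≤ ε := by simpa using epl ja ho jr
      nlinarith
    have jd : (N:ℝ) * (16 * ε) ≤ N * (‖cntOp q N (f 0) (f 1) (f 2)‖ - 2 / M) := by
      refine mul_le_mul_of_nonneg_left ?_ hNr.le
      rw [hε] at jb ⊢; linarith
    have je := jd.trans ((mul_sub _ _ _).le.trans (sub_le_iff_le_add.2 hcl))
    have jg : ((q * (16 * M ^ 2) : ℕ) : ℝ) * ε ≤ N * (16 * ε) := by nlinarith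
    exact le_of_mul_le_mul_left (jg.trans je) kq
  obtain ⟨Ψ, ⟨ba, R, hR, jm, jq⟩, sb⟩ := hK i (mkDat q M hq jc) ε ja ho hM _ (fun j x => hb j _) hT
  have hd : 0 < q * R := by positivity
  have hdr : (0:ℝ) < ((q * R : ℕ) : ℝ) := by exact_mod_cast hd
  obtain ⟨φ, pa, pb, pc⟩ := localise (ψ := fun x : ℤ => Ψ ((x : ZMod (q * (16 * M ^ 2))))) (fun x => ba _) hd (κ := q / (ε ^ K * M)) (R := ε ^ (2 * K + 2) * M) (by positivity) (fun x => by
    rw [le_div_iff₀ (by positivity)]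
    have ea : ((x + ((q * R : ℕ) : ℤ) : ℤ) : ZMod (q * (16 * M ^ 2))) = (x : ZMod (q * (16 * M ^ 2))) + (q * R) • (1 : ZMod (q * (16 * M ^ 2))) := by
      push_cast; simp
    rw [ea]
    exact jq _)
  refine ⟨φ, R, pa, hR, jm, pb, ?_⟩
  have eb : ((q * (16 * M ^ 2) : ℕ) : ℝ) * ε ^ K ≤ ‖∑ x ∈ Icc (1:ℤ) N, f i x * Ψ ((x : ZMod (q * (16 * M ^ 2))))‖ := by
    have := sum_lift hL (hs i) (fun x : ZMod (q * (16 * M ^ 2)) => Ψ x)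
    rw [← this]
    have sc : ε ^ K ≤ ‖𝔼 x : ZMod (q * (16 * M ^ 2)), f i ((x.val : ℕ) : ℤ) * Ψ x‖ := sb
    rw [Fintype.expect_eq_sum_div_card, ZMod.card, norm_div, Complex.norm_natCast, le_div_iff₀ kq] at sc
    linarith
  have ec : ‖∑ x ∈ Icc (1:ℤ) N, f i x * Ψ ((x : ZMod (q * (16 * M ^ 2))))‖ - ‖∑ x ∈ Icc (1:ℤ) N, f i x * φ x‖ ≤ N * ε ^ (K + 2) := by
    refine (norm_sub_norm_le _ _).trans ?_
    rw [← sum_sub_distrib]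
    refine (norm_sum_le _ _).trans ((sum_le_card_nsmul _ _ (ε ^ (K + 2)) fun x _ => ?_).trans (by simp))
    rw [← mul_sub, norm_mul, norm_sub_rev]
    refine (mul_le_of_le_one_left (norm_nonneg _) (hb _ _)).trans ((pc x).trans ?_)
    have kj : (1:ℝ) ≤ R := by exact_mod_cast hR
    have hq0 : (0:ℝ) < q := by exact_mod_cast hq
    have : ε ^ (2 * K + 2) * M / ((q * R : ℕ) : ℝ) * (q / (ε ^ K * M)) = ε ^ (K + 2) / R := by
      push_cast
      have : ε ^ (2 * K + 2) = ε ^ (K + 2) * ε ^ K := by ring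
      rw [this]; field_simp
    rw [this]
    exact div_le_self (by positivity) kj
  have ed : ε ^ (K + 2) ≤ ε ^ K / 2 := by
    rw [pow_add]
    have : ε ^ 2 ≤ 1/2 := by nlinarith
    have := mul_le_mul_of_nonneg_left this (show 0 ≤ ε ^ K by positivity)
    linarith
  have := pow_pos ja K
  nlinarith
end CutNorm

/-- **Full cut norm inverse theorem.** -/
theorem full_cut_norm_inverse :
    ∃ C c : ℝ, 0 < C ∧ 0 < c ∧
      ∀ (q N : ℕ), 0 < q → q ≤ N → ∀ (δ : ℝ) (f : ℤ → ℂ), 0 < δ →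
        (∀ x, ‖f x‖ ≤ 1) →
        (∀ x, f x ≠ 0 → x ∈ Finset.Icc (1 : ℤ) (N : ℤ)) →
        δ ≤ cutNorm q N f →
        ((N : ℝ) ≤ C * ((q : ℝ) / δ) ^ C ∨
          ∃ (φ₁ φ₂ : ℤ → ℂ) (M₁ M₂ : ℝ) (q₁ q₂ : ℕ),
            (∀ x, ‖φ₁ x‖ ≤ 1) ∧ (∀ x, ‖φ₂ x‖ ≤ 1) ∧ 0 < q₁ ∧ 0 < q₂ ∧
            IsLocalFunction φ₁ M₁ (q * q₁) ∧ IsLocalFunction φ₂ M₂ (q * q₂) ∧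
            c * (δ / (q : ℝ)) ^ C * Real.sqrt N ≤ M₁ ∧
            c * (δ / (q : ℝ)) ^ C * Real.sqrt N ≤ M₂ ∧
            (q₁ : ℝ) ≤ C * δ ^ (-C) ∧ (q₂ : ℝ) ≤ C * δ ^ (-C) ∧
            c * δ ^ C * N ≤
              ‖∑ x ∈ Finset.Icc (1 : ℤ) (N : ℤ), f x * φ₁ x * φ₂ x‖) := by
  obtain ⟨K, jr, hK⟩ := CutNorm.zinv
  obtain ⟨n, hn⟩ : ∃ n : ℕ, n = 4 * 128 ^ (2 * K + 2) := ⟨_, rfl⟩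
  have hnK : 2 * K + 2 ≤ n := by
    have := (Nat.lt_pow_self (n := 2 * K + 2) (a := 128) (by norm_num))
    omega
  have ju : 0 < n := by omega
  have hnr : (0:ℝ) < n := by exact_mod_cast ju
  have kk : (1:ℝ) ≤ n := by exact_mod_cast ju
  have hnc : (n:ℝ) = 4 * 128 ^ (2 * K + 2) := by rw [hn]; push_cast; rfl
  refine ⟨n, 1 / n, hnr, by positivity, fun q N hq hN δ f hδ hb hs hcut => ?_⟩
  have hel : δ ≤ 1 ∧ ∃ (F : Fin 3 → ℤ → ℂ) (i : Fin 3), F i = f ∧ (∀ i x, ‖F i x‖ ≤ 1) ∧ (∀ i x, F i x ≠ 0 → x ∈ Finset.Icc (1:ℤ) N) ∧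
      δ / 2 ≤ ‖cntOp q N (F 0) (F 1) (F 2)‖ := by
    have key : ∀ r ∈ {r : ℝ | ∃ g₁ g₂ : ℤ → ℂ, (∀ x, ‖g₁ x‖ ≤ 1) ∧ (∀ x, ‖g₂ x‖ ≤ 1) ∧ (∀ x, g₁ x ≠ 0 → x ∈ Finset.Icc (1 : ℤ) (N : ℤ)) ∧
        (∀ x, g₂ x ≠ 0 → x ∈ Finset.Icc (1 : ℤ) (N : ℤ)) ∧ (r = ‖cntOp q N f g₁ g₂‖ ∨ r = ‖cntOp q N g₁ f g₂‖ ∨ r = ‖cntOp q N g₁ g₂ f‖)},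
        ∃ (F : Fin 3 → ℤ → ℂ) (i : Fin 3), F i = f ∧ (∀ i x, ‖F i x‖ ≤ 1) ∧ (∀ i x, F i x ≠ 0 → x ∈ Finset.Icc (1:ℤ) N) ∧
        r = ‖cntOp q N (F 0) (F 1) (F 2)‖ := by
      rintro r ⟨g₁, g₂, ba, bb, sa, sb, h | h | h⟩
      · exact ⟨![f, g₁, g₂], 0, rfl, by simp [Fin.forall_fin_succ]; exact ⟨hb, ba, bb⟩, Fin.forall_fin_succ.2 ⟨hs, Fin.forall_fin_two.2 ⟨sa, sb⟩⟩, h⟩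
      · exact ⟨![g₁, f, g₂], 1, rfl, by simp [Fin.forall_fin_succ]; exact ⟨ba, hb, bb⟩, Fin.forall_fin_succ.2 ⟨sa, Fin.forall_fin_two.2 ⟨hs, sb⟩⟩, h⟩
      · exact ⟨![g₁, g₂, f], 2, rfl, by simp [Fin.forall_fin_succ]; exact ⟨ba, bb, hb⟩, Fin.forall_fin_succ.2 ⟨sa, Fin.forall_fin_two.2 ⟨sb, hs⟩⟩, h⟩
    have hne : Set.Nonempty {r : ℝ | ∃ g₁ g₂ : ℤ → ℂ, (∀ x, ‖g₁ x‖ ≤ 1) ∧ (∀ x, ‖g₂ x‖ ≤ 1) ∧ (∀ x, g₁ x ≠ 0 → x ∈ Finset.Icc (1 : ℤ) (N : ℤ)) ∧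
        (∀ x, g₂ x ≠ 0 → x ∈ Finset.Icc (1 : ℤ) (N : ℤ)) ∧ (r = ‖cntOp q N f g₁ g₂‖ ∨ r = ‖cntOp q N g₁ f g₂‖ ∨ r = ‖cntOp q N g₁ g₂ f‖)} :=
      ⟨_, 0, 0, by simp, by simp, by simp, by simp, Or.inl rfl⟩
    constructor
    · refine hcut.trans (csSup_le hne fun r hr => ?_)
      obtain ⟨F, i, -, hFb, -, rfl⟩ := key r hr
      exact (CutNorm.cnt_le hq hN hFb).1
    · obtain ⟨r, hr, hlt⟩ := exists_lt_of_lt_csSup hne (show δ / 2 < _ from lt_of_lt_of_le (by linarith) hcut)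
      obtain ⟨F, i, e, hFb, hFs, rfl⟩ := key r hr
      exact ⟨F, i, e, hFb, hFs, hlt.le⟩
  obtain ⟨hδ1, F, i, rfl, hFb, hFs, hF⟩ := hel
  obtain ⟨jc, ab, aa⟩ := CutNorm.arith hq hN
  have hKK := hK q N hq hN δ hδ hδ1 F hFb hFs i hF
  generalize Nat.sqrt (N / q) = M at *
  have hMr : (0:ℝ) < M := by exact_mod_cast jc
  have kh : (1:ℝ) ≤ q := by exact_mod_cast hq
  have hq0 : (0:ℝ) < q := by linarith
  have a2r : (N:ℝ) ≤ 4 * (q * M ^ 2) := by exact_mod_cast aa.le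
  have hδp : ∀ k, 0 < δ ^ k := fun k => pow_pos hδ k
  have hp : ∀ k, k ≤ n → δ ^ n ≤ δ ^ k := fun k hk => pow_le_pow_of_le_one hδ.le hδ1 hk
  have hc128 : ∀ k, k ≤ 2 * K + 2 → 4 * (128:ℝ) ^ k ≤ n := fun k hk => by
    rw [hnc]; gcongr; norm_num
  have hneg : δ ^ (-(n:ℝ)) = (δ ^ n)⁻¹ := by rw [Real.rpow_neg hδ.le, Real.rpow_natCast]
  rw [Real.rpow_natCast, Real.rpow_natCast, Real.rpow_natCast, hneg]
  by_cases hM : 1 ≤ (δ / 128) ^ K * (M:ℝ)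
  · right
    obtain ⟨φ, R, pa, hR, jm, pb, pc⟩ := hKK hM
    have hres : 1 / (n:ℝ) * (δ / q) ^ n * Real.sqrt N ≤ (δ / 128) ^ (2 * K + 2) * M := by
      have sa : Real.sqrt N ≤ 2 * q * M := by
        refine Real.sqrt_le_iff.2 ⟨by positivity, a2r.trans ?_⟩
        nlinarith [mul_le_mul_of_nonneg_right kh (show (0:ℝ) ≤ q * M ^ 2 by positivity)]
      have sb : (δ / q) ^ n ≤ δ ^ (2 * K + 2) / q := by
        rw [div_pow]
        exact div_le_div₀ (hδp _).le (hp _ hnK) hq0 (le_self_pow₀ kh ju.ne')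
      calc 1 / (n:ℝ) * (δ / q) ^ n * Real.sqrt N ≤ 1 / (n:ℝ) * (δ ^ (2 * K + 2) / q) * (2 * q * M) := by gcongr
        _ = (2 * δ ^ (2 * K + 2) * M) / n := by field_simp
        _ ≤ (2 * δ ^ (2 * K + 2) * M) / (2 * 128 ^ (2 * K + 2)) := by
            have := hc128 _ le_rfl
            have h128 : (0:ℝ) < 128 ^ (2 * K + 2) := by positivity
            gcongr
            linarith
        _ = _ := by rw [div_pow]; field_simp
    have hinv : 1 ≤ (δ ^ n)⁻¹ := (one_le_inv₀ (hδp n)).2 (pow_le_one₀ hδ.le hδ1)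
    refine ⟨φ, fun _ => 1, (δ / 128) ^ (2 * K + 2) * M, (δ / 128) ^ (2 * K + 2) * M, R, 1, pa, by simp, hR, one_pos, pb, ⟨0, fun _ _ _ _ => rfl⟩, hres, hres, ?_, ?_, ?_⟩
    · rw [← div_eq_mul_inv, le_div_iff₀ (hδp n)]
      rw [div_pow, ← mul_div_assoc, div_le_one (by positivity)] at jm
      have := hc128 K (by omega)
      have h128 : (0:ℝ) < 128 ^ K := by positivity
      have := mul_le_mul_of_nonneg_left (hp K (by omega)) (Nat.cast_nonneg (α := ℝ) R)
      linarith
    · push_cast; nlinarith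
    · simp only [mul_one]
      refine le_trans (mul_le_mul_of_nonneg_right ?_ (Nat.cast_nonneg _)) pc
      rw [div_pow, div_div, one_div_mul_eq_div]
      have := hc128 K (by omega)
      have h128 : (0:ℝ) < 128 ^ K := by positivity
      exact div_le_div₀ (hδp _).le (hp _ (by omega)) (by positivity) (by linarith)
  · left
    rw [not_le, div_pow, div_mul_eq_mul_div, div_lt_one (by positivity)] at hM
    have jb : (δ ^ K * M) ^ 2 ≤ (128 ^ K) ^ 2 := pow_le_pow_left₀ (by positivity) hM.le 2
    have jd := hc128 (2 * K) (by omega)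
    have je : (q:ℝ) ≤ q ^ n := le_self_pow₀ kh ju.ne'
    rw [div_pow, ← mul_div_assoc, le_div_iff₀ (hδp n)]
    calc (N:ℝ) * δ ^ n ≤ 4 * (q * M ^ 2) * δ ^ (2 * K) := mul_le_mul a2r (hp _ (by omega)) (hδp _).le (by positivity)
      _ = 4 * (δ ^ K * M) ^ 2 * q := by ring
      _ ≤ 4 * (128 ^ K) ^ 2 * q ^ n := by gcongr
      _ = 4 * 128 ^ (2 * K) * q ^ n := by ring
      _ ≤ n * q ^ n := by gcongr
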